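/- arXiv:2601.14585 — 2 statements merged into one kernel-verified Lean document; each statement's English description precedes it below -/
import Mathlib

section
/- Let S₁ and S₂ be maximal star decompositions of a common cyclic polygon P, with respect to diagonal sets D₁ and D₂ respectively. Then S₁ can be transformed into S₂ by a finite sequence of diagonal flips, i.e., there is a finite sequence D₁ = F₀, F₁, …, F_t = D₂ of diagonal sets such that P has a maximal star decomposition with respect to each Fᵢ and each Fᵢ₊₁ is obtained from Fᵢ by a diagonal flip. -/
open Complex
open scoped Classical

noncomputable section

/-- The anticlockwise arc displacement from `u` to `v` on the unit circle, lying in `(0, 2π]`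
(equal to `2π` when `v = u`). -/
def posArc (u v : ℂ) : ℝ :=
  if 0 < Complex.arg (v / u) then Complex.arg (v / u) else Complex.arg (v / u) + 2 * Real.pi

/-- `u, v, w` occur in anticlockwise order on the circle. -/
def ACW (u v w : ℂ) : Prop :=
  u ≠ v ∧ v ≠ w ∧ u ≠ w ∧ posArc u v < posArc u w

/-- The open anticlockwise arc from `u` to `v`. -/
def arcOO (u v : ℂ) : Set ℂ := {x | x ≠ u ∧ x ≠ v ∧ posArc u x < posArc u v}

/-- The anticlockwise arc from `u` to `v`, open at `u` and closed at `v`. -/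
def arcOC (u v : ℂ) : Set ℂ := {x | x ≠ u ∧ (x = v ∨ posArc u x < posArc u v)}

/-- The closed anticlockwise arc from `u` to `v`. -/
def arcCC (u v : ℂ) : Set ℂ := {x | x = u ∨ x = v ∨ (x ≠ u ∧ posArc u x < posArc u v)}

/-- The (undirected) angle `∠ x v z` at apex `v`. -/
def vangle (x v z : ℂ) : ℝ := |Complex.arg ((x - v) / (z - v))|

/-- A cyclic polygon: a finite set of vertices on the unit circle together with a set of
directed edges such that every vertex has indegree and outdegree one, and any two
consecutive edges `uv`, `vw` have `u, v, w` in anticlockwise order. -/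
structure CyclicPolygon where
  V : Finset ℂ
  E : Finset (ℂ × ℂ)
  nonempty : V.Nonempty
  onCircle : ∀ v ∈ V, ‖v‖ = 1
  endmem : ∀ e ∈ E, e.1 ∈ V ∧ e.2 ∈ V
  outdeg : ∀ v ∈ V, ∃! w, (v, w) ∈ E
  indeg : ∀ v ∈ V, ∃! u, (u, v) ∈ E
  acw : ∀ u v w : ℂ, (u, v) ∈ E → (v, w) ∈ E → ACW u v w

namespace CyclicPolygon

/-- The successor `v⁺` of a vertex. -/
noncomputable def next (P : CyclicPolygon) (v : ℂ) : ℂ :=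
  if h : ∃ w, (v, w) ∈ P.E then h.choose else v

/-- The predecessor `v⁻` of a vertex. -/
noncomputable def prev (P : CyclicPolygon) (v : ℂ) : ℂ :=
  if h : ∃ u, (u, v) ∈ P.E then h.choose else v

end CyclicPolygon

/-- The interior angle `∠ v⁻ v v⁺` of `P` at `v`. -/
def interiorAngle (P : CyclicPolygon) (v : ℂ) : ℝ :=
  vangle (P.prev v) v (P.next v)

/-- The length of an edge `uv`: the number of vertices on the open anticlockwise
arc from `u` to `v`, plus one. -/
def edgeLength (P : CyclicPolygon) (u v : ℂ) : ℕ :=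
  ((P.V : Set ℂ) ∩ arcOO u v).ncard + 1

/-- A `k`-star: a cyclic polygon with `2k+1` vertices all of whose edges have length `k`. -/
def IsKStar (S : CyclicPolygon) (k : ℕ) : Prop :=
  S.V.card = 2 * k + 1 ∧ ∀ e ∈ S.E, edgeLength S e.1 e.2 = k

/-- A star: a `k`-star for some positive integer `k`. -/
def IsStar (S : CyclicPolygon) : Prop := ∃ k : ℕ, 0 < k ∧ IsKStar S k

/-- The segment from `u` to `x` splits the interior angle `∠ u⁻ u u⁺` of `S` at `u`
into the two (smaller, nonzero) angles `∠ u⁻ u x` and `∠ x u u⁺`. -/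
def SplitsVertexAngle (S : CyclicPolygon) (u x : ℂ) : Prop :=
  u ∈ S.V ∧ 0 < vangle (S.prev u) u x ∧ 0 < vangle x u (S.next u) ∧
    vangle (S.prev u) u x + vangle x u (S.next u) = vangle (S.prev u) u (S.next u)

/-- `(u, v)` is a linkable pair for the pair of cyclic polygons `(S₁, S₂)`:
the segment `uv` splits the angle of `S₁` at `u` and the angle of `S₂` at `v`. -/
def LinkablePair (S₁ S₂ : CyclicPolygon) (u v : ℂ) : Prop :=
  u ≠ v ∧ SplitsVertexAngle S₁ u v ∧ SplitsVertexAngle S₂ v u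

/-- `u, v` is a linkable pair of vertices of the cyclic polygon `P`. -/
def Linkable (P : CyclicPolygon) (u v : ℂ) : Prop := LinkablePair P P u v

/-- `D` is a set of (undirected) diagonals of `P`, i.e. every member joins a linkable pair. -/
def IsDiagonalSet (P : CyclicPolygon) (D : Set (Sym2 ℂ)) : Prop :=
  ∀ u v : ℂ, s(u, v) ∈ D → Linkable P u v

/-- The set `D̃` of directed edges associated to a set of diagonals `D`. -/
def tilde (D : Set (Sym2 ℂ)) : Set (ℂ × ℂ) := {e | s(e.1, e.2) ∈ D}

/-- The segment from `v` towards `x` splits the angle `∠ u v w`. -/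
def SplitsAngle3 (u v w x : ℂ) : Prop :=
  0 < vangle u v x ∧ 0 < vangle x v w ∧ vangle u v x + vangle x v w = vangle u v w

/-- `𝒮` is a star decomposition of `P` with respect to the diagonal set `D`: the
cycle decomposition of `E ∪ D̃` determined by `f_next` (each cycle follows the
tightest turn, i.e. no diagonal of `D` splits the angle between two consecutive
edges of a cycle), all of whose cycles are stars. -/
def IsStarDecomp (P : CyclicPolygon) (D : Set (Sym2 ℂ)) (𝒮 : Finset CyclicPolygon) : Prop :=
  IsDiagonalSet P D ∧
  (∀ S ∈ 𝒮, IsStar S ∧ (S.V : Set ℂ) ⊆ (P.V : Set ℂ)) ∧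
  (∀ S ∈ 𝒮, (S.E : Set (ℂ × ℂ)) ⊆ (P.E : Set (ℂ × ℂ)) ∪ tilde D) ∧
  (∀ e ∈ (P.E : Set (ℂ × ℂ)) ∪ tilde D, ∃ S ∈ 𝒮, e ∈ S.E) ∧
  (∀ S₁ ∈ 𝒮, ∀ S₂ ∈ 𝒮, S₁ ≠ S₂ → ∀ e : ℂ × ℂ, e ∈ S₁.E → e ∉ S₂.E) ∧
  (∀ S ∈ 𝒮, ∀ u v w : ℂ, (u, v) ∈ S.E → (v, w) ∈ S.E →
      ¬ ∃ x, s(v, x) ∈ D ∧ SplitsAngle3 u v w x)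

/-- `P` admits a star decomposition with respect to `D`. -/
def HasStarDecomp (P : CyclicPolygon) (D : Set (Sym2 ℂ)) : Prop :=
  ∃ 𝒮 : Finset CyclicPolygon, IsStarDecomp P D 𝒮

/-- A maximal star decomposition: no proper superset of `D` admits a star decomposition. -/
def IsMaximalStarDecomp (P : CyclicPolygon) (D : Set (Sym2 ℂ))
    (𝒮 : Finset CyclicPolygon) : Prop :=
  IsStarDecomp P D 𝒮 ∧ ∀ D' : Set (Sym2 ℂ), D ⊂ D' → ¬ HasStarDecomp P D'

/-- `D'` is obtained from `D` by a diagonal flip: remove one diagonal and add another. -/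
def FlipStep (D D' : Set (Sym2 ℂ)) : Prop :=
  ∃ e f : Sym2 ℂ, e ∈ D ∧ f ∉ D ∧ D' = (D \ {e}) ∪ {f}

/-- The two chords `ab` and `cd` are crossing: they share no endpoint and
intersect inside the circle. -/
def Crossing (a b c d : ℂ) : Prop :=
  a ≠ c ∧ a ≠ d ∧ b ≠ c ∧ b ≠ d ∧ (openSegment ℝ a b ∩ openSegment ℝ c d).Nonempty

/-- The two chords `ab` and `cd` share a common point: they have a common
endvertex or intersect inside the circle. -/
def ShareCommonPoint (a b c d : ℂ) : Prop :=
  a = c ∨ a = d ∨ b = c ∨ b = d ∨ (openSegment ℝ a b ∩ openSegment ℝ c d).Nonempty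

/-- Two cyclic polygons have a pair of overlapped angles: a common vertex `y` and a vertex
`x` of either polygon lying on both arcs `⦅y⁺ y⁻⟧` (taken in each polygon). -/
def OverlappedAngles (S₁ S₂ : CyclicPolygon) : Prop :=
  ∃ y : ℂ, y ∈ S₁.V ∧ y ∈ S₂.V ∧
    ∃ x : ℂ, (x ∈ S₁.V ∨ x ∈ S₂.V) ∧
      x ∈ arcOC (S₁.next y) (S₁.prev y) ∧ x ∈ arcOC (S₂.next y) (S₂.prev y)

/-- Two cyclic polygons are mutually independent: no two of their angles are overlapped. -/
def IndepPolygons (S₁ S₂ : CyclicPolygon) : Prop := ¬ OverlappedAngles S₁ S₂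

/-- The edge `uv` of `P` is minimal: no edge `xy` of `P` has all vertices of the closed
arc from `x` to `y` inside the open arc from `u` to `v`. -/
def MinimalEdge (P : CyclicPolygon) (u v : ℂ) : Prop :=
  (u, v) ∈ P.E ∧
    ¬ ∃ x y : ℂ, (x, y) ∈ P.E ∧ ∀ z ∈ P.V, z ∈ arcCC x y → z ∈ arcOO u v

/-- `vs` enumerates the star `S` as `v₀ v₁ ⋯ v₂ₖ` with `v₁ = v`, `v₀ = v⁻` (so that `v⁻v`
is an edge of `S`), each edge of `S` is an edge of `P` or a diagonal of `P`, and all the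
edges `v₂ᵢ₋₁v₂ᵢ` are edges of `P`. -/
def IsBorderCandidate (P : CyclicPolygon) (v : ℂ) (S : CyclicPolygon) (k : ℕ)
    (vs : ℕ → ℂ) : Prop :=
  0 < k ∧ IsStar S ∧ S.V.card = 2 * k + 1 ∧
  (S.V : Set ℂ) ⊆ (P.V : Set ℂ) ∧
  vs 0 = P.prev v ∧ vs 1 = v ∧ vs (2 * k + 1) = vs 0 ∧
  (∀ x ∈ S.V, ∃ i ≤ 2 * k, vs i = x) ∧
  (∀ i ≤ 2 * k, (vs i, vs (i + 1)) ∈ S.E) ∧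
  (∀ i ≤ 2 * k, (vs i, vs (i + 1)) ∈ P.E ∨ Linkable P (vs i) (vs (i + 1))) ∧
  (∀ i : ℕ, 1 ≤ i → i ≤ k → (vs (2 * i - 1), vs (2 * i)) ∈ P.E)

/-- The angle sequence `(∠v₁v₂v₃, ∠v₃v₄v₅, …, ∠v₂ₖ₋₁v₂ₖv₀)` of an enumerated star. -/
noncomputable def angleList (vs : ℕ → ℂ) (k : ℕ) : List ℝ :=
  (List.range k).map fun i => vangle (vs (2 * i + 1)) (vs (2 * i + 2)) (vs (2 * i + 3))

/-- `S` is the border star `S*(P, v)`: among all border candidates, its angle sequence is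
lexicographically minimal. -/
def IsBorderStar (P : CyclicPolygon) (v : ℂ) (S : CyclicPolygon) : Prop :=
  ∃ (k : ℕ) (vs : ℕ → ℂ), IsBorderCandidate P v S k vs ∧
    ∀ (S' : CyclicPolygon) (k' : ℕ) (vs' : ℕ → ℂ), IsBorderCandidate P v S' k' vs' →
      ¬ List.Lex (· < ·) (angleList vs' k') (angleList vs k)



namespace StarFlip

section Word

variable {α ι : Type*} (κ : α → ℤ) (A : Set α) (lo hi : ι → α)

/-- The product of the adjacent swaps attached to the letters of `Q` that are not in `D`. -/
def W (Q : List ι) (D : Set ι) : Equiv.Perm α :=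
  (Q.map fun e => if e ∈ D then 1 else Equiv.swap (lo e) (hi e)).prod

/-- The number of letters of `Q` that are not in `D`. -/
def cnt (Q : List ι) (D : Set ι) : ℕ :=
  (Q.map fun e => if e ∈ D then 0 else 1).sum

/-- The letter `e` is attached to an adjacent pair of `A`. -/
structure Adj (e : ι) : Prop where
  lo_mem : lo e ∈ A
  hi_mem : hi e ∈ A
  lt : κ (lo e) < κ (hi e)
  adj : ∀ x ∈ A, x ≠ lo e → x ≠ hi e → (κ x < κ (lo e) ↔ κ x < κ (hi e))

/-- Reducedness of a subword. -/
def Red : List ι → Set ι → Prop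
  | [], _ => True
  | q :: Q, D => Red Q D ∧
      (q ∈ D ∨ κ ((W lo hi Q D)⁻¹ (lo q)) < κ ((W lo hi Q D)⁻¹ (hi q)))

variable {κ A lo hi}

lemma W_cons_mem {q : ι} {Q : List ι} {D : Set ι} (h : q ∈ D) :
    W lo hi (q :: Q) D = W lo hi Q D := by simp [W, h]

lemma W_cons_not_mem {q : ι} {Q : List ι} {D : Set ι} (h : q ∉ D) :
    W lo hi (q :: Q) D = Equiv.swap (lo q) (hi q) * W lo hi Q D := by simp [W, h]

lemma cnt_cons_mem {q : ι} {Q : List ι} {D : Set ι} (h : q ∈ D) :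
    cnt (q :: Q) D = cnt Q D := by simp [cnt, h]

lemma cnt_cons_not_mem {q : ι} {Q : List ι} {D : Set ι} (h : q ∉ D) :
    cnt (q :: Q) D = cnt Q D + 1 := by simp [cnt, h]; omega

lemma W_congr {Q : List ι} {D D' : Set ι} (h : ∀ e ∈ Q, (e ∈ D ↔ e ∈ D')) :
    W lo hi Q D = W lo hi Q D' := by
  unfold W
  congr 1
  apply List.map_congr_left
  intro e he
  simp [h e he]

lemma cnt_congr {Q : List ι} {D D' : Set ι} (h : ∀ e ∈ Q, (e ∈ D ↔ e ∈ D')) :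
    cnt Q D = cnt Q D' := by
  unfold cnt
  congr 1
  apply List.map_congr_left
  intro e he
  simp [h e he]

lemma Red_congr {Q : List ι} {D D' : Set ι} (h : ∀ e ∈ Q, (e ∈ D ↔ e ∈ D')) :
    Red κ lo hi Q D ↔ Red κ lo hi Q D' := by
  induction Q with
  | nil => simp [Red]
  | cons q Q ih =>
    have h' : ∀ e ∈ Q, (e ∈ D ↔ e ∈ D') := fun e he => h e (List.mem_cons_of_mem _ he)
    simp only [Red]
    rw [ih h', W_congr h', h q List.mem_cons_self]

lemma cnt_insert {Q : List ι} {D : Set ι} {e : ι} (hQ : Q.Nodup) (he : e ∈ Q) (heD : e ∉ D) :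
    cnt Q D = cnt Q (insert e D) + 1 := by
  induction Q with
  | nil => simp at he
  | cons q Q ih =>
    rw [List.nodup_cons] at hQ
    by_cases hqe : q = e
    · subst hqe
      rw [cnt_cons_not_mem heD, cnt_cons_mem (Set.mem_insert _ _)]
      congr 1
      apply cnt_congr
      intro f hf
      have : f ≠ q := by rintro rfl; exact hQ.1 hf
      simp [this]
    · have he' : e ∈ Q := by
        rcases List.mem_cons.1 he with h | h
        · exact absurd h.symm hqe
        · exact h
      have := ih hQ.2 he'
      by_cases hq : q ∈ D
      · rw [cnt_cons_mem hq, cnt_cons_mem (Set.mem_insert_of_mem _ hq), this]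
      · rw [cnt_cons_not_mem hq, cnt_cons_not_mem, this]
        simp [hq, hqe]

lemma cnt_mono {Q : List ι} {D D' : Set ι} (h : D ⊆ D') : cnt Q D' ≤ cnt Q D := by
  induction Q with
  | nil => simp [cnt]
  | cons q Q ih =>
    by_cases hq : q ∈ D
    · rw [cnt_cons_mem hq, cnt_cons_mem (h hq)]; exact ih
    · rw [cnt_cons_not_mem hq]
      by_cases hq' : q ∈ D'
      · rw [cnt_cons_mem hq']; omega
      · rw [cnt_cons_not_mem hq']; omega

lemma Adj.swap_lt {e : ι} (h : Adj κ A lo hi e) (hκ : Function.Injective κ) {a b : α}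
    (ha : a ∈ A) (hb : b ∈ A) (hab : κ a < κ b) (hne : ¬ (a = lo e ∧ b = hi e)) :
    κ (Equiv.swap (lo e) (hi e) a) < κ (Equiv.swap (lo e) (hi e) b) := by
  have hlt := h.lt
  have h1 := h.adj a ha
  have h2 := h.adj b hb
  have hia : ∀ c, a ≠ c → κ a ≠ κ c := fun c hc hh => hc (hκ hh)
  have hib : ∀ c, b ≠ c → κ b ≠ κ c := fun c hc hh => hc (hκ hh)
  have q1 := hia (lo e)
  have q2 := hia (hi e)
  have q3 := hib (lo e)
  have q4 := hib (hi e)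
  by_cases c1 : a = lo e <;> by_cases c2 : a = hi e <;> by_cases c3 : b = lo e <;>
    by_cases c4 : b = hi e <;>
    simp only [Equiv.swap_apply_def, c1, c2, c3, c4, if_true, if_false, true_and, not_true,
      ne_eq, not_false_iff, forall_const] at * <;> first | omega | (simp_all; done) | (simp_all; omega)

lemma Adj.swap_mem {e : ι} (h : Adj κ A lo hi e) {a : α} (ha : a ∈ A) :
    Equiv.swap (lo e) (hi e) a ∈ A := by
  rw [Equiv.swap_apply_def]
  split_ifs
  · exact h.hi_mem
  · exact h.lo_mem
  · exact ha

lemma exchange (hκ : Function.Injective κ) {Q : List ι} (hQ : Q.Nodup)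
    (hA : ∀ e ∈ Q, Adj κ A lo hi e) (D : Set ι) {a b : α} (ha : a ∈ A) (hb : b ∈ A)
    (hab : κ a < κ b)
    (hw : κ ((W lo hi Q D)⁻¹ b) < κ ((W lo hi Q D)⁻¹ a)) :
    ∃ e ∈ Q, e ∉ D ∧ W lo hi Q (insert e D) = Equiv.swap a b * W lo hi Q D := by
  induction Q generalizing a b with
  | nil => simp [W] at hw; omega
  | cons q Q ih =>
    rw [List.nodup_cons] at hQ
    have hA' : ∀ e ∈ Q, Adj κ A lo hi e := fun e he => hA e (List.mem_cons_of_mem _ he)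
    have hq := hA q List.mem_cons_self
    by_cases hqD : q ∈ D
    · rw [W_cons_mem hqD] at hw
      obtain ⟨e, he, heD, hW⟩ := ih hQ.2 hA' ha hb hab hw
      refine ⟨e, List.mem_cons_of_mem _ he, heD, ?_⟩
      rw [W_cons_mem (Set.mem_insert_of_mem _ hqD), W_cons_mem hqD, hW]
    · rw [W_cons_not_mem hqD] at hw
      by_cases hc : a = lo q ∧ b = hi q
      · refine ⟨q, List.mem_cons_self, hqD, ?_⟩
        rw [W_cons_mem (Set.mem_insert _ _), W_cons_not_mem hqD, hc.1, hc.2, ← mul_assoc,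
          Equiv.swap_mul_self, one_mul]
        apply W_congr
        intro f hf
        have : f ≠ q := by rintro rfl; exact hQ.1 hf
        simp [this]
      · have h1 := hq.swap_lt hκ ha hb hab hc
        obtain ⟨e, he, heD, hW⟩ := ih hQ.2 hA' (hq.swap_mem ha) (hq.swap_mem hb) h1
          (by simpa [mul_inv_rev] using hw)
        have hqe : q ≠ e := by rintro rfl; exact hQ.1 he
        refine ⟨e, List.mem_cons_of_mem _ he, heD, ?_⟩
        rw [W_cons_not_mem (by simp [hqe, hqD]), W_cons_not_mem hqD, hW]
        have := Equiv.swap_apply_apply (Equiv.swap (lo q) (hi q)) a b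
        rw [this, Equiv.swap_inv]
        simp only [← mul_assoc]
        rw [Equiv.swap_mul_self, one_mul]

lemma red_min (hκ : Function.Injective κ) {Q : List ι} 
    (hA : ∀ e ∈ Q, Adj κ A lo hi e) {D : Set ι} (hR : Red κ lo hi Q D)
    {Q' : List ι} (hQ' : Q'.Nodup) (hA' : ∀ e ∈ Q', Adj κ A lo hi e) {D' : Set ι}
    (hW : W lo hi Q' D' = W lo hi Q D) : cnt Q D ≤ cnt Q' D' := by
  induction Q generalizing D' with
  | nil => simp [cnt]
  | cons q Q ih =>
    have hA1 : ∀ e ∈ Q, Adj κ A lo hi e := fun e he => hA e (List.mem_cons_of_mem _ he)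
    have hq := hA q List.mem_cons_self
    by_cases hqD : q ∈ D
    · rw [cnt_cons_mem hqD]
      rw [W_cons_mem hqD] at hW
      exact ih hA1 hR.1 hW
    · have h2 := hR.2.resolve_left hqD
      rw [W_cons_not_mem hqD] at hW
      obtain ⟨e, he, heD, hE⟩ := exchange hκ hQ' hA' D' hq.lo_mem hq.hi_mem hq.lt
        (by rw [hW]; simpa [mul_inv_rev] using h2)
      rw [hW, ← mul_assoc, Equiv.swap_mul_self, one_mul] at hE
      have := ih hA1 hR.1 hE
      rw [cnt_cons_not_mem hqD, cnt_insert hQ' he heD]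
      omega

lemma not_red (hκ : Function.Injective κ) {Q : List ι} (hQ : Q.Nodup)
    (hA : ∀ e ∈ Q, Adj κ A lo hi e) {D : Set ι} (hR : ¬ Red κ lo hi Q D) :
    ∃ D', D ⊆ D' ∧ (∀ e ∈ D', e ∈ D ∨ e ∈ Q) ∧ W lo hi Q D' = W lo hi Q D ∧
      cnt Q D' < cnt Q D := by
  induction Q with
  | nil => simp [Red] at hR
  | cons q Q ih =>
    rw [List.nodup_cons] at hQ
    have hA' : ∀ e ∈ Q, Adj κ A lo hi e := fun e he => hA e (List.mem_cons_of_mem _ he)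
    have hq := hA q List.mem_cons_self
    by_cases hR' : Red κ lo hi Q D
    · have h2 : ¬ (q ∈ D ∨ κ ((W lo hi Q D)⁻¹ (lo q)) < κ ((W lo hi Q D)⁻¹ (hi q))) :=
        fun h => hR ⟨hR', h⟩
      push Not at h2
      obtain ⟨hqD, h3⟩ := h2
      have h4 : κ ((W lo hi Q D)⁻¹ (hi q)) ≠ κ ((W lo hi Q D)⁻¹ (lo q)) := by
        intro h
        have h5 := (W lo hi Q D)⁻¹.injective (hκ h)
        have := hq.lt
        rw [h5] at this
        exact lt_irrefl _ this
      obtain ⟨e, he, heD, hE⟩ := exchange hκ hQ.2 hA' D hq.lo_mem hq.hi_mem hq.lt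
        (lt_of_le_of_ne h3 h4)
      have hcong : ∀ f ∈ Q, (f ∈ insert q (insert e D) ↔ f ∈ insert e D) := by
        intro f hf
        have : f ≠ q := by rintro rfl; exact hQ.1 hf
        simp [this]
      refine ⟨insert q (insert e D), ?_, ?_, ?_, ?_⟩
      · intro f hf
        simp [hf]
      · intro f hf
        simp only [Set.mem_insert_iff] at hf
        rcases hf with rfl | rfl | hf
        · simp
        · simp [he]
        · simp [hf]
      · rw [W_cons_mem (Set.mem_insert _ _), W_cons_not_mem hqD, W_congr hcong, hE]
      · rw [cnt_cons_mem (Set.mem_insert _ _), cnt_cons_not_mem hqD, cnt_congr hcong,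
          cnt_insert hQ.2 he heD]
        omega
    · obtain ⟨D', h1, h2, h3, h4⟩ := ih hQ.2 hA' hR'
      refine ⟨D', h1, ?_, ?_, ?_⟩
      · intro e he
        rcases h2 e he with h | h
        · simp [h]
        · simp [h]
      · by_cases hqD : q ∈ D
        · rw [W_cons_mem hqD, W_cons_mem (h1 hqD), h3]
        · have : q ∉ D' := fun h => (h2 q h).elim hqD hQ.1
          rw [W_cons_not_mem hqD, W_cons_not_mem this, h3]
      · by_cases hqD : q ∈ D
        · rw [cnt_cons_mem hqD, cnt_cons_mem (h1 hqD)]; exact h4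
        · have : q ∉ D' := fun h => (h2 q h).elim hqD hQ.1
          rw [cnt_cons_not_mem hqD, cnt_cons_not_mem this]; omega

/-- One flip leading to a reduced subword with product `g`. -/
def RStep (κ : α → ℤ) (lo hi : ι → α) (Q : List ι) (g : Equiv.Perm α) (D D' : Set ι) : Prop :=
  (∀ e ∈ D', e ∈ Q) ∧ Red κ lo hi Q D' ∧ W lo hi Q D' = g ∧
    ∃ e f, e ∈ D ∧ f ∉ D ∧ D' = (D \ {e}) ∪ {f}

lemma red_connected (hκ : Function.Injective κ) {Q : List ι} (hQ : Q.Nodup)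
    (hA : ∀ e ∈ Q, Adj κ A lo hi e) (g : Equiv.Perm α) {D₁ D₂ : Set ι}
    (s₁ : ∀ e ∈ D₁, e ∈ Q) (s₂ : ∀ e ∈ D₂, e ∈ Q)
    (r₁ : Red κ lo hi Q D₁) (r₂ : Red κ lo hi Q D₂)
    (w₁ : W lo hi Q D₁ = g) (w₂ : W lo hi Q D₂ = g) :
    Relation.ReflTransGen (fun X Y => (∀ e ∈ X, e ∈ Q) ∧ RStep κ lo hi Q g X Y) D₁ D₂ := by
  induction Q generalizing g D₁ D₂ with
  | nil =>
    have h1 : D₁ = ∅ := by ext e; simpa using s₁ e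
    have h2 : D₂ = ∅ := by ext e; simpa using s₂ e
    rw [h1, h2]
  | cons q Q ih =>
    have hQ0 := hQ
    rw [List.nodup_cons] at hQ
    have hA' : ∀ e ∈ Q, Adj κ A lo hi e := fun e he => hA e (List.mem_cons_of_mem _ he)
    have hq := hA q List.mem_cons_self
    have sub_of : ∀ D : Set ι, (∀ e ∈ D, e ∈ q :: Q) → q ∉ D → ∀ e ∈ D, e ∈ Q := by
      intro D hD hqD e he
      rcases List.mem_cons.1 (hD e he) with rfl | h
      · exact absurd he hqD
      · exact h
    -- both use `q`
    have case1 : ∀ E₁ E₂ : Set ι, (∀ e ∈ E₁, e ∈ q :: Q) → (∀ e ∈ E₂, e ∈ q :: Q) →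
        Red κ lo hi (q :: Q) E₁ → Red κ lo hi (q :: Q) E₂ → W lo hi (q :: Q) E₁ = g →
        W lo hi (q :: Q) E₂ = g → q ∉ E₁ → q ∉ E₂ → Relation.ReflTransGen
          (fun X Y => (∀ e ∈ X, e ∈ q :: Q) ∧ RStep κ lo hi (q :: Q) g X Y) E₁ E₂ := by
      intro E₁ E₂ s₁ s₂ r₁ r₂ w₁ w₂ h₁ h₂
      rw [W_cons_not_mem h₁] at w₁
      rw [W_cons_not_mem h₂] at w₂
      have hw₁ : W lo hi Q E₁ = Equiv.swap (lo q) (hi q) * g := by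
        rw [← w₁, ← mul_assoc, Equiv.swap_mul_self, one_mul]
      have hw₂ : W lo hi Q E₂ = Equiv.swap (lo q) (hi q) * g := by
        rw [← w₂, ← mul_assoc, Equiv.swap_mul_self, one_mul]
      have key := ih hQ.2 hA' _ (sub_of _ s₁ h₁) (sub_of _ s₂ h₂) r₁.1 r₂.1 hw₁ hw₂
      have hred := r₁.2.resolve_left h₁
      rw [hw₁] at hred
      refine Relation.ReflTransGen.mono ?_ _ _ key
      rintro X Y ⟨hX, hY, hYr, hYw, hflip⟩
      have hqY : q ∉ Y := fun h => hQ.1 (hY q h)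
      refine ⟨fun e he => List.mem_cons_of_mem _ (hX e he),
        fun e he => List.mem_cons_of_mem _ (hY e he), ⟨hYr, Or.inr ?_⟩, ?_, hflip⟩
      · rw [hYw]; exact hred
      · rw [W_cons_not_mem hqY, hYw, ← mul_assoc, Equiv.swap_mul_self, one_mul]
    -- both drop `q`
    have case2 : q ∈ D₁ → q ∈ D₂ → Relation.ReflTransGen
          (fun X Y => (∀ e ∈ X, e ∈ q :: Q) ∧ RStep κ lo hi (q :: Q) g X Y) D₁ D₂ := by
      intro h₁ h₂
      have hc : ∀ D : Set ι, ∀ e ∈ Q, (e ∈ D \ {q} ↔ e ∈ D) := by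
        intro D e he
        have : e ≠ q := by rintro rfl; exact hQ.1 he
        simp [this]
      have hc2 : ∀ D : Set ι, ∀ e ∈ Q, (e ∈ insert q D ↔ e ∈ D) := by
        intro D e he
        have : e ≠ q := by rintro rfl; exact hQ.1 he
        simp [this]
      rw [W_cons_mem h₁] at w₁
      rw [W_cons_mem h₂] at w₂
      have key := ih hQ.2 hA' g (D₁ := D₁ \ {q}) (D₂ := D₂ \ {q})
        (sub_of _ (fun e he => s₁ e he.1) (by simp)) (sub_of _ (fun e he => s₂ e he.1) (by simp))
        ((Red_congr (hc _)).2 r₁.1) ((Red_congr (hc _)).2 r₂.1)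
        (by rw [W_congr (hc _), w₁]) (by rw [W_congr (hc _), w₂])
      have := Relation.ReflTransGen.lift (p := (fun X Y => (∀ e ∈ X, e ∈ q :: Q) ∧
        RStep κ lo hi (q :: Q) g X Y)) (fun X => insert q X) ?_ _ _ key
      · simpa [Function.onFun, Set.insert_sdiff_singleton, Set.insert_eq_of_mem h₁, Set.insert_eq_of_mem h₂]
          using this
      · rintro X Y ⟨hX, hY, hYr, hYw, e, f, he, hf, hflip⟩
        have hqe : e ≠ q := by rintro rfl; exact hQ.1 (hX _ he)
        have hqf : f ≠ q := by
          rintro rfl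
          exact hQ.1 (hY _ (by rw [hflip]; simp))
        refine ⟨?_, ?_, ⟨(Red_congr (hc2 _)).2 hYr, Or.inl (Set.mem_insert _ _)⟩, ?_, e, f, ?_, ?_, ?_⟩
        · intro e he
          rcases he with rfl | he
          · simp
          · exact List.mem_cons_of_mem _ (hX e he)
        · intro e he
          rcases he with rfl | he
          · simp
          · exact List.mem_cons_of_mem _ (hY e he)
        · show W lo hi (q :: Q) (insert q Y) = g
          rw [W_cons_mem (Set.mem_insert _ _), W_congr (hc2 _), hYw]
        · exact Set.mem_insert_of_mem _ he
        · simp [hqf, hf]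
        · show insert q Y = (insert q X \ {e}) ∪ {f}
          rw [hflip]
          ext z
          simp only [Set.mem_insert_iff, Set.mem_union, Set.mem_sdiff, Set.mem_singleton_iff]
          constructor
          · rintro (rfl | h | h)
            · exact Or.inl ⟨Or.inl rfl, hqe.symm⟩
            · exact Or.inl ⟨Or.inr h.1, h.2⟩
            · exact Or.inr h
          · tauto
    -- exchange
    have case3 : ∀ E₁ E₂ : Set ι, (∀ e ∈ E₁, e ∈ q :: Q) → (∀ e ∈ E₂, e ∈ q :: Q) →
        Red κ lo hi (q :: Q) E₁ → Red κ lo hi (q :: Q) E₂ → W lo hi (q :: Q) E₁ = g →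
        W lo hi (q :: Q) E₂ = g → q ∉ E₁ → q ∈ E₂ → ∃ E₃ : Set ι, (∀ e ∈ E₃, e ∈ q :: Q) ∧
          Red κ lo hi (q :: Q) E₃ ∧ W lo hi (q :: Q) E₃ = g ∧ q ∉ E₃ ∧ ∃ e, e ∉ E₂ ∧ e ∈ E₃ ∧
          E₃ = (E₂ \ {q}) ∪ {e} ∧ E₂ = (E₃ \ {e}) ∪ {q} := by
      intro E₁ E₂ s₁ s₂ r₁ r₂ w₁ w₂ h₁ h₂
      have hred := r₁.2.resolve_left h₁
      have w₂' := w₂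
      rw [W_cons_mem h₂] at w₂'
      rw [W_cons_not_mem h₁] at w₁
      have hw₁ : W lo hi Q E₁ = Equiv.swap (lo q) (hi q) * g := by
        rw [← w₁, ← mul_assoc, Equiv.swap_mul_self, one_mul]
      rw [hw₁] at hred
      obtain ⟨e, he, heD, hE⟩ := exchange hκ hQ.2 hA' E₂ hq.lo_mem hq.hi_mem hq.lt
        (by rw [w₂']; simpa [mul_inv_rev] using hred)
      have heq : e ≠ q := by rintro rfl; exact hQ.1 he
      have hc : ∀ f ∈ Q, (f ∈ (E₂ \ {q}) ∪ {e} ↔ f ∈ insert e E₂) := by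
        intro f hf
        have : f ≠ q := by rintro rfl; exact hQ.1 hf
        simp [this]
      have hq3 : q ∉ (E₂ \ {q}) ∪ {e} := by simp [heq.symm]
      have hW3 : W lo hi (q :: Q) ((E₂ \ {q}) ∪ {e}) = g := by
        rw [W_cons_not_mem hq3, W_congr hc, hE, w₂', ← mul_assoc, Equiv.swap_mul_self, one_mul]
      refine ⟨(E₂ \ {q}) ∪ {e}, ?_, ?_, hW3, hq3, e, heD, by simp, rfl, ?_⟩
      · rintro f (hf | hf)
        · exact s₂ f hf.1
        · rw [Set.mem_singleton_iff.1 hf]; exact List.mem_cons_of_mem _ he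
      · by_contra hnr
        obtain ⟨D', -, -, hW', hcnt⟩ := not_red hκ hQ0 hA hnr
        have := red_min hκ hA r₂ hQ0 hA (D' := D') (by rw [hW', hW3, w₂])
        rw [cnt_cons_not_mem hq3, cnt_congr hc] at hcnt
        rw [cnt_cons_mem h₂, cnt_insert hQ.2 he heD] at this
        omega
      · ext z
        simp only [Set.mem_union, Set.mem_sdiff, Set.mem_singleton_iff]
        constructor
        · intro hz
          by_cases hzq : z = q
          · exact Or.inr hzq
          · exact Or.inl ⟨Or.inl ⟨hz, hzq⟩, by rintro rfl; exact heD hz⟩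
        · rintro (⟨h | h, h'⟩ | h)
          · exact h.1
          · exact absurd h h'
          · rw [h]; exact h₂
    by_cases h₁ : q ∈ D₁ <;> by_cases h₂ : q ∈ D₂
    · exact case2 h₁ h₂
    · obtain ⟨E₃, s₃, r₃, w₃, h₃, e, he, he3, hE, hE'⟩ := case3 D₂ D₁ s₂ s₁ r₂ r₁ w₂ w₁ h₂ h₁
      refine Relation.ReflTransGen.head ?_ (case1 E₃ D₂ s₃ s₂ r₃ r₂ w₃ w₂ h₃ h₂)
      exact ⟨s₁, s₃, r₃, w₃, q, e, h₁, he, hE⟩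
    · obtain ⟨E₃, s₃, r₃, w₃, h₃, e, he, he3, hE, hE'⟩ := case3 D₁ D₂ s₁ s₂ r₁ r₂ w₁ w₂ h₁ h₂
      refine Relation.ReflTransGen.tail (case1 D₁ E₃ s₁ s₃ r₁ r₃ w₁ w₃ h₁ h₃) ?_
      exact ⟨s₃, s₂, r₂, w₂, e, q, he3, h₃, hE'⟩
    · exact case1 D₁ D₂ s₁ s₂ r₁ r₂ w₁ w₂ h₁ h₂

/-- `D` is a maximal set of letters that may be dropped with product `g`. -/
def WMax (lo hi : ι → α) (Q : List ι) (g : Equiv.Perm α) (D : Set ι) : Prop :=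
  (∀ e ∈ D, e ∈ Q) ∧ W lo hi Q D = g ∧
    ∀ D', D ⊂ D' → (∀ e ∈ D', e ∈ Q) → W lo hi Q D' ≠ g

lemma WMax_iff (hκ : Function.Injective κ) {Q : List ι} (hQ : Q.Nodup)
    (hA : ∀ e ∈ Q, Adj κ A lo hi e) (g : Equiv.Perm α) (D : Set ι) :
    WMax lo hi Q g D ↔ (∀ e ∈ D, e ∈ Q) ∧ W lo hi Q D = g ∧ Red κ lo hi Q D := by
  constructor
  · rintro ⟨h1, h2, h3⟩
    refine ⟨h1, h2, ?_⟩
    by_contra hnr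
    obtain ⟨D', hs, hs', hW, hc⟩ := not_red hκ hQ hA hnr
    refine h3 D' ⟨hs, fun h => ?_⟩ (fun e he => (hs' e he).elim (h1 e) id) (hW.trans h2)
    have := cnt_mono (Q := Q) h
    omega
  · rintro ⟨h1, h2, h3⟩
    refine ⟨h1, h2, ?_⟩
    rintro D' ⟨hs, hs'⟩ hQ' hW
    have h4 := red_min hκ hA h3 hQ hA (hW.trans h2.symm)
    obtain ⟨e, he, heD⟩ := Set.not_subset.1 hs'
    have h5 := cnt_insert hQ (hQ' e he) heD
    have h6 : cnt Q D' ≤ cnt Q (insert e D) := cnt_mono (Set.insert_subset he hs)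
    omega

theorem word_connected (hκ : Function.Injective κ) {Q : List ι} (hQ : Q.Nodup)
    (hA : ∀ e ∈ Q, Adj κ A lo hi e) (g : Equiv.Perm α) {D₁ D₂ : Set ι}
    (h₁ : WMax lo hi Q g D₁) (h₂ : WMax lo hi Q g D₂) :
    Relation.ReflTransGen (fun X Y => (∀ e ∈ X, e ∈ Q) ∧ WMax lo hi Q g Y ∧
      ∃ e f, e ∈ X ∧ f ∉ X ∧ Y = (X \ {e}) ∪ {f}) D₁ D₂ := by
  rw [WMax_iff hκ hQ hA] at h₁ h₂
  refine Relation.ReflTransGen.mono ?_ _ _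
    (red_connected hκ hQ hA g h₁.1 h₂.1 h₁.2.2 h₂.2.2 h₁.2.1 h₂.2.1)
  rintro X Y ⟨hX, hY, hr, hw, hf⟩
  exact ⟨hX, (WMax_iff hκ hQ hA g Y).2 ⟨hY, hw, hr⟩, hf⟩

end Word

end StarFlip


namespace StarFlip

/-- The combinatorial data of a cyclic polygon, lifted to the universal cover of the circle:
the vertices are the integers (modulo `N`), `σ` is the successor, `τ` the predecessor. -/
structure Comb where
  N : ℕ
  σ : ℤ → ℤ
  τ : ℤ → ℤ
  hN : 0 < N
  στ : ∀ i, σ (τ i) = i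
  τσ : ∀ i, τ (σ i) = i
  σ_add : ∀ i, σ (i + N) = σ i + N
  τ_add : ∀ i, τ (i + N) = τ i + N
  lt_σ : ∀ i, i < σ i
  acw : ∀ i, σ i < τ i + N

namespace Comb

variable (K : Comb)

lemma τ_lt (i : ℤ) : K.τ i < i := by
  have := K.lt_σ (K.τ i)
  rwa [K.στ] at this

/-- Lifted linkable pairs. -/
def L (a b : ℤ) : Prop := K.σ a < b ∧ b < K.τ a + K.N ∧ K.σ b < a + K.N ∧ a < K.τ b

/-- `D` is a lifted set of diagonals. -/
structure IsDiag (D : ℤ → ℤ → Prop) : Prop where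
  link : ∀ a b, D a b → K.L a b
  flip : ∀ a b, D a b ↔ D b (a + K.N)

/-- Lifted chords: diagonals and edges. -/
def C (D : ℤ → ℤ → Prop) (a b : ℤ) : Prop := D a b ∨ b = K.σ a ∨ b = K.τ a + K.N

/-- The step of the sweep at time `t`. -/
def st (D : ℤ → ℤ → Prop) (t j : ℤ) : ℤ := if K.C D j (t - j) ∨ K.C D (t - j) j then t - j else j

/-- Active bisectors pointing outwards. -/
def Out (t j : ℤ) : Prop := K.σ j ≤ t - j ∧ t - j < K.τ j + K.N

/-- Active bisectors pointing inwards. -/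
def In (t j : ℤ) : Prop := K.σ j ≤ t - j + K.N ∧ t - j < K.τ j

/-- Active bisectors. -/
def Act (t j : ℤ) : Prop := K.Out t j ∨ K.In t j

/-- Deck transformation. -/
def fl (t j : ℤ) : ℤ := if 2 * j ≤ t then j + K.N else j

/-- Position of a bisector at time `t`. -/
def kap (t j : ℤ) : ℤ := min (2 * j) (2 * t + 1 - 2 * j)

variable {K}

lemma isDiag_L : K.IsDiag K.L where
  link := fun a b h => h
  flip := by
    intro a b
    have h1 := K.σ_add a
    have h2 := K.τ_add a
    unfold L
    constructor
    · rintro ⟨h3, h4, h5, h6⟩; refine ⟨?_, ?_, ?_, ?_⟩ <;> omega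
    · rintro ⟨h3, h4, h5, h6⟩; refine ⟨?_, ?_, ?_, ?_⟩ <;> omega

lemma L_ne {a b : ℤ} (h : K.L a b) : a < b ∧ b < a + K.N ∧ b ≠ K.σ a ∧ b ≠ K.τ a + K.N := by
  have h1 := K.lt_σ a
  have h2 := K.τ_lt a
  obtain ⟨h3, h4, h5, h6⟩ := h
  refine ⟨?_, ?_, ?_, ?_⟩ <;> omega

section
variable {D : ℤ → ℤ → Prop}

lemma C_cases (hD : K.IsDiag D) {a b : ℤ} (h : K.C D a b) :
    (K.σ a < b ∧ b < K.τ a + K.N ∧ K.σ b < a + K.N ∧ a < K.τ b) ∨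
    (b = K.σ a ∧ a = K.τ b) ∨ (b = K.τ a + K.N ∧ K.σ b = a + K.N) := by
  rcases h with h | h | h
  · exact Or.inl (hD.link a b h)
  · right; left
    exact ⟨h, by rw [h, K.τσ]⟩
  · right; right
    exact ⟨h, by rw [h, K.σ_add, K.στ]⟩

lemma C_lt (hD : K.IsDiag D) {a b : ℤ} (h : K.C D a b) : a < b ∧ b < a + K.N := by
  have h1 := K.lt_σ a
  have h2 := K.τ_lt a
  have h3 := K.acw a
  rcases C_cases hD h with h | h | h <;> constructor <;> omega

lemma C_flip (hD : K.IsDiag D) {a b : ℤ} : K.C D a b ↔ K.C D b (a + K.N) := by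
  unfold C
  rw [hD.flip]
  have e1 : b = K.σ a ↔ a + K.N = K.τ b + K.N := by
    constructor
    · intro h; rw [h, K.τσ]
    · intro h
      have : a = K.τ b := by omega
      rw [this, K.στ]
  have e2 : b = K.τ a + K.N ↔ a + K.N = K.σ b := by
    constructor
    · intro h; rw [h, K.σ_add, K.στ]
    · intro h
      have := K.τσ b
      rw [← h, K.τ_add] at this
      exact this.symm
  rw [e1, e2]
  tauto

lemma C_σ (a : ℤ) : K.C D a (K.σ a) := Or.inr (Or.inl rfl)
lemma C_τ (a : ℤ) : K.C D (K.τ a) a := Or.inr (Or.inl (K.στ a).symm)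
lemma C_τ' (a : ℤ) : K.C D a (K.τ a + K.N) := Or.inr (Or.inr rfl)
lemma C_σ' (hD : K.IsDiag D) (a : ℤ) : K.C D (K.σ a - K.N) a := by
  rw [C_flip hD]
  have : K.σ a - K.N + K.N = K.σ a := by ring
  rw [this]
  exact C_σ a

lemma st_invol (t : ℤ) : Function.Involutive (K.st D t) := by
  intro j
  unfold st
  by_cases h : K.C D j (t - j) ∨ K.C D (t - j) j
  · rw [if_pos h, if_pos]
    · ring
    · rw [show t - (t - j) = j by ring]; exact h.symm
  · rw [if_neg h, if_neg h]

lemma st_of_out (hD : K.IsDiag D) {t j : ℤ} (h : K.Out (t - 1) j) :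
    (K.C D j (t - j) ∧ K.st D t j = t - j ∧ K.In t (t - j)) ∨
    (¬ K.C D j (t - j) ∧ K.st D t j = j ∧ K.Out t j) := by
  have h1 := K.lt_σ j
  have h2 := K.τ_lt j
  have h3 := K.acw j
  have h4 := K.acw (t - j)
  obtain ⟨h5, h6⟩ := h
  have hn : ¬ K.C D (t - j) j := fun h => by have := (C_lt hD h).1; omega
  by_cases hC : K.C D j (t - j)
  · left
    refine ⟨hC, by simp [st, hC], ?_⟩
    unfold In
    rcases C_cases hD hC with h | h | h <;> constructor <;> omega
  · right
    refine ⟨hC, by simp [st, hC, hn], ?_⟩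
    have : t - j ≠ K.τ j + K.N := fun h => hC (by rw [h]; exact C_τ' j)
    unfold Out
    constructor <;> omega

lemma st_of_in (hD : K.IsDiag D) {t j : ℤ} (h : K.In (t - 1) j) :
    (K.C D (t - j) j ∧ K.st D t j = t - j ∧ K.Out t (t - j)) ∨
    (¬ K.C D (t - j) j ∧ K.st D t j = j ∧ K.In t j) := by
  have h1 := K.lt_σ j
  have h2 := K.τ_lt j
  have h3 := K.acw j
  have h4 := K.acw (t - j)
  obtain ⟨h5, h6⟩ := h
  have hn : ¬ K.C D j (t - j) := fun h => by have := (C_lt hD h).1; omega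
  by_cases hC : K.C D (t - j) j
  · left
    refine ⟨hC, by simp [st, hC], ?_⟩
    unfold Out
    rcases C_cases hD hC with h | h | h <;> constructor <;> omega
  · right
    refine ⟨hC, by simp [st, hC, hn], ?_⟩
    have : t - j ≠ K.τ j := fun h => hC (by rw [h]; exact C_τ j)
    unfold In
    constructor <;> omega

lemma st_to_out (hD : K.IsDiag D) {t j : ℤ} (h : K.Out t j) :
    (K.C D j (t - j) ∧ K.st D t j = t - j ∧ K.In (t - 1) (t - j)) ∨
    (¬ K.C D j (t - j) ∧ K.st D t j = j ∧ K.Out (t - 1) j) := by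
  have h1 := K.lt_σ j
  have h2 := K.τ_lt j
  have h3 := K.acw j
  have h4 := K.acw (t - j)
  obtain ⟨h5, h6⟩ := h
  have hn : ¬ K.C D (t - j) j := fun h => by have := (C_lt hD h).1; omega
  by_cases hC : K.C D j (t - j)
  · left
    refine ⟨hC, by simp [st, hC], ?_⟩
    unfold In
    rcases C_cases hD hC with h | h | h <;> constructor <;> omega
  · right
    refine ⟨hC, by simp [st, hC, hn], ?_⟩
    have : t - j ≠ K.σ j := fun h => hC (by rw [h]; exact C_σ j)
    unfold Out
    constructor <;> omega

lemma st_to_in (hD : K.IsDiag D) {t j : ℤ} (h : K.In t j) :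
    (K.C D (t - j) j ∧ K.st D t j = t - j ∧ K.Out (t - 1) (t - j)) ∨
    (¬ K.C D (t - j) j ∧ K.st D t j = j ∧ K.In (t - 1) j) := by
  have h1 := K.lt_σ j
  have h2 := K.τ_lt j
  have h3 := K.acw j
  have h4 := K.acw (t - j)
  obtain ⟨h5, h6⟩ := h
  have hn : ¬ K.C D j (t - j) := fun h => by have := (C_lt hD h).1; omega
  by_cases hC : K.C D (t - j) j
  · left
    refine ⟨hC, by simp [st, hC], ?_⟩
    unfold Out
    rcases C_cases hD hC with h | h | h <;> constructor <;> omega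
  · right
    refine ⟨hC, by simp [st, hC, hn], ?_⟩
    have : t - j ≠ K.σ j - K.N := fun h => hC (by rw [h]; exact C_σ' hD j)
    unfold In
    constructor <;> omega

lemma act_step (hD : K.IsDiag D) {t j : ℤ} (h : K.Act (t - 1) j) : K.Act t (K.st D t j) := by
  rcases h with h | h
  · rcases st_of_out hD h with ⟨-, h1, h2⟩ | ⟨-, h1, h2⟩
    · rw [h1]; exact Or.inr h2
    · rw [h1]; exact Or.inl h2
  · rcases st_of_in hD h with ⟨-, h1, h2⟩ | ⟨-, h1, h2⟩
    · rw [h1]; exact Or.inl h2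
    · rw [h1]; exact Or.inr h2

lemma act_step_back (hD : K.IsDiag D) {t j : ℤ} (h : K.Act t j) : K.Act (t - 1) (K.st D t j) := by
  rcases h with h | h
  · rcases st_to_out hD h with ⟨-, h1, h2⟩ | ⟨-, h1, h2⟩
    · rw [h1]; exact Or.inr h2
    · rw [h1]; exact Or.inl h2
  · rcases st_to_in hD h with ⟨-, h1, h2⟩ | ⟨-, h1, h2⟩
    · rw [h1]; exact Or.inl h2
    · rw [h1]; exact Or.inr h2

lemma fl_out {t j : ℤ} (h : K.Out t j) : K.fl t j = j + K.N := by
  have h1 := K.lt_σ j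
  obtain ⟨h2, h3⟩ := h
  unfold fl
  rw [if_pos (by omega)]

lemma fl_in {t j : ℤ} (h : K.In t j) : K.fl t j = j := by
  have h1 := K.τ_lt j
  obtain ⟨h2, h3⟩ := h
  unfold fl
  rw [if_neg (by omega)]

lemma In_fl {t j : ℤ} (h : K.Out t j) : K.In (t + K.N) (j + K.N) := by
  have h1 := K.σ_add j
  have h4 := K.τ_add j
  obtain ⟨h2, h3⟩ := h
  unfold In
  constructor <;> omega

lemma Out_fl {t j : ℤ} (h : K.In t j) : K.Out (t + K.N) j := by
  obtain ⟨h2, h3⟩ := h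
  unfold Out
  constructor <;> omega

lemma act_fl {t j : ℤ} (h : K.Act t j) : K.Act (t + K.N) (K.fl t j) := by
  rcases h with h | h
  · rw [fl_out h]; exact Or.inr (In_fl h)
  · rw [fl_in h]; exact Or.inl (Out_fl h)

lemma st_fl (hD : K.IsDiag D) {t j : ℤ} (h : K.Act (t - 1) j) :
    K.st D (t + K.N) (K.fl (t - 1) j) = K.fl t (K.st D t j) := by
  rcases h with h | h
  · have hi : K.In (t + K.N - 1) (j + K.N) := by
      have := In_fl h
      rwa [show t - 1 + (K.N : ℤ) = t + K.N - 1 by ring] at this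
    have e : t + K.N - (j + K.N) = t - j := by ring
    rw [fl_out h]
    rcases st_of_out hD h with ⟨hC, h1, h2⟩ | ⟨hC, h1, h2⟩
    · rw [h1, fl_in h2]
      rcases st_of_in hD hi with ⟨-, h3, -⟩ | ⟨h3, -, -⟩
      · rw [h3, e]
      · rw [e, ← C_flip hD] at h3
        exact absurd hC h3
    · rw [h1, fl_out h2]
      rcases st_of_in hD hi with ⟨h3, -, -⟩ | ⟨-, h3, -⟩
      · rw [e, ← C_flip hD] at h3
        exact absurd h3 hC
      · rw [h3]
  · have hi : K.Out (t + K.N - 1) j := by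
      have := Out_fl h
      rwa [show t - 1 + (K.N : ℤ) = t + K.N - 1 by ring] at this
    have e : t + K.N - j = t - j + K.N := by ring
    rw [fl_in h]
    rcases st_of_in hD h with ⟨hC, h1, h2⟩ | ⟨hC, h1, h2⟩
    · rw [h1, fl_out h2]
      rcases st_of_out hD hi with ⟨-, h3, -⟩ | ⟨h3, -, -⟩
      · rw [h3, e]
      · rw [e, ← C_flip hD] at h3
        exact absurd hC h3
    · rw [h1, fl_in h2]
      rcases st_of_out hD hi with ⟨h3, -, -⟩ | ⟨-, h3, -⟩
      · rw [e, ← C_flip hD] at h3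
        exact absurd h3 hC
      · rw [h3]

lemma kap_out {t j : ℤ} (h : K.Out t j) : kap t j = 2 * j := by
  have h1 := K.lt_σ j
  obtain ⟨h2, h3⟩ := h
  unfold kap
  omega

lemma kap_in {t j : ℤ} (h : K.In t j) : kap t j = 2 * t + 1 - 2 * j := by
  have h1 := K.τ_lt j
  obtain ⟨h2, h3⟩ := h
  unfold kap
  omega

lemma kap_step (hD : K.IsDiag D) {t j : ℤ} (h : K.Act (t - 1) j) :
    kap (t - 1) j ≤ kap t (K.st D t j) ∧ kap t (K.st D t j) ≤ kap (t - 1) j + 2 := by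
  rcases h with h | h
  · rw [kap_out h]
    rcases st_of_out hD h with ⟨-, h1, h2⟩ | ⟨-, h1, h2⟩
    · rw [h1, kap_in h2]; omega
    · rw [h1, kap_out h2]; omega
  · rw [kap_in h]
    rcases st_of_in hD h with ⟨-, h1, h2⟩ | ⟨-, h1, h2⟩
    · rw [h1, kap_out h2]; omega
    · rw [h1, kap_in h2]; omega

lemma kap_inj (t : ℤ) : Function.Injective (kap t) := by
  intro x y h
  unfold kap at h
  omega

lemma L_of_both {t j : ℤ} (h : K.Out (t - 1) j) (h' : K.In (t - 1) (t - j)) :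
    K.L j (t - j) := by
  obtain ⟨h1, h2⟩ := h
  obtain ⟨h3, h4⟩ := h'
  have h5 : t - j ≠ K.τ j + K.N := by
    intro h
    have := K.στ j
    have h6 := K.σ_add (K.τ j)
    rw [← h] at h6
    omega
  have h6 : j ≠ K.τ (t - j) := by
    intro h
    have := K.στ (t - j)
    rw [← h] at this
    omega
  refine ⟨?_, ?_, ?_, ?_⟩ <;> omega

end

lemma kap_st_lt {t x y : ℤ} (hx : K.Act (t - 1) x) (hy : K.Act (t - 1) y)
    (h : kap (t - 1) x < kap (t - 1) y) : kap t (K.st K.L t x) < kap t (K.st K.L t y) := by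
  rcases hx with hx | hx <;> rcases hy with hy | hy
  · rw [kap_out hx, kap_out hy] at h
    rcases st_of_out isDiag_L hx with ⟨-, h1, h2⟩ | ⟨-, h1, h2⟩ <;>
    rcases st_of_out isDiag_L hy with ⟨-, h3, h4⟩ | ⟨-, h3, h4⟩ <;> rw [h1, h3] <;>
    (first | rw [kap_out h2] | rw [kap_in h2]) <;> (first | rw [kap_out h4] | rw [kap_in h4]) <;>
    omega
  · rw [kap_out hx, kap_in hy] at h
    rcases st_of_out isDiag_L hx with ⟨-, h1, h2⟩ | ⟨-, h1, h2⟩ <;>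
    rcases st_of_in isDiag_L hy with ⟨-, h3, h4⟩ | ⟨-, h3, h4⟩ <;> rw [h1, h3] <;>
    (first | rw [kap_out h2] | rw [kap_in h2]) <;> (first | rw [kap_out h4] | rw [kap_in h4]) <;>
    omega
  · rw [kap_in hx, kap_out hy] at h
    have hc : x = t - y → K.C K.L y (t - y) ∧ K.C K.L (t - x) x := by
      rintro rfl
      have := L_of_both hy hx
      exact ⟨Or.inl this, Or.inl (by rwa [sub_sub_cancel])⟩
    rcases st_of_in isDiag_L hx with ⟨c1, h1, h2⟩ | ⟨c1, h1, h2⟩ <;>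
    rcases st_of_out isDiag_L hy with ⟨c2, h3, h4⟩ | ⟨c2, h3, h4⟩
    · rw [h1, h3, kap_out h2, kap_in h4]; omega
    · have : x ≠ t - y := fun h => c2 (hc h).1
      rw [h1, h3, kap_out h2, kap_out h4]; omega
    · have : x ≠ t - y := fun h => c1 (hc h).2
      rw [h1, h3, kap_in h2, kap_in h4]; omega
    · have : x ≠ t - y := fun h => c1 (hc h).2
      rw [h1, h3, kap_in h2, kap_out h4]; omega
  · rw [kap_in hx, kap_in hy] at h
    rcases st_of_in isDiag_L hx with ⟨-, h1, h2⟩ | ⟨-, h1, h2⟩ <;>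
    rcases st_of_in isDiag_L hy with ⟨-, h3, h4⟩ | ⟨-, h3, h4⟩ <;> rw [h1, h3] <;>
    (first | rw [kap_out h2] | rw [kap_in h2]) <;> (first | rw [kap_out h4] | rw [kap_in h4]) <;>
    omega

end Comb
end StarFlip


namespace StarFlip
namespace Comb

variable {K : Comb} {D : ℤ → ℤ → Prop}

/-- A strand of the sweep. -/
structure Strand (K : Comb) (D : ℤ → ℤ → Prop) (j : ℤ → ℤ) : Prop where
  step : ∀ t, j t = K.st D t (j (t - 1))
  act : ∀ t, K.Act t (j t)

lemma strand_back {j : ℤ → ℤ} (h : Strand K D j) (t : ℤ) : j (t - 1) = K.st D t (j t) := by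
  rw [h.step t, st_invol]

lemma strand_ext {j j' : ℤ → ℤ} (h : Strand K D j) (h' : Strand K D j') {t0 : ℤ}
    (e : j t0 = j' t0) (t : ℤ) : j t = j' t := by
  refine Int.inductionOn' (motive := fun t => j t = j' t) t t0 e ?_ ?_
  · intro k _ ih
    rw [h.step, h'.step, show k + 1 - 1 = k by ring, ih]
  · intro k _ ih
    rw [strand_back h, strand_back h', ih]

/-- Forward recursion. -/
def fwd (K : Comb) (D : ℤ → ℤ → Prop) (t0 j0 : ℤ) : ℕ → ℤ
  | 0 => j0
  | n + 1 => K.st D (t0 + n + 1) (fwd K D t0 j0 n)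

/-- Backward recursion. -/
def bwd (K : Comb) (D : ℤ → ℤ → Prop) (t0 j0 : ℤ) : ℕ → ℤ
  | 0 => j0
  | n + 1 => K.st D (t0 - n) (bwd K D t0 j0 n)

lemma strand_exists (hD : K.IsDiag D) {t0 j0 : ℤ} (h : K.Act t0 j0) :
    ∃ j, Strand K D j ∧ j t0 = j0 := by
  have hf : ∀ n : ℕ, K.Act (t0 + n) (fwd K D t0 j0 n) := by
    intro n
    induction n with
    | zero => simpa [fwd] using h
    | succ n ih =>
      have := act_step hD (t := t0 + n + 1) (j := fwd K D t0 j0 n) (by simpa using ih)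
      simpa [fwd, add_assoc] using this
  have hb : ∀ n : ℕ, K.Act (t0 - n) (bwd K D t0 j0 n) := by
    intro n
    induction n with
    | zero => simpa [bwd] using h
    | succ n ih =>
      have := act_step_back hD ih
      simpa [bwd, sub_sub] using this
  set j : ℤ → ℤ := fun t => if t0 ≤ t then fwd K D t0 j0 (t - t0).toNat
    else bwd K D t0 j0 (t0 - t).toNat with hj
  have jf : ∀ n : ℕ, j (t0 + n) = fwd K D t0 j0 n := by
    intro n
    simp [hj]
  have jb : ∀ n : ℕ, j (t0 - n) = bwd K D t0 j0 n := by
    intro n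
    rcases Nat.eq_zero_or_pos n with rfl | hn
    · simp [hj, fwd, bwd]
    · simp only [hj]
      rw [if_neg (by omega)]
      congr 1
      omega
  refine ⟨j, ⟨?_, ?_⟩, by simpa [fwd] using jf 0⟩
  · intro t
    by_cases ht : t0 < t
    · obtain ⟨n, hn⟩ : ∃ n : ℕ, t = t0 + ((n + 1 : ℕ) : ℤ) := ⟨(t - t0 - 1).toNat, by omega⟩
      rw [hn, jf, show t0 + ((n + 1 : ℕ) : ℤ) - 1 = t0 + (n : ℤ) by push_cast; ring, jf]
      simp [fwd, add_assoc]
    · obtain ⟨n, hn⟩ : ∃ n : ℕ, t = t0 - (n : ℤ) := ⟨(t0 - t).toNat, by omega⟩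
      rw [hn, jb, show t0 - (n : ℤ) - 1 = t0 - ((n + 1 : ℕ) : ℤ) by push_cast; ring, jb]
      simp only [bwd]
      rw [st_invol]
  · intro t
    by_cases ht : t0 ≤ t
    · obtain ⟨n, hn⟩ : ∃ n : ℕ, t = t0 + (n : ℤ) := ⟨(t - t0).toNat, by omega⟩
      rw [hn, jf]; exact hf n
    · obtain ⟨n, hn⟩ : ∃ n : ℕ, t = t0 - (n : ℤ) := ⟨(t0 - t).toNat, by omega⟩
      rw [hn, jb]; exact hb n

lemma strand_shift (hD : K.IsDiag D) {j : ℤ → ℤ} (h : Strand K D j) :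
    Strand K D (fun t => K.fl (t - K.N) (j (t - K.N))) where
  step := by
    intro t
    have := st_fl hD (t := t - K.N) (h.act (t - K.N - 1))
    rw [← h.step, sub_add_cancel] at this
    rw [← this]
    congr 2 <;> ring_nf
  act := by
    intro t
    have := act_fl (h.act (t - K.N))
    rwa [sub_add_cancel] at this

lemma strand_per (hD : K.IsDiag D) {j : ℤ → ℤ} (h : Strand K D j) {t1 : ℤ}
    (e : j (t1 + K.N) = K.fl t1 (j t1)) (t : ℤ) : j (t + K.N) = K.fl t (j t) := by
  have := strand_ext h (strand_shift hD h) (t0 := t1 + K.N) (by simpa using e) (t + K.N)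
  simpa using this

/-- All strands are periodic. -/
def Per (K : Comb) (D : ℤ → ℤ → Prop) : Prop :=
  ∀ j, Strand K D j → ∀ t, j (t + K.N) = K.fl t (j t)

/-- The step as a permutation. -/
def stP (K : Comb) (D : ℤ → ℤ → Prop) (t : ℤ) : Equiv.Perm ℤ :=
  Function.Involutive.toPerm (K.st D t) (st_invol t)

lemma stP_apply (t x : ℤ) : stP K D t x = K.st D t x := rfl

/-- The composition of the first `m` steps. -/
def Ph (K : Comb) (D : ℤ → ℤ → Prop) : ℕ → Equiv.Perm ℤ
  | 0 => 1
  | m + 1 => stP K D (m + 1) * Ph K D m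

lemma strand_Ph {j : ℤ → ℤ} (h : Strand K D j) (m : ℕ) : j m = Ph K D m (j 0) := by
  induction m with
  | zero => simp [Ph]
  | succ m ih =>
    rw [h.step]
    simp only [Ph, Equiv.Perm.mul_apply, stP_apply]
    rw [← ih]
    push_cast
    congr 2
    ring

lemma per_iff (hD : K.IsDiag D) :
    Per K D ↔ ∀ j0, K.Act 0 j0 → Ph K D K.N j0 = K.fl 0 j0 := by
  constructor
  · intro h j0 h0
    obtain ⟨j, hj, e⟩ := strand_exists hD h0
    have := h j hj 0
    rw [zero_add, strand_Ph hj, e] at this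
    exact this
  · intro h j hj
    apply strand_per hD hj (t1 := 0)
    rw [zero_add, strand_Ph hj]
    exact h _ (hj.act 0)

lemma act_Ph (hD : K.IsDiag D) {x : ℤ} (m : ℕ) : K.Act 0 x → K.Act m (Ph K D m x) := by
  intro h
  obtain ⟨j, hj, e⟩ := strand_exists hD h
  have := hj.act m
  rwa [strand_Ph hj, e] at this

lemma act_Ph_symm (hD : K.IsDiag D) {x : ℤ} (m : ℕ) : K.Act m x → K.Act 0 ((Ph K D m)⁻¹ x) := by
  intro h
  obtain ⟨j, hj, e⟩ := strand_exists hD h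
  have := hj.act 0
  rw [strand_Ph hj] at e
  rw [← e]
  simpa using this

lemma kap_Ph_lt (m : ℕ) {x y : ℤ} (hx : K.Act 0 x) (hy : K.Act 0 y)
    (h : kap 0 x < kap 0 y) : kap m (Ph K K.L m x) < kap m (Ph K K.L m y) := by
  induction m with
  | zero => simpa [Ph] using h
  | succ m ih =>
    simp only [Ph, Equiv.Perm.mul_apply, stP_apply]
    have := kap_st_lt (K := K) (t := (m : ℤ) + 1) (by simpa using act_Ph isDiag_L m hx)
      (by simpa using act_Ph isDiag_L m hy) (by simpa using ih)
    simpa using this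

lemma kap_Ph_iff (m : ℕ) {x y : ℤ} (hx : K.Act 0 x) (hy : K.Act 0 y) :
    kap m (Ph K K.L m x) < kap m (Ph K K.L m y) ↔ kap 0 x < kap 0 y := by
  constructor
  · intro h
    by_contra h'
    rcases lt_or_eq_of_le (not_lt.mp h') with h2 | h2
    · exact absurd (kap_Ph_lt m hy hx h2) (by omega)
    · rw [kap_inj 0 h2] at h
      exact lt_irrefl _ h
  · exact kap_Ph_lt m hx hy

end Comb
end StarFlip


namespace StarFlip
namespace Comb

variable {K : Comb} {D : ℤ → ℤ → Prop}

lemma row_apply (t : ℤ) (c : ℤ → Prop) (l : List ℤ) (hl : l.Nodup) (h2 : ∀ a ∈ l, 2 * a < t)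
    (j : ℤ) : (l.map fun a => if c a then 1 else Equiv.swap a (t - a)).prod j =
      if (j ∈ l ∧ ¬ c j) ∨ (t - j ∈ l ∧ ¬ c (t - j)) then t - j else j := by
  induction l generalizing j with
  | nil => simp
  | cons a l ih =>
    rw [List.nodup_cons] at hl
    have ha := h2 a (by simp)
    have ih' := ih hl.2 (fun a ha => h2 a (by simp [ha]))
    rw [List.map_cons, List.prod_cons, Equiv.Perm.mul_apply, ih']
    have key : ∀ x, x ∈ l → x ≠ a ∧ 2 * x < t := fun x hx =>
      ⟨fun e => hl.1 (e ▸ hx), h2 x (by simp [hx])⟩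
    by_cases h1 : j ∈ l ∧ ¬ c j ∨ t - j ∈ l ∧ ¬ c (t - j)
    · have h1' : (j ∈ a :: l ∧ ¬ c j) ∨ (t - j ∈ a :: l ∧ ¬ c (t - j)) := by
        simp only [List.mem_cons]; tauto
      rw [if_pos h1, if_pos h1']
      by_cases hc : c a
      · rw [if_pos hc]; rfl
      · rw [if_neg hc]
        apply Equiv.swap_apply_of_ne_of_ne
        · rcases h1 with ⟨h, -⟩ | ⟨h, -⟩ <;> have := key _ h <;> omega
        · rcases h1 with ⟨h, -⟩ | ⟨h, -⟩ <;> have := key _ h <;> omega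
    · rw [if_neg h1]
      by_cases hc : c a
      · rw [if_pos hc, if_neg]
        · rfl
        · simp only [List.mem_cons]
          rintro (⟨rfl | h, h3⟩ | ⟨h | h, h3⟩)
          · exact h3 hc
          · exact h1 (Or.inl ⟨h, h3⟩)
          · rw [h] at h3; exact h3 hc
          · exact h1 (Or.inr ⟨h, h3⟩)
      · rw [if_neg hc]
        by_cases e1 : j = a
        · subst e1
          rw [Equiv.swap_apply_left, if_pos (by simp [hc])]
        · by_cases e2 : j = t - a
          · have e3 : t - j = a := by omega
            rw [e2, Equiv.swap_apply_right, if_pos]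
            · ring
            · right; rw [← e2, e3]; simp [hc]
          · rw [Equiv.swap_apply_of_ne_of_ne e1 e2, if_neg]
            have e3 : t - j ≠ a := by omega
            simpa [e1, e3] using h1

/-- The set of smaller endpoints of the linkable pairs with sum `t`. -/
def rowL (K : Comb) (t : ℤ) : List ℤ :=
  ((Finset.Icc (-(K.N : ℤ)) K.N).filter fun a => K.L a (t - a)).toList

lemma mem_rowL {t a : ℤ} (h1 : 1 ≤ t) (h2 : t ≤ K.N) : a ∈ rowL K t ↔ K.L a (t - a) := by
  simp only [rowL, Finset.mem_toList, Finset.mem_filter, Finset.mem_Icc]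
  constructor
  · exact fun h => h.2
  · intro h
    have := L_ne h
    refine ⟨⟨?_, ?_⟩, h⟩ <;> omega

lemma rowL_lt {t a : ℤ} (h : a ∈ rowL K t) : K.L a (t - a) := by
  simp only [rowL, Finset.mem_toList, Finset.mem_filter, Finset.mem_Icc] at h
  exact h.2

lemma stP_eq (hD : K.IsDiag D) {t : ℤ} (h1 : 1 ≤ t) (h2 : t ≤ K.N) :
    stP K D t = stP K K.L t *
      ((rowL K t).map fun a => if D a (t - a) then 1 else Equiv.swap a (t - a)).prod := by
  ext j
  rw [Equiv.Perm.mul_apply, row_apply t (fun a => D a (t - a)) (rowL K t) (Finset.nodup_toList _)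
    (fun a ha => by have := L_ne (rowL_lt ha); omega)]
  simp only [stP_apply, mem_rowL h1 h2, sub_sub_cancel]
  have hl := fun a b => hD.link a b
  split_ifs with h
  · rcases h with ⟨h, h'⟩ | ⟨h, h'⟩
    · have h3 := L_ne h
      have n1 : ¬ K.C D j (t - j) := by
        rintro (h4 | h4 | h4)
        · exact h' h4
        · exact h3.2.2.1 h4
        · exact h3.2.2.2 h4
      have n2 : ¬ K.C D (t - j) j := fun h => by have := (C_lt hD h).1; omega
      have p : K.C K.L j (t - j) := Or.inl h
      simp [st, n1, n2, p]
    · have h3 := L_ne h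
      have n1 : ¬ K.C D (t - j) j := by
        rintro (h4 | h4 | h4)
        · exact h' h4
        · exact h3.2.2.1 h4
        · exact h3.2.2.2 h4
      have n2 : ¬ K.C D j (t - j) := fun h => by have := (C_lt hD h).1; omega
      have p : K.C K.L (t - j) j := Or.inl h
      simp [st, n1, n2, p]
  · have e1 : D j (t - j) ↔ K.L j (t - j) := ⟨hl _ _, fun h' => by tauto⟩
    have e2 : D (t - j) j ↔ K.L (t - j) j := ⟨hl _ _, fun h' => by tauto⟩
    have e3 : K.C D j (t - j) ∨ K.C D (t - j) j ↔ K.C K.L j (t - j) ∨ K.C K.L (t - j) j := by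
      unfold C; rw [e1, e2]
    unfold st
    by_cases h' : K.C D j (t - j) ∨ K.C D (t - j) j
    · rw [if_pos h', if_pos (e3.mp h')]
    · rw [if_neg h', if_neg (fun x => h' (e3.mpr x))]

/-- The word of linkable pairs up to time `m`. -/
def Q (K : Comb) : ℕ → List (ℤ × ℤ)
  | 0 => []
  | m + 1 => ((rowL K (m + 1)).map fun a => (a, (m : ℤ) + 1 - a)) ++ Q K m

/-- Left end of the transposition. -/
def lo (K : Comb) (p : ℤ × ℤ) : ℤ := (Ph K K.L (p.1 + p.2 - 1).toNat)⁻¹ p.2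
/-- Right end of the transposition. -/
def hi (K : Comb) (p : ℤ × ℤ) : ℤ := (Ph K K.L (p.1 + p.2 - 1).toNat)⁻¹ p.1

lemma W_int {ι : Type*} (f g : ι → ℤ) (l : List ι) (X : Set ι) :
    W f g l X = (l.map fun e => if e ∈ X then 1 else Equiv.swap (f e) (g e)).prod := by
  unfold W
  congr 1
  apply List.map_congr_left
  intro e _
  split_ifs
  · rfl
  · congr 1
    exact Subsingleton.elim _ _

lemma mem_Q {m : ℕ} (hm : m ≤ K.N) {p : ℤ × ℤ} :
    p ∈ Q K m ↔ 1 ≤ p.1 + p.2 ∧ p.1 + p.2 ≤ m ∧ K.L p.1 p.2 := by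
  induction m with
  | zero =>
    simp only [Q, List.not_mem_nil, false_iff]
    omega
  | succ m ih =>
    rw [Q, List.mem_append, ih (by omega), List.mem_map]
    constructor
    · rintro (⟨a, h, rfl⟩ | h)
      · rw [mem_rowL (by omega) (by exact_mod_cast hm)] at h
        refine ⟨by simp, by simp, h⟩
      · exact ⟨h.1, by push_cast; omega, h.2.2⟩
    · rintro ⟨h1, h2, h3⟩
      by_cases h : p.1 + p.2 = m + 1
      · left
        have e : p.2 = (m : ℤ) + 1 - p.1 := by omega
        refine ⟨p.1, ?_, by rw [← e]⟩
        rw [mem_rowL (by omega) (by exact_mod_cast hm), ← e]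
        exact h3
      · right
        push_cast at h2
        exact ⟨h1, by omega, h3⟩

lemma nodup_Q {m : ℕ} (hm : m ≤ K.N) : (Q K m).Nodup := by
  induction m with
  | zero => simp [Q]
  | succ m ih =>
    rw [Q, List.nodup_append]
    refine ⟨?_, ih (by omega), ?_⟩
    · apply List.Nodup.map _ (Finset.nodup_toList _)
      intro a b h
      exact (Prod.ext_iff.mp h).1
    · intro p hp q hq e
      subst e
      rw [mem_Q (by omega)] at hq
      obtain ⟨a, -, rfl⟩ := List.mem_map.mp hp
      simp at hq
      

lemma prod_conj {G ι : Type*} [Group G] (g : G) (f : ι → G) (l : List ι) :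
    (l.map fun a => g⁻¹ * f a * g).prod = g⁻¹ * (l.map f).prod * g := by
  induction l with
  | nil => simp
  | cons a l ih => rw [List.map_cons, List.prod_cons, ih, List.map_cons, List.prod_cons]; group

lemma Ph_eq (hD : K.IsDiag D) {m : ℕ} (hm : m ≤ K.N) :
    Ph K D m = Ph K K.L m * W (lo K) (hi K) (Q K m) {p | D p.1 p.2} := by
  induction m with
  | zero => simp [Ph, Q, W]
  | succ m ih =>
    have e : W (lo K) (hi K) (Q K (m + 1)) {p | D p.1 p.2} = (Ph K K.L m)⁻¹ *
      ((rowL K (m + 1)).map fun a => if D a ((m : ℤ) + 1 - a) then 1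
        else Equiv.swap a ((m : ℤ) + 1 - a)).prod * Ph K K.L m *
        W (lo K) (hi K) (Q K m) {p | D p.1 p.2} := by
      rw [← prod_conj]
      rw [W_int, W_int]
      rw [Q, List.map_append, List.prod_append, List.map_map]
      congr 2
      apply List.map_congr_left
      intro a _
      simp only [Function.comp, Set.mem_ofPred_eq, lo, hi]
      split_ifs with h
      · simp
      · have e2 : (a + ((m : ℤ) + 1 - a) - 1).toNat = m := by omega
        rw [e2]
        rw [Equiv.swap_comm, Equiv.swap_apply_apply]
        simp
    rw [e, Ph, Ph, stP_eq hD (by omega) (by exact_mod_cast hm), ih (by omega)]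
    simp only [mul_assoc]
    simp

lemma adj_Q {p : ℤ × ℤ} (hp : p ∈ Q K K.N) : Adj (kap 0) {j | K.Act 0 j} (lo K) (hi K) p := by
  rw [mem_Q le_rfl] at hp
  obtain ⟨h1, h2, h3⟩ := hp
  obtain ⟨a, b⟩ := p
  simp only at h1 h2 h3
  obtain ⟨l1, l2, l3, l4⟩ := h3
  obtain ⟨m, hm⟩ : ∃ m : ℕ, a + b - 1 = m := ⟨(a + b - 1).toNat, by omega⟩
  have hlo : lo K (a, b) = (Ph K K.L m)⁻¹ b := by simp [lo, hm]
  have hhi : hi K (a, b) = (Ph K K.L m)⁻¹ a := by simp [hi, hm]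
  have hb : K.In m b := by unfold In; constructor <;> omega
  have ha : K.Out m a := by unfold Out; constructor <;> omega
  have alo : K.Act 0 (lo K (a, b)) := by rw [hlo]; exact act_Ph_symm isDiag_L m (Or.inr hb)
  have ahi : K.Act 0 (hi K (a, b)) := by rw [hhi]; exact act_Ph_symm isDiag_L m (Or.inl ha)
  have klo : kap m (Ph K K.L m (lo K (a, b))) = 2 * a - 1 := by
    rw [hlo, show Ph K K.L m ((Ph K K.L m)⁻¹ b) = b from Equiv.apply_symm_apply _ _, kap_in hb]; omega
  have khi : kap m (Ph K K.L m (hi K (a, b))) = 2 * a := by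
    rw [hhi, show Ph K K.L m ((Ph K K.L m)⁻¹ a) = a from Equiv.apply_symm_apply _ _, kap_out ha]
  refine ⟨alo, ahi, ?_, ?_⟩
  · rw [← kap_Ph_iff m alo ahi, klo, khi]; omega
  · intro x hx n1 n2
    rw [← kap_Ph_iff m hx alo, ← kap_Ph_iff m hx ahi, klo, khi]
    have i1 : kap m (Ph K K.L m x) ≠ 2 * a - 1 := by
      rw [← klo]
      intro h
      exact n1 ((Ph K K.L m).injective (kap_inj _ h))
    omega

lemma W_fix {Q0 : List (ℤ × ℤ)} (hA : ∀ e ∈ Q0, Adj (kap 0) {j | K.Act 0 j} (lo K) (hi K) e)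
    (X : Set (ℤ × ℤ)) {x : ℤ} (hx : ¬ K.Act 0 x) : W (lo K) (hi K) Q0 X x = x := by
  rw [W_int]
  induction Q0 with
  | nil => simp
  | cons e Q0 ih =>
    rw [List.map_cons, List.prod_cons, Equiv.Perm.mul_apply, ih (fun e he => hA e (by simp [he]))]
    have := hA e (by simp)
    split_ifs
    · rfl
    · apply Equiv.swap_apply_of_ne_of_ne
      · intro h; exact hx (h ▸ this.lo_mem)
      · intro h; exact hx (h ▸ this.hi_mem)

lemma per_iff_W {D₁ : ℤ → ℤ → Prop} (hD₁ : K.IsDiag D₁) (h₁ : Per K D₁) (hD : K.IsDiag D) :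
    Per K D ↔ W (lo K) (hi K) (Q K K.N) {p | D p.1 p.2} =
      W (lo K) (hi K) (Q K K.N) {p | D₁ p.1 p.2} := by
  rw [per_iff hD₁] at h₁
  rw [per_iff hD]
  constructor
  · intro h
    ext x
    by_cases hx : K.Act 0 x
    · have := (h x hx).trans (h₁ x hx).symm
      rw [Ph_eq hD le_rfl, Ph_eq hD₁ le_rfl] at this
      exact (Ph K K.L K.N).injective this
    · rw [W_fix (fun e he => adj_Q he) _ hx, W_fix (fun e he => adj_Q he) _ hx]
  · intro h j0 h0
    rw [← h₁ j0 h0, Ph_eq hD le_rfl, Ph_eq hD₁ le_rfl, h]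

end Comb
end StarFlip


namespace StarFlip
namespace Comb

variable {K : Comb} {D : ℤ → ℤ → Prop}

/-- Number of elements of `J` in `[a, b)`. -/
def ct (J : ℤ → Prop) (a b : ℤ) : ℕ := ((Finset.Ico a b).filter J).card

lemma ct_add (J : ℤ → Prop) {a b c : ℤ} (h : a ≤ b) (h' : b ≤ c) :
    ct J a b + ct J b c = ct J a c := by
  unfold ct
  rw [← Finset.Ico_union_Ico_eq_Ico h h', Finset.filter_union, Finset.card_union_of_disjoint]
  apply Finset.disjoint_filter_filter
  exact Finset.Ico_disjoint_Ico_consecutive a b c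

lemma ct_pos {J : ℤ → Prop} {a b : ℤ} (h : a < b) (ha : J a) : 0 < ct J a b := by
  unfold ct
  rw [Finset.card_pos]
  exact ⟨a, by simp [h, ha]⟩

/-- A star, lifted to the universal cover. -/
structure LStar (K : Comb) (D : ℤ → ℤ → Prop) (J : ℤ → Prop) (ns ps : ℤ → ℤ) : Prop where
  J_add : ∀ i, J (i + K.N) ↔ J i
  J_ns : ∀ i, J i → J (ns i)
  J_ps : ∀ i, J i → J (ps i)
  ns_ps : ∀ i, J i → ns (ps i) = i
  ps_ns : ∀ i, J i → ps (ns i) = i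
  ns_add : ∀ i, J i → ns (i + K.N) = ns i + K.N
  lt_ns : ∀ i, J i → i < ns i
  acw : ∀ i, J i → ns i < ps i + K.N
  edge : ∀ i, J i → K.C D i (ns i)
  nosplit : ∀ i, J i → ∀ c, ns i < c → c < ps i + K.N → ¬ D i c
  star : ∃ k, 0 < k ∧ ∀ i, J i → ct J i (ns i) = k ∧ ct J i (i + K.N) = 2 * k + 1

lemma out_phase (hD : K.IsDiag D) {j : ℤ → ℤ} (hj : Strand K D j) {t s a : ℤ} (ha : j t = a)
    (ho : K.Out t a) (hts : t ≤ s) (hn : ∀ u, t < u → u ≤ s → ¬ K.C D a (u - a)) :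
    j s = a ∧ K.Out s a := by
  induction s, hts using Int.leInduction with
  | base => exact ⟨ha, ho⟩
  | succ s hts ih =>
    obtain ⟨i1, i2⟩ := ih (fun u h1 h2 => hn u h1 (by omega))
    have e : s + 1 - 1 = s := by ring
    rcases st_of_out hD (t := s + 1) (j := a) (by rwa [e]) with ⟨h, -, -⟩ | ⟨-, h1, h2⟩
    · exact absurd h (hn _ (by omega) le_rfl)
    · refine ⟨?_, h2⟩
      rw [hj.step, e, i1, h1]

lemma in_phase (hD : K.IsDiag D) {j : ℤ → ℤ} (hj : Strand K D j) {t s a : ℤ} (ha : j t = a)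
    (ho : K.In t a) (hts : t ≤ s) (hn : ∀ u, t < u → u ≤ s → ¬ K.C D (u - a) a) :
    j s = a ∧ K.In s a := by
  induction s, hts using Int.leInduction with
  | base => exact ⟨ha, ho⟩
  | succ s hts ih =>
    obtain ⟨i1, i2⟩ := ih (fun u h1 h2 => hn u h1 (by omega))
    have e : s + 1 - 1 = s := by ring
    rcases st_of_in hD (t := s + 1) (j := a) (by rwa [e]) with ⟨h, -, -⟩ | ⟨-, h1, h2⟩
    · exact absurd h (hn _ (by omega) le_rfl)
    · refine ⟨?_, h2⟩
      rw [hj.step, e, i1, h1]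

lemma out_turn (hD : K.IsDiag D) {j : ℤ → ℤ} (hj : Strand K D j) {s a : ℤ} (ha : j (s - 1) = a)
    (ho : K.Out (s - 1) a) (hC : K.C D a (s - a)) : j s = s - a ∧ K.In s (s - a) := by
  rcases st_of_out hD ho with ⟨-, h1, h2⟩ | ⟨h, -, -⟩
  · exact ⟨by rw [hj.step, ha, h1], h2⟩
  · exact absurd hC h

lemma in_turn (hD : K.IsDiag D) {j : ℤ → ℤ} (hj : Strand K D j) {s a : ℤ} (ha : j (s - 1) = a)
    (ho : K.In (s - 1) a) (hC : K.C D (s - a) a) : j s = s - a ∧ K.Out s (s - a) := by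
  rcases st_of_in hD ho with ⟨-, h1, h2⟩ | ⟨h, -, -⟩
  · exact ⟨by rw [hj.step, ha, h1], h2⟩
  · exact absurd hC h

lemma out_of_lt {t a : ℤ} (h : K.Act t a) (h2 : 2 * a < t) : K.Out t a := by
  rcases h with h | h
  · exact h
  · have := K.τ_lt a
    obtain ⟨h3, h4⟩ := h
    omega

lemma in_of_lt {t a : ℤ} (h : K.Act t a) (h2 : t < 2 * a) : K.In t a := by
  rcases h with h | h
  · have := K.lt_σ a
    obtain ⟨h3, h4⟩ := h
    omega
  · exact h

lemma event_exists (hD : K.IsDiag D) {j : ℤ → ℤ} (hj : Strand K D j) :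
    ∃ t, K.Out t (j t) ∧ K.C D (j t) (t - j t) := by
  by_contra hcon
  push Not at hcon
  have hout : ∀ t, ¬ K.Out t (j t) := by
    intro t ho
    have key : ∀ n : ℕ, j (t - n) = j t ∧ K.Out (t - n) (j t) := by
      intro n
      induction n with
      | zero => simpa using ho
      | succ n ih =>
        have h1 : ¬ K.C D (j t) (t - n - j t) := by
          have := hcon (t - n) (by rw [ih.1]; exact ih.2)
          rwa [ih.1] at this
        rcases st_to_out hD ih.2 with ⟨h, -, -⟩ | ⟨-, h2, h3⟩
        · exact absurd h h1
        · have e : t - ((n + 1 : ℕ) : ℤ) = t - n - 1 := by push_cast; ring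
          rw [e, strand_back hj, ih.1]
          exact ⟨h2, h3⟩
    have h1 := (key (t - j t - K.σ (j t) + 1).toNat).2.1
    have h2 := ho.1
    omega
  have hin : ∀ t, K.In t (j t) := fun t => (hj.act t).resolve_left (hout t)
  have key : ∀ n : ℕ, j (0 - n) = j 0 := by
    intro n
    induction n with
    | zero => simp
    | succ n ih =>
      have e : (0 : ℤ) - ((n + 1 : ℕ) : ℤ) = 0 - n - 1 := by push_cast; ring
      rcases st_to_in hD (hin (0 - n)) with ⟨h1, h2, h3⟩ | ⟨-, h2, h3⟩
      · rw [← h2, ← strand_back hj] at h3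
        exact absurd h3 (hout _)
      · rw [← strand_back hj] at h2
        rw [e, h2, ih]
  have h1 := (hin (0 - ((K.N + 0 - j 0 - K.σ (j 0) + 1).toNat : ℤ))).1
  have h2 := (hin 0).1
  rw [key] at h1
  omega

section
variable {J : ℤ → Prop} {ns ps : ℤ → ℤ}

lemma LStar.ps_add (h : LStar K D J ns ps) {i : ℤ} (hi : J i) : ps (i + K.N) = ps i + K.N := by
  have h1 := h.ns_add _ (h.J_ps i hi)
  rw [h.ns_ps i hi] at h1
  rw [← h1, h.ps_ns _ ((h.J_add _).mpr (h.J_ps i hi))]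

lemma LStar.nosplitC (hD : K.IsDiag D) (h : LStar K D J ns ps) {i : ℤ} (hi : J i) {c : ℤ}
    (h1 : ns i < c) (h2 : c < ps i + K.N) : ¬ K.C D i c := by
  have e1 := h.edge i hi
  have e2 := h.edge _ (h.J_ps i hi)
  rw [h.ns_ps i hi] at e2
  rw [C_flip hD] at e2
  have a1 := K.acw i
  rintro (h3 | h3 | h3)
  · exact h.nosplit i hi c h1 h2 h3
  · rcases C_cases hD e1 with h | h | h <;> omega
  · rcases C_cases hD e2 with h | h | h <;> omega

lemma LStar.half (hD : K.IsDiag D) (h : LStar K D J ns ps) {j : ℤ → ℤ} (hj : Strand K D j)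
    {a : ℤ} (ha : J a) (e : j (a + ns a) = a) :
    j (a + ps a + K.N) = ps a + K.N ∧ K.In (a + ps a + K.N) (ps a + K.N) := by
  have h1 := h.lt_ns a ha
  have h2 := h.acw a ha
  have o : K.Out (a + ns a) a := by
    have := hj.act (a + ns a)
    rw [e] at this
    exact out_of_lt this (by omega)
  obtain ⟨p1, p2⟩ := out_phase hD hj e o (s := a + ps a + K.N - 1) (by omega)
    (fun u hu1 hu2 => h.nosplitC hD ha (by omega) (by omega))
  have e2 := h.edge _ (h.J_ps a ha)
  rw [h.ns_ps a ha, C_flip hD] at e2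
  have e3 : a + ps a + K.N - a = ps a + K.N := by ring
  have := out_turn hD hj p1 p2 (by rwa [e3])
  rwa [e3] at this

lemma LStar.double (hD : K.IsDiag D) (h : LStar K D J ns ps) {j : ℤ → ℤ} (hj : Strand K D j)
    {a : ℤ} (ha : J a) (e : j (a + ns a) = a) :
    j ((ps (ps a) + K.N) + ns (ps (ps a) + K.N)) = ps (ps a) + K.N := by
  obtain ⟨q1, q2⟩ := h.half hD hj ha e
  set z := ps a with hz
  have hJz : J z := h.J_ps a ha
  have nz : ns z = a := h.ns_ps a ha
  have h2 := h.acw z hJz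
  obtain ⟨p1, p2⟩ := in_phase hD hj q1 q2 (s := ps z + z + 2 * K.N - 1) (by omega)
    (fun u hu1 hu2 hC => by
      have e4 : u - (z + K.N) + K.N = u - z := by ring
      have := (C_flip hD (a := z) (b := u - (z + K.N))).mpr hC
      exact h.nosplitC hD hJz (by omega) (by omega) this)
  have e2 := h.edge _ (h.J_ps z hJz)
  rw [h.ns_ps z hJz, C_flip hD, C_flip hD] at e2
  have e3 : ps z + z + 2 * K.N - (z + K.N) = ps z + K.N := by ring
  have := (in_turn hD hj p1 p2 (by rwa [e3])).1
  rw [h.ns_add _ (h.J_ps z hJz), h.ns_ps z hJz]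
  rw [e3] at this
  rw [show ps z + (K.N : ℤ) + (z + K.N) = ps z + z + 2 * K.N by ring]
  exact this

lemma LStar.iter (hD : K.IsDiag D) (h : LStar K D J ns ps) {j : ℤ → ℤ} (hj : Strand K D j)
    {a : ℤ} (ha : J a) (e : j (a + ns a) = a) (m : ℕ) :
    ∃ b, J b ∧ j (b + ns b) = b ∧ ns^[2 * m] b = a + m * K.N := by
  induction m with
  | zero => exact ⟨a, ha, e, by simp⟩
  | succ m ih =>
    obtain ⟨b, h1, h2, h3⟩ := ih
    have J1 := h.J_ps b h1
    have J2 := h.J_ps _ J1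
    refine ⟨ps (ps b) + K.N, (h.J_add _).mpr J2, h.double hD hj h1 h2, ?_⟩
    have e1 : ns (ns (ps (ps b) + K.N)) = b + K.N := by
      rw [h.ns_add _ J2, h.ns_ps _ J1, h.ns_add _ J1, h.ns_ps _ h1]
    have e2 : ∀ (n : ℕ) (c : ℤ), J c → ns^[n] (c + K.N) = ns^[n] c + K.N := by
      intro n
      induction n with
      | zero => simp
      | succ n ih =>
        intro c hc
        rw [Function.iterate_succ_apply, h.ns_add c hc, ih _ (h.J_ns c hc),
          Function.iterate_succ_apply]
    rw [show 2 * (m + 1) = (2 * m + 1) + 1 by ring, Function.iterate_succ_apply,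
      Function.iterate_succ_apply, e1, e2 _ _ h1, h3]
    push_cast
    ring

lemma LStar.close (h : LStar K D J ns ps) :
    ∃ k : ℕ, ∀ a, J a → ns^[2 * k + 1] a = a + k * K.N := by
  obtain ⟨k, hk, hs⟩ := h.star
  refine ⟨k, fun a ha => ?_⟩
  have hN := K.hN
  have f1 : ∀ m : ℕ, J (ns^[m] a) ∧ a ≤ ns^[m] a ∧ ct J a (ns^[m] a) = m * k := by
    intro m
    induction m with
    | zero => simp [ha, ct]
    | succ m ih =>
      obtain ⟨i1, i2, i3⟩ := ih
      rw [Function.iterate_succ_apply']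
      have := h.lt_ns _ i1
      refine ⟨h.J_ns _ i1, by omega, ?_⟩
      rw [← ct_add J i2 this.le, i3, (hs _ i1).1]
      ring
  have f2 : ∀ m : ℕ, J (a + m * K.N) ∧ a ≤ a + m * K.N ∧
      ct J a (a + m * K.N) = m * (2 * k + 1) := by
    intro m
    induction m with
    | zero => simp [ha, ct]
    | succ m ih =>
      obtain ⟨i1, i2, i3⟩ := ih
      have e : a + ((m + 1 : ℕ) : ℤ) * K.N = a + m * K.N + K.N := by push_cast; ring
      rw [e]
      refine ⟨(h.J_add _).mpr i1, by omega, ?_⟩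
      rw [← ct_add J i2 (by omega), i3, (hs _ i1).2]
      ring
  obtain ⟨a1, a2, a3⟩ := f1 (2 * k + 1)
  obtain ⟨b1, b2, b3⟩ := f2 k
  rcases lt_trichotomy (ns^[2 * k + 1] a) (a + k * K.N) with hlt | heq | hgt
  · have := ct_add J a2 hlt.le
    have := ct_pos hlt a1
    have e := mul_comm k (2 * k + 1)
    omega
  · exact heq
  · have := ct_add J b2 hgt.le
    have := ct_pos hgt b1
    have e := mul_comm k (2 * k + 1)
    omega

lemma LStar.per (hD : K.IsDiag D) (h : LStar K D J ns ps) {j : ℤ → ℤ} (hj : Strand K D j)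
    {a : ℤ} (ha : J a) (e : j (a + ns a) = a) (t : ℤ) : j (t + K.N) = K.fl t (j t) := by
  obtain ⟨k, hk⟩ := h.close
  obtain ⟨b, h1, h2, h3⟩ := h.iter hD hj ha e k
  have h4 := hk b h1
  rw [Function.iterate_succ_apply', h3] at h4
  have hJ : ∀ m : ℕ, J (a + m * K.N) := by
    intro m
    induction m with
    | zero => simpa
    | succ m ih =>
      rw [show a + ((m + 1 : ℕ) : ℤ) * K.N = a + m * K.N + K.N by push_cast; ring]
      exact (h.J_add _).mpr ih
  have h5 : ∀ m : ℕ, ns (a + m * K.N) = ns a + m * K.N := by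
    intro m
    induction m with
    | zero => simp
    | succ m ih =>
      rw [show a + ((m + 1 : ℕ) : ℤ) * K.N = a + m * K.N + K.N by push_cast; ring,
        h.ns_add _ (hJ m), ih]
      push_cast
      ring
  rw [h5] at h4
  have hb : b = ns a := by linarith
  subst hb
  have h6 := (h.half hD hj h1 h2).1
  rw [h.ps_ns a ha] at h6
  apply strand_per hD hj (t1 := a + ns a)
  have o : K.Out (a + ns a) a := by
    have := hj.act (a + ns a)
    rw [e] at this
    exact out_of_lt this (by have := h.lt_ns a ha; omega)
  rw [e, fl_out o, add_comm a (ns a)]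
  exact h6

end

end Comb
end StarFlip


namespace StarFlip
namespace Comb

variable {K : Comb} {D : ℤ → ℤ → Prop}

lemma C_add (hD : K.IsDiag D) {a b : ℤ} : K.C D a b ↔ K.C D (a + K.N) (b + K.N) := by
  rw [C_flip hD, C_flip hD]

lemma out_phase_back (hD : K.IsDiag D) {j : ℤ → ℤ} (hj : Strand K D j) {t s a : ℤ}
    (ha : j t = a) (ho : K.Out t a) (hts : s ≤ t)
    (hn : ∀ u, s < u → u ≤ t → ¬ K.C D a (u - a)) : j s = a ∧ K.Out s a := by
  induction s, hts using Int.leInductionDown with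
  | base => exact ⟨ha, ho⟩
  | pred s hts ih =>
    obtain ⟨i1, i2⟩ := ih (fun u h1 h2 => hn u (by omega) h2)
    rcases st_to_out hD i2 with ⟨h, -, -⟩ | ⟨-, h1, h2⟩
    · exact absurd h (hn _ (by omega) hts)
    · refine ⟨?_, h2⟩
      rw [strand_back hj, i1, h1]

lemma kap_mono (hD : K.IsDiag D) {j : ℤ → ℤ} (hj : Strand K D j) :
    Monotone (fun t => kap t (j t)) := by
  apply monotone_int_of_le_succ
  intro t
  have e : t + 1 - 1 = t := by ring
  have := (kap_step hD (t := t + 1) (j := j t) (by rw [e]; exact hj.act t)).1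
  rw [e] at this
  have e2 := hj.step (t + 1)
  rw [e] at e2
  rwa [← e2] at this

section
variable {j : ℤ → ℤ}

lemma per_two (hj : Strand K D j)
    (hP : ∀ t, j (t + K.N) = K.fl t (j t)) (t : ℤ) : j (t + 2 * K.N) = j t + K.N := by
  have h1 := hP t
  have h2 := hP (t + K.N)
  rw [show t + 2 * (K.N : ℤ) = t + K.N + K.N by ring, h2]
  rcases hj.act t with h | h
  · rw [fl_out h] at h1
    rw [h1, fl_in (In_fl h)]
  · rw [fl_in h] at h1
    rw [h1, fl_out (Out_fl h)]

lemma phase (hD : K.IsDiag D) (hj : Strand K D j)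
    (hP : ∀ t, j (t + K.N) = K.fl t (j t)) {a : ℤ} (ha : ∃ t, j t = a) :
    ∃ b c, K.C D a b ∧ K.C D a c ∧ b < c ∧ (∀ d, b < d → d < c → ¬ K.C D a d) ∧
      (∀ t, a + b ≤ t → t < a + c → j t = a ∧ K.Out t a) ∧
      (j (a + c) = c ∧ K.In (a + c) c) ∧ (j (a + b - 1) = b ∧ K.In (a + b - 1) b) ∧
      ∀ t, j t = a → K.Out t a → a + b ≤ t ∧ t < a + c := by
  obtain ⟨t0, h0, o0⟩ : ∃ t, j t = a ∧ K.Out t a := by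
    obtain ⟨t, ht⟩ := ha
    rcases hj.act t with h | h
    · exact ⟨t, ht, ht ▸ h⟩
    · refine ⟨t + K.N, ?_, ?_⟩
      · rw [hP, fl_in h, ht]
      · rw [← ht]; exact Out_fl h
  obtain ⟨b, ⟨hb1, hb2⟩, hb3⟩ := Int.exists_greatest_of_bdd
    (P := fun b => b ≤ t0 - a ∧ K.C D a b) ⟨t0 - a, fun z hz => hz.1⟩
    ⟨K.σ a, o0.1, C_σ a⟩
  obtain ⟨c, ⟨hc1, hc2⟩, hc3⟩ := Int.exists_least_of_bdd
    (P := fun c => t0 - a < c ∧ K.C D a c) ⟨t0 - a, fun z hz => hz.1.le⟩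
    ⟨K.τ a + K.N, o0.2, C_τ' a⟩
  have hno : ∀ d, b < d → d < c → ¬ K.C D a d := by
    intro d h1 h2 h3
    rcases le_or_gt d (t0 - a) with h | h
    · have := hb3 d ⟨h, h3⟩; omega
    · have := hc3 d ⟨h, h3⟩; omega
  have hst : ∀ t, a + b ≤ t → t < a + c → j t = a ∧ K.Out t a := by
    intro t h1 h2
    rcases le_or_gt t t0 with h | h
    · exact out_phase_back hD hj h0 o0 h (fun u h3 h4 => hno _ (by omega) (by omega))
    · exact out_phase hD hj h0 o0 h.le (fun u h3 h4 => hno _ (by omega) (by omega))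
  have hend : j (a + c) = c ∧ K.In (a + c) c := by
    have e : a + c - a = c := by ring
    have := hst (a + c - 1) (by omega) (by omega)
    have := out_turn hD hj this.1 this.2 (by rwa [e])
    rwa [e] at this
  have hbeg : j (a + b - 1) = b ∧ K.In (a + b - 1) b := by
    have e : a + b - a = b := by ring
    have := hst (a + b) (by omega) (by omega)
    rcases st_to_out hD this.2 with ⟨-, h1, h2⟩ | ⟨h1, -, -⟩
    · rw [e] at h1 h2
      rw [strand_back hj, this.1]
      exact ⟨h1, h2⟩
    · rw [e] at h1
      exact absurd hb2 h1
  refine ⟨b, c, hb2, hc2, by omega, hno, hst, hend, hbeg, ?_⟩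
  intro t h1 h2
  have m := kap_mono hD hj
  have k1 : kap t (j t) = 2 * a := by rw [h1]; exact kap_out h2
  constructor
  · by_contra hlt
    have := m (show t ≤ a + b - 1 by omega)
    simp only at this
    rw [k1, hbeg.1, kap_in hbeg.2] at this
    omega
  · by_contra hlt
    have := m (show a + c ≤ t by omega)
    simp only at this
    rw [k1, hend.1, kap_in hend.2] at this
    omega

lemma ct_image {J : ℤ → Prop} {ns ps : ℤ → ℤ} (h1 : ∀ i, J i → J (ns i)) (h2 : ∀ i, J i → J (ps i))
    (h3 : ∀ i, J i → ns (ps i) = i) (h4 : ∀ i, J i → ps (ns i) = i)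
    (hm : ∀ a b, J a → J b → a < b → ns a < ns b) {a b : ℤ} (ha : J a) (hb : J b) :
    ct J a b = ct J (ns a) (ns b) := by
  have hm' : ∀ a b, J a → J b → (ns a < ns b ↔ a < b) := by
    intro a b ha hb
    refine ⟨fun h => ?_, hm a b ha hb⟩
    by_contra hn
    rcases lt_or_eq_of_le (not_lt.mp hn) with h5 | h5
    · have := hm b a hb ha h5; omega
    · rw [h5] at h; omega
  unfold ct
  apply Finset.card_nbij' ns ps
  · intro i hi
    simp only [Finset.coe_filter, Finset.mem_Ico] at hi ⊢
    obtain ⟨⟨i1, i2⟩, i3⟩ := hi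
    refine ⟨⟨?_, (hm' _ _ i3 hb).mpr i2⟩, h1 i i3⟩
    by_contra hn
    have := (hm' _ _ i3 ha).mp (by omega)
    omega
  · intro i hi
    simp only [Finset.coe_filter, Finset.mem_Ico] at hi ⊢
    obtain ⟨⟨i1, i2⟩, i3⟩ := hi
    refine ⟨⟨?_, ?_⟩, h2 i i3⟩
    · by_contra hn
      have := hm (ps i) a (h2 i i3) ha (by omega)
      rw [h3 i i3] at this
      omega
    · rw [← h3 i i3] at i2
      exact (hm' _ _ (h2 i i3) hb).mp i2
  · intro i hi
    exact h4 i (Finset.mem_filter.mp hi).2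
  · intro i hi
    exact h3 i (Finset.mem_filter.mp hi).2

lemma strand_star (hD : K.IsDiag D) (hj : Strand K D j)
    (hP : ∀ t, j (t + K.N) = K.fl t (j t)) :
    ∃ ns ps, LStar K D (fun i => ∃ t, j t = i) ns ps ∧
      ∀ a b, ((∃ t, j t = a) ∧ b = ns a) ↔ (K.C D a b ∧ j (a + b) = a) := by
  set J : ℤ → Prop := fun i => ∃ t, j t = i with hJ
  have hph : ∀ a, ∃ b c, J a → K.C D a b ∧ K.C D a c ∧ b < c ∧
      (∀ d, b < d → d < c → ¬ K.C D a d) ∧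
      (∀ t, a + b ≤ t → t < a + c → j t = a ∧ K.Out t a) ∧
      (j (a + c) = c ∧ K.In (a + c) c) ∧ (j (a + b - 1) = b ∧ K.In (a + b - 1) b) ∧
      ∀ t, j t = a → K.Out t a → a + b ≤ t ∧ t < a + c := by
    intro a
    by_cases ha : J a
    · obtain ⟨b, c, h⟩ := phase hD hj hP ha
      exact ⟨b, c, fun _ => h⟩
    · exact ⟨0, 0, fun h => absurd h ha⟩
  choose ns cs hph using hph
  have J_add : ∀ i, J (i + K.N) ↔ J i := by
    intro i
    constructor
    · rintro ⟨t, ht⟩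
      refine ⟨t - 2 * K.N, ?_⟩
      have := per_two hj hP (t - 2 * K.N)
      rw [sub_add_cancel] at this
      omega
    · rintro ⟨t, ht⟩
      exact ⟨t + 2 * K.N, by rw [per_two hj hP, ht]⟩
  have hEd : ∀ a b, (J a ∧ b = ns a) ↔ (K.C D a b ∧ j (a + b) = a) := by
    intro a b
    constructor
    · rintro ⟨ha, rfl⟩
      obtain ⟨p1, p2, p3, p4, p5, p6, p7, p8⟩ := hph a ha
      exact ⟨p1, (p5 _ le_rfl (by omega)).1⟩
    · rintro ⟨h1, h2⟩
      have ha : J a := ⟨_, h2⟩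
      refine ⟨ha, ?_⟩
      obtain ⟨p1, p2, p3, p4, p5, p6, p7, p8⟩ := hph a ha
      have hl := C_lt hD h1
      have o : K.Out (a + b) a := by
        have := hj.act (a + b)
        rw [h2] at this
        exact out_of_lt this (by omega)
      have := p8 _ h2 o
      by_contra hne
      exact p4 b (by omega) (by omega) h1
  have J_ns : ∀ i, J i → J (ns i) := by
    intro i hi
    obtain ⟨p1, p2, p3, p4, p5, p6, p7, p8⟩ := hph i hi
    exact ⟨_, p7.1⟩
  have hpe : ∀ a, J a → K.C D (cs a - K.N) a ∧ j (cs a - K.N + a) = cs a - K.N := by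
    intro a ha
    obtain ⟨p1, p2, p3, p4, p5, p6, p7, p8⟩ := hph a ha
    have e0 : cs a - (K.N : ℤ) + K.N = cs a := by ring
    have hC : K.C D (cs a - K.N) a := by
      rw [C_flip hD, e0]; exact p2
    refine ⟨hC, ?_⟩
    have h1 := hP (cs a - K.N + a)
    rw [show cs a - (K.N : ℤ) + a + K.N = a + cs a by ring, p6.1] at h1
    rcases hj.act (cs a - K.N + a) with h | h
    · rw [fl_out h] at h1; omega
    · rw [fl_in h] at h1
      rw [← h1] at h
      have := h.1
      have := K.lt_σ (cs a)
      have := C_lt hD p2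
      omega
  have J_ps : ∀ i, J i → J (cs i - K.N) := fun i hi => ⟨_, (hpe i hi).2⟩
  have ns_ps : ∀ i, J i → ns (cs i - K.N) = i := fun i hi => ((hEd _ _).mpr (hpe i hi)).2.symm
  have ps_ns : ∀ i, J i → cs (ns i) - K.N = i := by
    intro z hz
    obtain ⟨p1, p2, p3, p4, p5, p6, p7, p8⟩ := hph z hz
    have ha := J_ns z hz
    set a := ns z with hadef
    obtain ⟨q1, q2, q3, q4, q5, q6, q7, q8⟩ := hph a ha
    have h1 := p5 (z + a) le_rfl (by omega)
    have h2 := hP (z + a)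
    rw [h1.1, fl_out h1.2] at h2
    have h3 := In_fl h1.2
    have e : z + a + K.N - (z + K.N) = a := by ring
    have hC : K.C D a (z + K.N) := (C_flip hD).mp p1
    rcases st_to_in hD h3 with ⟨-, h4, h5⟩ | ⟨h4, -, -⟩
    · rw [e] at h4 h5
      rw [← h2, ← strand_back hj] at h4
      have h6 := q8 _ h4 h5
      by_contra hne
      exact q4 (z + K.N) (by omega) (by omega) hC
    · rw [e] at h4
      exact absurd hC h4
  have ns_add : ∀ i, J i → ns (i + K.N) = ns i + K.N := by
    intro i hi
    have h1 := (hEd i (ns i)).mp ⟨hi, rfl⟩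
    have h2 := (hEd (i + K.N) (ns i + K.N)).mpr ⟨(C_add hD).mp h1.1, by
      rw [show i + (K.N : ℤ) + (ns i + K.N) = i + ns i + 2 * K.N by ring, per_two hj hP, h1.2]⟩
    exact h2.2.symm
  have hm : ∀ a b, J a → J b → a < b → ns a < ns b := by
    intro a b ha hb hab
    obtain ⟨p1, p2, p3, p4, p5, p6, p7, p8⟩ := hph a ha
    obtain ⟨q1, q2, q3, q4, q5, q6, q7, q8⟩ := hph b hb
    have a1 := p5 (a + ns a) le_rfl (by omega)
    have b1 := q5 (b + ns b) le_rfl (by omega)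
    have m := kap_mono hD hj
    have hT : a + ns a < b + ns b := by
      by_contra hn
      have := m (not_lt.mp hn)
      simp only at this
      rw [a1.1, b1.1, kap_out a1.2, kap_out b1.2] at this
      omega
    have a2 := hP (a + ns a)
    have b2 := hP (b + ns b)
    rw [a1.1, fl_out a1.2] at a2
    rw [b1.1, fl_out b1.2] at b2
    have := m (show a + ns a + K.N ≤ b + ns b + K.N by omega)
    simp only at this
    rw [a2, b2, kap_in (In_fl a1.2), kap_in (In_fl b1.2)] at this
    have hne : ns a ≠ ns b := by
      intro h
      have h1 := ps_ns a ha
      have h2 := ps_ns b hb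
      rw [h] at h1
      omega
    omega
  have lt_ns : ∀ i, J i → i < ns i := fun i hi => (C_lt hD (hph i hi).1).1
  have acw : ∀ i, J i → ns i < cs i - K.N + K.N := fun i hi => by
    have := (hph i hi).2.2.1
    omega
  have J0 : J (j 0) := ⟨0, rfl⟩
  have hle : ∀ a b, J a → J b → a ≤ b → ct J a (ns a) = ct J b (ns b) := by
    intro a b ha hb hab
    have h1 := ct_image J_ns J_ps ns_ps ps_ns hm ha hb
    have h2 := ct_add J (lt_ns a ha).le (show ns a ≤ ns b by
      rcases lt_or_eq_of_le hab with h | h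
      · exact (hm a b ha hb h).le
      · rw [h])
    have h3 := ct_add J hab (lt_ns b hb).le
    omega
  have hconst : ∀ a, J a → ct J a (ns a) = ct J (j 0) (ns (j 0)) := by
    intro a ha
    rcases le_total a (j 0) with h | h
    · exact hle _ _ ha J0 h
    · exact (hle _ _ J0 ha h).symm
  refine ⟨ns, fun i => cs i - K.N, ⟨J_add, J_ns, J_ps, ns_ps, ps_ns, ns_add, lt_ns, acw,
    fun i hi => (hph i hi).1, ?_, ?_⟩, hEd⟩
  · intro i hi c h1 h2 h3
    exact (hph i hi).2.2.2.1 c h1 (by simpa using h2) (Or.inl h3)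
  · refine ⟨ct J (j 0) (ns (j 0)), ct_pos (lt_ns _ J0) J0, fun i hi => ⟨hconst i hi, ?_⟩⟩
    have hc := J_ns i hi
    have h1 := lt_ns i hi
    have h2 := lt_ns _ hc
    have h3 := acw _ hc
    rw [ps_ns i hi] at h3
    rw [← ct_add J h1.le (by omega), ← ct_add J h2.le h3.le, hconst i hi, hconst _ hc]
    have : ct J (ns (ns i)) (i + K.N) = 1 := by
      unfold ct
      rw [Finset.card_eq_one]
      refine ⟨ns (ns i), ?_⟩
      ext d
      simp only [Finset.mem_filter, Finset.mem_Ico, Finset.mem_singleton]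
      constructor
      · rintro ⟨⟨d1, d2⟩, hd⟩
        by_contra hne
        obtain ⟨p1, p2, p3, p4, p5, p6, p7, p8⟩ := hph _ hc
        obtain ⟨q1, q2, q3, q4, q5, q6, q7, q8⟩ := hph d hd
        have hcs := ps_ns i hi
        set c := ns i with hcdef
        have s1 := p5 (c + d - 1) (by omega) (by omega)
        have s2 := p5 (c + d) (by omega) (by omega)
        have r1 := hP (c + d - 1)
        have r2 := hP (c + d)
        rw [s1.1, fl_out s1.2] at r1
        rw [s2.1, fl_out s2.2] at r2
        have k1 := kap_in (In_fl s1.2)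
        have k2 := kap_in (In_fl s2.2)
        rw [← r1] at k1
        rw [← r2] at k2
        have s3 := q5 (d + ns d) le_rfl (by omega)
        have k3 := kap_out s3.2
        have m := kap_mono hD hj
        rcases le_or_gt (d + ns d) (c + d - 1 + K.N) with h | h
        · have := m h
          simp only at this
          rw [k1, r1, s3.1, k3] at this
          omega
        · have := m (show c + d + K.N ≤ d + ns d by omega)
          simp only at this
          rw [k2, r2, s3.1, k3] at this
          omega
      · rintro rfl
        exact ⟨⟨le_rfl, h3⟩, J_ns _ hc⟩
    omega

end
end Comb
end StarFlip


namespace StarFlip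

lemma posArc_exp (α : ℝ) {φ : ℝ} (h1 : 0 < φ) (h2 : φ < 2 * Real.pi) :
    posArc (Complex.exp (α * Complex.I)) (Complex.exp ((α + φ : ℝ) * Complex.I)) = φ := by
  have e : Complex.exp ((α + φ : ℝ) * Complex.I) / Complex.exp (α * Complex.I) =
      Complex.exp (φ * Complex.I) := by
    rw [← Complex.exp_sub]
    congr 1
    push_cast
    ring
  unfold posArc
  rw [e]
  rcases le_or_gt φ Real.pi with h | h
  · have : Complex.arg (Complex.exp (φ * Complex.I)) = φ := by
      rw [Complex.arg_exp_mul_I, toIocMod_eq_self]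
      constructor <;> linarith
    rw [this, if_pos h1]
  · have : Complex.arg (Complex.exp (φ * Complex.I)) = φ - 2 * Real.pi := by
      rw [Complex.arg_exp_mul_I, ← toIocMod_sub, toIocMod_eq_self]
      constructor <;> linarith
    rw [this, if_neg (by linarith)]
    ring

lemma exp_sub_exp (α β : ℝ) : Complex.exp (β * Complex.I) - Complex.exp (α * Complex.I) =
    Complex.exp (((α + β) / 2 : ℝ) * Complex.I) *
      (2 * Complex.I * (Real.sin ((β - α) / 2) : ℝ)) := by
  have e1 : Complex.exp (β * Complex.I) = Complex.exp (((α + β) / 2 : ℝ) * Complex.I) *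
      Complex.exp (((β - α) / 2 : ℝ) * Complex.I) := by
    rw [← Complex.exp_add]; congr 1; push_cast; ring
  have e2 : Complex.exp (α * Complex.I) = Complex.exp (((α + β) / 2 : ℝ) * Complex.I) *
      Complex.exp (-((β - α) / 2 : ℝ) * Complex.I) := by
    rw [← Complex.exp_add]; congr 1; push_cast; ring
  rw [e1, e2, ← mul_sub]
  congr 1
  rw [Complex.ofReal_sin, Complex.sin]
  have : Complex.I * Complex.I = -1 := Complex.I_mul_I
  linear_combination (Complex.exp (((β - α) / 2 : ℝ) * Complex.I) -
    Complex.exp (-((β - α) / 2 : ℝ) * Complex.I)) * this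

lemma vangle_exp {α β γ : ℝ} (h1 : α < β) (h2 : β < α + 2 * Real.pi) (h3 : α < γ)
    (h4 : γ < α + 2 * Real.pi) :
    vangle (Complex.exp (β * Complex.I)) (Complex.exp (α * Complex.I))
      (Complex.exp (γ * Complex.I)) = |β - γ| / 2 := by
  unfold vangle
  rw [exp_sub_exp, exp_sub_exp]
  have s1 : 0 < Real.sin ((β - α) / 2) := Real.sin_pos_of_pos_of_lt_pi (by linarith) (by linarith)
  have s2 : 0 < Real.sin ((γ - α) / 2) := Real.sin_pos_of_pos_of_lt_pi (by linarith) (by linarith)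
  have e : Complex.exp (((α + β) / 2 : ℝ) * Complex.I) *
      (2 * Complex.I * (Real.sin ((β - α) / 2) : ℝ)) /
      (Complex.exp (((α + γ) / 2 : ℝ) * Complex.I) *
      (2 * Complex.I * (Real.sin ((γ - α) / 2) : ℝ))) =
      ((Real.sin ((β - α) / 2) / Real.sin ((γ - α) / 2) : ℝ) : ℂ) *
        Complex.exp (((β - γ) / 2 : ℝ) * Complex.I) := by
    have e1 : Complex.exp (((α + β) / 2 : ℝ) * Complex.I) =
        Complex.exp (((α + γ) / 2 : ℝ) * Complex.I) *
          Complex.exp (((β - γ) / 2 : ℝ) * Complex.I) := by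
      rw [← Complex.exp_add]; congr 1; push_cast; ring
    have n1 := Complex.exp_ne_zero (((α + γ) / 2 : ℝ) * Complex.I)
    have n2 : ((Real.sin ((γ - α) / 2) : ℝ) : ℂ) ≠ 0 := by exact_mod_cast s2.ne'
    have n3 := Complex.I_ne_zero
    rw [e1, Complex.ofReal_div (Real.sin ((β - α) / 2)) (Real.sin ((γ - α) / 2))]
    field_simp
  rw [e, Complex.arg_real_mul _ (div_pos s1 s2), Complex.arg_exp_mul_I,
    (toIocMod_eq_self _).mpr, abs_div, abs_two]
  constructor <;> linarith

/-- A covering of the circle by a periodic sequence of angles. -/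
structure Cov (N : ℕ) (θ : ℤ → ℝ) : Prop where
  hN : 0 < N
  mono : StrictMono θ
  per : ∀ i, θ (i + N) = θ i + 2 * Real.pi

/-- The point with index `i`. -/
def xx (θ : ℤ → ℝ) (i : ℤ) : ℂ := Complex.exp (θ i * Complex.I)

section
variable {N : ℕ} {θ : ℤ → ℝ}

lemma xx_add (h : Cov N θ) (i : ℤ) : xx θ (i + N) = xx θ i := by
  unfold xx
  rw [h.per]
  push_cast
  rw [add_mul, Complex.exp_add, Complex.exp_two_pi_mul_I, mul_one]

lemma xx_add_mul (h : Cov N θ) (i m : ℤ) : xx θ (i + m * N) = xx θ i := by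
  induction m using Int.induction_on with
  | zero => simp
  | succ m ih => rw [← ih, ← xx_add h (i + m * N)]; congr 1; ring
  | pred m ih => rw [← ih, ← xx_add h (i + (-m - 1) * N)]; congr 1; ring

lemma xx_sub (h : Cov N θ) (i : ℤ) : xx θ (i - N) = xx θ i := by
  rw [← xx_add h (i - N), sub_add_cancel]

lemma posArc_xx (h : Cov N θ) {a b : ℤ} (h1 : a < b) (h2 : b < a + N) :
    posArc (xx θ a) (xx θ b) = θ b - θ a := by
  have m1 := h.mono h1
  have m2 := h.mono h2
  rw [h.per] at m2
  have := posArc_exp (θ a) (φ := θ b - θ a) (by linarith) (by linarith)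
  rw [add_sub_cancel] at this
  exact this

lemma xx_ne (h : Cov N θ) {a b : ℤ} (h1 : a < b) (h2 : b < a + N) : xx θ a ≠ xx θ b := by
  intro e
  have h3 := posArc_xx h h1 h2
  have m1 := h.mono h1
  have m2 := h.mono h2
  rw [h.per] at m2
  rw [← e] at h3
  have : posArc (xx θ a) (xx θ a) = 2 * Real.pi := by
    unfold posArc
    have : xx θ a / xx θ a = 1 := div_self (Complex.exp_ne_zero _)
    rw [this]
    simp
  linarith

lemma xx_inj (h : Cov N θ) {a b c : ℤ} (h1 : a ≤ b) (h2 : b < a + N) (h3 : a ≤ c)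
    (h4 : c < a + N) (e : xx θ b = xx θ c) : b = c := by
  rcases lt_trichotomy b c with h5 | h5 | h5
  · exact absurd e (xx_ne h h5 (by omega))
  · exact h5
  · exact absurd e.symm (xx_ne h h5 (by omega))

lemma xx_rep (h : Cov N θ) (a i : ℤ) : ∃ b, a ≤ b ∧ b < a + N ∧ xx θ b = xx θ i ∧ ∃ m, b = i + m * N := by
  have hN : (0 : ℤ) < N := by exact_mod_cast h.hN
  have h1 := Int.emod_nonneg (i - a) hN.ne'
  have h2 := Int.emod_lt_of_pos (i - a) hN
  have h3 := Int.mul_ediv_add_emod (i - a) N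
  refine ⟨a + (i - a) % N, by omega, by omega, ?_, -((i - a) / N), by linarith⟩
  rw [← xx_add_mul h _ ((i - a) / N)]
  congr 1
  linarith

lemma xx_eq_iff (h : Cov N θ) {a b : ℤ} : xx θ a = xx θ b ↔ ∃ m : ℤ, b = a + m * N := by
  constructor
  · intro e
    obtain ⟨c, h1, h2, h3, m, h4⟩ := xx_rep h a b
    have hN := h.hN
    have := xx_inj h le_rfl (by omega) h1 h2 (e.trans h3.symm)
    exact ⟨-m, by linarith⟩
  · rintro ⟨m, rfl⟩
    exact (xx_add_mul h a m).symm

lemma vangle_xx (h : Cov N θ) {a b c : ℤ} (h1 : a < b) (h2 : b < a + N) (h3 : a < c)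
    (h4 : c < a + N) : vangle (xx θ b) (xx θ a) (xx θ c) = |θ b - θ c| / 2 := by
  have m1 := h.mono h1
  have m2 := h.mono h2
  have m3 := h.mono h3
  have m4 := h.mono h4
  rw [h.per] at m2 m4
  exact vangle_exp m1 m2 m3 m4

lemma splits_xx (h : Cov N θ) {a p n b : ℤ} (n1 : a < n) (hnp : n < p) (p1 : p < a + N)
    (b1 : a < b) (b2 : b < a + N) :
    SplitsAngle3 (xx θ p) (xx θ a) (xx θ n) (xx θ b) ↔ n < b ∧ b < p := by
  unfold SplitsAngle3
  rw [vangle_xx h (by omega) p1 b1 b2, vangle_xx h b1 b2 n1 (by omega),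
    vangle_xx h (by omega) p1 n1 (by omega)]
  have m1 := h.mono hnp
  rw [abs_of_pos (sub_pos.mpr m1)]
  constructor
  · rintro ⟨h1, h2, h3⟩
    have h1' : θ p - θ b ≠ 0 := by
      intro e; rw [e] at h1; simp at h1
    have h2' : θ b - θ n ≠ 0 := by
      intro e; rw [e] at h2; simp at h2
    have l1 := le_abs_self (θ p - θ b)
    have l2 := le_abs_self (θ b - θ n)
    have l3 := neg_abs_le (θ p - θ b)
    have l4 := neg_abs_le (θ b - θ n)
    have q1 : 0 ≤ θ p - θ b := by
      by_contra hn
      rw [abs_of_neg (not_le.mp hn)] at *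
      linarith
    have q2 : 0 ≤ θ b - θ n := by
      by_contra hn
      rw [abs_of_neg (not_le.mp hn)] at *
      linarith
    constructor
    · apply h.mono.lt_iff_lt.mp
      have := lt_of_le_of_ne q2 (Ne.symm h2')
      linarith
    · apply h.mono.lt_iff_lt.mp
      have := lt_of_le_of_ne q1 (Ne.symm h1')
      linarith
  · rintro ⟨h1, h2⟩
    have m2 := h.mono h1
    have m3 := h.mono h2
    rw [abs_of_pos (sub_pos.mpr m2), abs_of_pos (sub_pos.mpr m3)]
    refine ⟨by linarith, by linarith, by ring⟩

end

lemma cov_exists (V : Finset ℂ) (hne : V.Nonempty) (hc : ∀ v ∈ V, ‖v‖ = 1) :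
    ∃ θ, Cov V.card θ ∧ ∀ v, v ∈ V ↔ ∃ i, xx θ i = v := by
  set N := V.card with hNdef
  have hN : 0 < N := Finset.card_pos.mpr hne
  have hexp : ∀ v ∈ V, Complex.exp (Complex.arg v * Complex.I) = v := by
    intro v hv
    have := Complex.norm_mul_exp_arg_mul_I v
    rwa [hc v hv, Complex.ofReal_one, one_mul] at this
  have hcard : (V.image Complex.arg).card = N := by
    apply Finset.card_image_of_injOn
    intro u hu v hv e
    rw [← hexp u hu, ← hexp v hv, e]
  set emb := (V.image Complex.arg).orderEmbOfFin hcard with hemb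
  have hmem : ∀ i, ∃ v ∈ V, Complex.arg v = emb i := by
    intro i
    have := Finset.orderEmbOfFin_mem (V.image Complex.arg) hcard i
    exact Finset.mem_image.mp this
  have hb : ∀ i, -Real.pi < emb i ∧ emb i ≤ Real.pi := by
    intro i
    obtain ⟨v, -, hv⟩ := hmem i
    rw [← hv]
    exact Complex.arg_mem_Ioc v
  have hNz : (0 : ℤ) < N := by exact_mod_cast hN
  have hlt : ∀ i : ℤ, (i % N).toNat < N := by
    intro i
    have h1 := Int.emod_nonneg i hNz.ne'
    have h2 := Int.emod_lt_of_pos i hNz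
    omega
  set θ : ℤ → ℝ := fun i => emb ⟨(i % N).toNat, hlt i⟩ + 2 * Real.pi * ((i / N : ℤ) : ℝ) with hθ
  have hx : ∀ i, xx θ i = Complex.exp (emb ⟨(i % N).toNat, hlt i⟩ * Complex.I) := by
    intro i
    unfold xx
    have : ((θ i : ℝ) : ℂ) * Complex.I = (emb ⟨(i % N).toNat, hlt i⟩ : ℝ) * Complex.I +
        ((i / N : ℤ) : ℂ) * (2 * Real.pi * Complex.I) := by
      simp only [hθ]
      push_cast
      ring
    rw [this, Complex.exp_add, Complex.exp_int_mul_two_pi_mul_I, mul_one]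
  refine ⟨θ, ⟨hN, ?_, ?_⟩, ?_⟩
  · apply strictMono_int_of_lt_succ
    intro i
    have h1 := Int.emod_nonneg i hNz.ne'
    have h2 := Int.emod_lt_of_pos i hNz
    have h3 := Int.mul_ediv_add_emod i N
    by_cases hcase : i % N + 1 < N
    · have q : (i + 1) / N = i / N ∧ (i + 1) % N = i % N + 1 := by
        rw [Int.ediv_emod_unique hNz]
        refine ⟨by linarith, by omega, hcase⟩
      have : emb ⟨(i % N).toNat, hlt i⟩ < emb ⟨((i + 1) % N).toNat, hlt (i + 1)⟩ := by
        apply emb.strictMono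
        simp only [Fin.mk_lt_mk]
        omega
      simp only [hθ]
      rw [q.1]
      linarith
    · have q : (i + 1) / N = i / N + 1 ∧ (i + 1) % N = 0 := by
        rw [Int.ediv_emod_unique hNz]
        refine ⟨?_, le_rfl, hNz⟩
        have : i % N = N - 1 := by omega
        rw [this] at h3
        linarith
      simp only [hθ]
      rw [q.1]
      push_cast
      have b1 := hb ⟨(i % N).toNat, hlt i⟩
      have b2 := hb ⟨((i + 1) % N).toNat, hlt (i + 1)⟩
      linarith
  · intro i
    simp only [hθ, Int.add_emod_right]
    rw [Int.add_ediv_of_dvd_right (dvd_refl _), Int.ediv_self hNz.ne']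
    push_cast
    ring
  · intro v
    constructor
    · intro hv
      have : Complex.arg v ∈ Set.range emb := by
        rw [Finset.range_orderEmbOfFin]
        simp only [Finset.coe_image]
        exact ⟨v, hv, rfl⟩
      obtain ⟨⟨k, hk⟩, hk'⟩ := this
      refine ⟨k, ?_⟩
      rw [hx, ← hexp v hv, ← hk']
      have : ((k : ℤ) % N).toNat = k := by
        rw [Int.emod_eq_of_lt (by omega) (by exact_mod_cast hk)]
        simp
      simp only [this]
    · rintro ⟨i, rfl⟩
      obtain ⟨v, hv, e⟩ := hmem ⟨(i % N).toNat, hlt i⟩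
      rw [hx, ← e, hexp v hv]
      exact hv

end StarFlip


namespace StarFlip
open Comb

/-- The lift of a cyclic polygon. -/
structure PLift (N : ℕ) (θ : ℤ → ℝ) (S : CyclicPolygon) (ns ps : ℤ → ℤ) : Prop where
  lt_ns : ∀ i, xx θ i ∈ S.V → i < ns i
  ns_lt : ∀ i, xx θ i ∈ S.V → ns i < i + N
  ns_mem : ∀ i, xx θ i ∈ S.V → (xx θ i, xx θ (ns i)) ∈ S.E
  ps_lt : ∀ i, xx θ i ∈ S.V → ps i < i
  lt_ps : ∀ i, xx θ i ∈ S.V → i < ps i + N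
  ps_mem : ∀ i, xx θ i ∈ S.V → (xx θ (ps i), xx θ i) ∈ S.E
  acw : ∀ i, xx θ i ∈ S.V → ns i < ps i + N

section
variable {N : ℕ} {θ : ℤ → ℝ} {S : CyclicPolygon} {ns ps : ℤ → ℤ}

lemma out_unique {u v w : ℂ} (h : (u, v) ∈ S.E) (h' : (u, w) ∈ S.E) : v = w :=
  (S.outdeg u (S.endmem _ h).1).unique h h'

lemma in_unique {u v w : ℂ} (h : (u, w) ∈ S.E) (h' : (v, w) ∈ S.E) : u = v :=
  (S.indeg w (S.endmem _ h).2).unique h h'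

lemma edge_ne {u v : ℂ} (h : (u, v) ∈ S.E) : u ≠ v := by
  obtain ⟨t, ht, -⟩ := S.indeg u (S.endmem _ h).1
  exact (S.acw _ _ _ ht h).2.1

lemma next_eq {u v : ℂ} (h : (u, v) ∈ S.E) : S.next u = v := by
  have hex : ∃ w, (u, w) ∈ S.E := ⟨v, h⟩
  unfold CyclicPolygon.next
  rw [dif_pos hex]
  exact out_unique hex.choose_spec h

lemma prev_eq {u v : ℂ} (h : (u, v) ∈ S.E) : S.prev v = u := by
  have hex : ∃ w, (w, v) ∈ S.E := ⟨u, h⟩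
  unfold CyclicPolygon.prev
  rw [dif_pos hex]
  exact in_unique hex.choose_spec h

lemma plift_exists (h : Cov N θ) (S : CyclicPolygon) (hV : ∀ v ∈ S.V, ∃ i, xx θ i = v) :
    ∃ ns ps, PLift N θ S ns ps := by
  have key : ∀ i, ∃ b c, xx θ i ∈ S.V → (i < b ∧ b < i + N ∧ (xx θ i, xx θ b) ∈ S.E) ∧
      (c < i ∧ i < c + N ∧ (xx θ c, xx θ i) ∈ S.E) ∧ b < c + N := by
    intro i
    by_cases hi : xx θ i ∈ S.V
    · obtain ⟨w, hw, -⟩ := S.outdeg _ hi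
      obtain ⟨u, hu, -⟩ := S.indeg _ hi
      obtain ⟨w', rfl⟩ := hV w (S.endmem _ hw).2
      obtain ⟨u', rfl⟩ := hV u (S.endmem _ hu).1
      obtain ⟨b, b1, b2, b3, -⟩ := xx_rep h i w'
      obtain ⟨c, c1, c2, c3, -⟩ := xx_rep h (i - N) u'
      rw [← b3] at hw
      rw [← c3] at hu
      have n1 : i ≠ b := by rintro rfl; exact edge_ne hw rfl
      have n2 : i - N ≠ c := by
        rintro rfl
        rw [xx_sub h] at hu
        exact edge_ne hu rfl
      have hacw := S.acw _ _ _ hu hw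
      refine ⟨b, c, fun _ => ⟨⟨by omega, b2, hw⟩, ⟨by omega, by omega, hu⟩, ?_⟩⟩
      obtain ⟨a1, a2, a3, a4⟩ := hacw
      rw [posArc_xx h (by omega) (by omega)] at a4
      by_contra hn
      rcases eq_or_lt_of_le (not_lt.mp hn) with h5 | h5
      · rw [← h5, xx_add h] at a3
        exact a3 rfl
      · rw [← xx_sub h b, posArc_xx h (by omega) (by omega)] at a4
        have := h.mono (show b - N < i by omega)
        linarith
    · exact ⟨0, 0, fun h => absurd h hi⟩
  choose ns ps hk using key
  exact ⟨ns, ps, fun i hi => (hk i hi).1.1, fun i hi => (hk i hi).1.2.1,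
    fun i hi => (hk i hi).1.2.2, fun i hi => (hk i hi).2.1.1, fun i hi => (hk i hi).2.1.2.1,
    fun i hi => (hk i hi).2.1.2.2, fun i hi => (hk i hi).2.2⟩

lemma PLift.uniq (h : Cov N θ) (pl : PLift N θ S ns ps) {a b : ℤ} (h1 : a < b) (h2 : b < a + N)
    (he : (xx θ a, xx θ b) ∈ S.E) : b = ns a := by
  have ha := (S.endmem _ he).1
  have := out_unique he (pl.ns_mem a ha)
  exact xx_inj h h1.le h2 (pl.lt_ns a ha).le (pl.ns_lt a ha) this

lemma PLift.uniq' (h : Cov N θ) (pl : PLift N θ S ns ps) {a b : ℤ} (h1 : a < b) (h2 : b < a + N)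
    (he : (xx θ a, xx θ b) ∈ S.E) : a = ps b := by
  have hb := (S.endmem _ he).2
  have := in_unique he (pl.ps_mem b hb)
  have := pl.ps_lt b hb
  have := pl.lt_ps b hb
  refine xx_inj h (a := b - N) (by omega) (by omega) (by omega) (by omega) ?_
  assumption

lemma PLift.J_ns (pl : PLift N θ S ns ps) (i : ℤ) (hi : xx θ i ∈ S.V) :
    xx θ (ns i) ∈ S.V := (S.endmem _ (pl.ns_mem i hi)).2

lemma PLift.J_ps (pl : PLift N θ S ns ps) (i : ℤ) (hi : xx θ i ∈ S.V) :
    xx θ (ps i) ∈ S.V := (S.endmem _ (pl.ps_mem i hi)).1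

lemma PLift.ns_ps (h : Cov N θ) (pl : PLift N θ S ns ps) (i : ℤ) (hi : xx θ i ∈ S.V) :
    ns (ps i) = i :=
  (pl.uniq h (pl.ps_lt i hi) (pl.lt_ps i hi) (pl.ps_mem i hi)).symm

lemma PLift.ps_ns (h : Cov N θ) (pl : PLift N θ S ns ps) (i : ℤ) (hi : xx θ i ∈ S.V) :
    ps (ns i) = i :=
  (pl.uniq' h (pl.lt_ns i hi) (pl.ns_lt i hi) (pl.ns_mem i hi)).symm

lemma PLift.ns_add (h : Cov N θ) (pl : PLift N θ S ns ps) (i : ℤ) (hi : xx θ i ∈ S.V) :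
    ns (i + N) = ns i + N := by
  have h1 := pl.lt_ns i hi
  have h2 := pl.ns_lt i hi
  refine (pl.uniq h (by omega) (by omega) ?_).symm
  rw [xx_add h, xx_add h]
  exact pl.ns_mem i hi

lemma PLift.ps_add (h : Cov N θ) (pl : PLift N θ S ns ps) (i : ℤ) (hi : xx θ i ∈ S.V) :
    ps (i + N) = ps i + N := by
  have h1 := pl.ps_lt i hi
  have h2 := pl.lt_ps i hi
  refine (pl.uniq' h (by omega) (by omega) ?_).symm
  rw [xx_add h, xx_add h]
  exact pl.ps_mem i hi

lemma count_all (h : Cov N θ) (hV : ∀ v ∈ S.V, ∃ i, xx θ i = v) (i : ℤ) :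
    ct (fun i => xx θ i ∈ S.V) i (i + N) = S.V.card := by
  have : ((Finset.Ico i (i + N)).filter (fun i => xx θ i ∈ S.V)).image (xx θ) = S.V := by
    ext v
    simp only [Finset.mem_image, Finset.mem_filter, Finset.mem_Ico]
    constructor
    · rintro ⟨c, ⟨-, hc⟩, rfl⟩; exact hc
    · intro hv
      obtain ⟨c, rfl⟩ := hV v hv
      obtain ⟨b, b1, b2, b3, -⟩ := xx_rep h i c
      exact ⟨b, ⟨⟨b1, b2⟩, by rw [b3]; exact hv⟩, b3⟩
  unfold ct
  rw [← this, Finset.card_image_of_injOn]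
  · simp only [this]
  · intro b hb c hc e
    simp only [Finset.coe_filter, Finset.mem_Ico] at hb hc
    exact xx_inj h hb.1.1 hb.1.2 hc.1.1 hc.1.2 e

lemma count_arc (h : Cov N θ) (hV : ∀ v ∈ S.V, ∃ i, xx θ i = v) {i b : ℤ} (h1 : i < b)
    (h2 : b < i + N) (hi : xx θ i ∈ S.V) :
    ct (fun i => xx θ i ∈ S.V) i b = edgeLength S (xx θ i) (xx θ b) := by
  have e1 : (S.V : Set ℂ) ∩ arcOO (xx θ i) (xx θ b) =
      (((Finset.Ioo i b).filter (fun i => xx θ i ∈ S.V)).image (xx θ) : Finset ℂ) := by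
    ext v
    simp only [Finset.coe_image, Finset.coe_filter, Finset.mem_Ioo, Set.mem_image,
      Set.mem_inter_iff, Finset.mem_coe]
    constructor
    · rintro ⟨hv, n1, n2, n3⟩
      obtain ⟨c, rfl⟩ := hV v hv
      obtain ⟨d, d1, d2, d3, -⟩ := xx_rep h i c
      rw [← d3] at n1 n2 n3 hv ⊢
      have hd : i ≠ d := by rintro rfl; exact n1 rfl
      rw [posArc_xx h (by omega) d2, posArc_xx h h1 h2] at n3
      have : d < b := h.mono.lt_iff_lt.mp (by linarith)
      exact ⟨d, ⟨⟨by omega, this⟩, hv⟩, rfl⟩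
    · rintro ⟨d, ⟨⟨d1, d2⟩, hd⟩, rfl⟩
      refine ⟨hd, (xx_ne h d1 (by omega)).symm, xx_ne h d2 (by omega), ?_⟩
      rw [posArc_xx h (by omega) (by omega), posArc_xx h h1 h2]
      have := h.mono d2
      linarith
  unfold edgeLength ct
  rw [e1, Set.ncard_coe_finset, Finset.card_image_of_injOn]
  · have : (Finset.Ico i b).filter (fun i => xx θ i ∈ S.V) =
        insert i ((Finset.Ioo i b).filter (fun i => xx θ i ∈ S.V)) := by
      ext c
      simp only [Finset.mem_insert, Finset.mem_filter, Finset.mem_Ico, Finset.mem_Ioo]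
      constructor
      · rintro ⟨⟨c1, c2⟩, hc⟩
        rcases eq_or_lt_of_le c1 with h3 | h3
        · exact Or.inl h3.symm
        · exact Or.inr ⟨⟨h3, c2⟩, hc⟩
      · rintro (rfl | ⟨⟨c1, c2⟩, hc⟩)
        · exact ⟨⟨le_rfl, h1⟩, hi⟩
        · exact ⟨⟨c1.le, c2⟩, hc⟩
    have hc := congrArg Finset.card this
    rw [Finset.card_insert_of_notMem (by simp)] at hc
    convert hc using 2
    ext c
    simp only [Finset.mem_filter]
  · intro b hb c hc e
    simp only [Finset.coe_filter, Finset.mem_Ioo] at hb hc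
    exact xx_inj h (a := i) hb.1.1.le (by have := hb.1.2; omega) hc.1.1.le
      (by have := hc.1.2; omega) e

end

/-- The data attached to a polygon. -/
structure Setup (P : CyclicPolygon) (K : Comb) (θ : ℤ → ℝ) : Prop where
  cov : Cov K.N θ
  hV : ∀ v, v ∈ P.V ↔ ∃ i, xx θ i = v
  pl : PLift K.N θ P K.σ K.τ

lemma setup_exists (P : CyclicPolygon) : ∃ K θ, Setup P K θ := by
  obtain ⟨θ, h, hV⟩ := cov_exists P.V P.nonempty P.onCircle
  obtain ⟨ns, ps, pl⟩ := plift_exists h P (fun v hv => (hV v).mp hv)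
  have hall : ∀ i, xx θ i ∈ P.V := fun i => (hV _).mpr ⟨i, rfl⟩
  exact ⟨⟨P.V.card, ns, ps, h.hN, fun i => pl.ns_ps h i (hall i), fun i => pl.ps_ns h i (hall i),
    fun i => pl.ns_add h i (hall i), fun i => pl.ps_add h i (hall i), fun i => pl.lt_ns i (hall i),
    fun i => pl.acw i (hall i)⟩, θ, h, hV, pl⟩

/-- The lift of a set of diagonals. -/
def DL (K : Comb) (θ : ℤ → ℝ) (D : Set (Sym2 ℂ)) (a b : ℤ) : Prop :=
  a < b ∧ b < a + K.N ∧ s(xx θ a, xx θ b) ∈ D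

section
variable {P : CyclicPolygon} {K : Comb} {θ : ℤ → ℝ} {D : Set (Sym2 ℂ)}

lemma Setup.mem (hs : Setup P K θ) (i : ℤ) : xx θ i ∈ P.V := (hs.hV _).mpr ⟨i, rfl⟩

lemma Setup.splits (hs : Setup P K θ) {a b : ℤ} (h1 : a < b) (h2 : b < a + K.N) :
    SplitsVertexAngle P (xx θ a) (xx θ b) ↔ K.σ a < b ∧ b < K.τ a + K.N := by
  have hm := hs.mem a
  have e1 := next_eq (hs.pl.ns_mem a hm)
  have e2 := prev_eq (hs.pl.ps_mem a hm)
  have t := K.τ_lt a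
  rw [← splits_xx hs.cov (K.lt_σ a) (K.acw a) (by omega) h1 h2]
  unfold SplitsVertexAngle SplitsAngle3
  rw [e1, e2, xx_add hs.cov]
  simp [hm]

lemma Setup.linkable (hs : Setup P K θ) {a b : ℤ} (h1 : a < b) (h2 : b < a + K.N) :
    Linkable P (xx θ a) (xx θ b) ↔ K.L a b := by
  unfold Linkable LinkablePair
  have h3 := hs.splits (a := b) (b := a + K.N) h2 (by omega)
  rw [xx_add hs.cov] at h3
  rw [hs.splits h1 h2, h3]
  have := xx_ne hs.cov h1 h2
  unfold Comb.L
  constructor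
  · rintro ⟨-, ⟨h4, h5⟩, h6, h7⟩
    refine ⟨h4, h5, h6, by omega⟩
  · rintro ⟨h4, h5, h6, h7⟩
    exact ⟨this, ⟨h4, h5⟩, h6, by omega⟩

lemma Setup.isDiag (hs : Setup P K θ) (hD : IsDiagonalSet P D) : K.IsDiag (DL K θ D) where
  link := by
    rintro a b ⟨h1, h2, h3⟩
    exact (hs.linkable h1 h2).mp (hD _ _ h3)
  flip := by
    intro a b
    unfold DL
    rw [xx_add hs.cov, Sym2.eq_swap]
    constructor
    · rintro ⟨h1, h2, h3⟩; exact ⟨h2, by omega, h3⟩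
    · rintro ⟨h1, h2, h3⟩; exact ⟨by omega, h1, h3⟩

lemma Setup.lift_pair (hs : Setup P K θ) {u v : ℂ} (hu : u ∈ P.V) (hv : v ∈ P.V) (hne : u ≠ v)
    (a : ℤ) (ha : xx θ a = u) : ∃ b, a < b ∧ b < a + K.N ∧ xx θ b = v := by
  obtain ⟨i, rfl⟩ := (hs.hV v).mp hv
  obtain ⟨b, b1, b2, b3, -⟩ := xx_rep hs.cov a i
  refine ⟨b, ?_, b2, b3⟩
  rcases eq_or_lt_of_le b1 with h | h
  · subst h; rw [ha] at b3; exact absurd b3 hne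
  · exact h

lemma linkable_mem {u v : ℂ} (h : Linkable P u v) : u ∈ P.V ∧ v ∈ P.V ∧ u ≠ v :=
  ⟨h.2.1.1, h.2.2.1, h.1⟩

lemma Setup.edge_iff (hs : Setup P K θ) {a b : ℤ} (h1 : a < b) (h2 : b < a + K.N) :
    (xx θ a, xx θ b) ∈ (P.E : Set (ℂ × ℂ)) ∪ tilde D ↔ DL K θ D a b ∨ b = K.σ a := by
  have e : (xx θ a, xx θ b) ∈ P.E ↔ b = K.σ a :=
    ⟨fun h => hs.pl.uniq hs.cov h1 h2 h, fun h => by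
      rw [h]; exact hs.pl.ns_mem a (hs.mem a)⟩
  simp only [Set.mem_union, Finset.mem_coe, e, tilde, DL, h1, h2, true_and]
  exact or_comm

lemma star_lift (hs : Setup P K θ) {𝒮 : Finset CyclicPolygon} (h : IsStarDecomp P D 𝒮)
    {S : CyclicPolygon} (hS : S ∈ 𝒮) :
    ∃ ns ps, PLift K.N θ S ns ps ∧ LStar K (DL K θ D) (fun i => xx θ i ∈ S.V) ns ps := by
  obtain ⟨hD, h1, h2, h3, h4, h5⟩ := h
  obtain ⟨hst, hsub⟩ := h1 S hS
  have hV : ∀ v ∈ S.V, ∃ i, xx θ i = v := fun v hv => (hs.hV v).mp (hsub hv)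
  obtain ⟨ns, ps, pl⟩ := plift_exists hs.cov S hV
  refine ⟨ns, ps, pl, ?_, pl.J_ns, pl.J_ps, pl.ns_ps hs.cov, pl.ps_ns hs.cov, pl.ns_add hs.cov,
    pl.lt_ns, pl.acw, ?_, ?_, ?_⟩
  · intro i
    rw [xx_add hs.cov]
  · intro i hi
    have := h2 S hS (pl.ns_mem i hi)
    rw [hs.edge_iff (pl.lt_ns i hi) (pl.ns_lt i hi)] at this
    rcases this with h | h
    · exact Or.inl h
    · exact Or.inr (Or.inl h)
  · intro i hi c c1 c2 hc
    apply h5 S hS _ _ _ (pl.ps_mem i hi) (pl.ns_mem i hi)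
    refine ⟨xx θ c, hc.2.2, ?_⟩
    have p1 := pl.ps_lt i hi
    have p2 := pl.lt_ns i hi
    have := (splits_xx hs.cov p2 (pl.acw i hi) (by omega) hc.1 hc.2.1).mpr ⟨c1, c2⟩
    rwa [xx_add hs.cov] at this
  · obtain ⟨k, hk, hk1, hk2⟩ := hst
    refine ⟨k, hk, fun i hi => ⟨?_, ?_⟩⟩
    · rw [count_arc hs.cov hV (pl.lt_ns i hi) (pl.ns_lt i hi) hi]
      exact hk2 _ (pl.ns_mem i hi)
    · rw [count_all hs.cov hV, hk1]

lemma per_of_decomp (hs : Setup P K θ) {𝒮 : Finset CyclicPolygon} (h : IsStarDecomp P D 𝒮) :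
    Per K (DL K θ D) := by
  have hD := hs.isDiag h.1
  intro j hj
  obtain ⟨t, ho, hC⟩ := event_exists hD hj
  set a := j t with ha
  set b := t - a with hb
  have hlt := C_lt hD hC
  have hed : (xx θ a, xx θ b) ∈ (P.E : Set (ℂ × ℂ)) ∪ tilde D := by
    rw [hs.edge_iff hlt.1 hlt.2]
    rcases hC with h | h | h
    · exact Or.inl h
    · exact Or.inr h
    · have := ho.2; omega
  obtain ⟨S, hS, he⟩ := h.2.2.2.1 _ hed
  obtain ⟨ns, ps, pl, hl⟩ := star_lift hs h hS
  have hb2 := pl.uniq hs.cov hlt.1 hlt.2 he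
  refine hl.per hD hj (a := a) (S.endmem _ he).1 ?_
  rw [← hb2, hb, ha]
  congr 1
  ring

end

end StarFlip


namespace StarFlip
open Comb

section
variable {K : Comb} {θ : ℤ → ℝ} {D : ℤ → ℤ → Prop} {J : ℤ → Prop} {ns ps : ℤ → ℤ}

lemma Comb.LStar.J_add_mul (h : LStar K D J ns ps) (i m : ℤ) : J (i + m * K.N) ↔ J i := by
  induction m using Int.induction_on with
  | zero => simp
  | succ m ih =>
    rw [← ih, ← h.J_add (i + m * K.N)]
    rw [show i + (m + 1 : ℤ) * K.N = i + m * K.N + K.N by ring]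
  | pred m ih =>
    rw [← ih, ← h.J_add (i + (-m - 1) * K.N)]
    rw [show i + (-m - 1 : ℤ) * K.N + K.N = i + -m * K.N by ring]

lemma Comb.LStar.ns_add_mul (h : LStar K D J ns ps) {i : ℤ} (hi : J i) (m : ℤ) :
    ns (i + m * K.N) = ns i + m * K.N := by
  induction m using Int.induction_on with
  | zero => simp
  | succ m ih =>
    rw [show i + (m + 1 : ℤ) * K.N = i + m * K.N + K.N by ring,
      h.ns_add _ ((h.J_add_mul i m).mpr hi), ih]
    ring
  | pred m ih =>
    have h1 := h.ns_add _ ((h.J_add_mul i (-m - 1)).mpr hi)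
    rw [show i + (-m - 1 : ℤ) * K.N + K.N = i + -m * K.N by ring, ih] at h1
    linarith

/-- `S` is the polygon with lift `(J, ns)`. -/
def PO (θ : ℤ → ℝ) (J : ℤ → Prop) (ns : ℤ → ℤ) (S : CyclicPolygon) : Prop :=
  (∀ v, v ∈ S.V ↔ ∃ i, J i ∧ xx θ i = v) ∧
  (∀ e, e ∈ S.E ↔ ∃ i, J i ∧ e = (xx θ i, xx θ (ns i)))

lemma Comb.LStar.ns_lt (h : LStar K D J ns ps) {i : ℤ} (hi : J i) : ns i < i + K.N := by
  have h1 := h.acw i hi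
  have h2 := h.lt_ns _ (h.J_ps i hi)
  rw [h.ns_ps i hi] at h2
  omega

lemma Comb.LStar.po (hc : Cov K.N θ) (h : LStar K D J ns ps) (hne : ∃ i, J i) :
    ∃ S : CyclicPolygon, PO θ J ns S := by
  have hV : ∀ v, v ∈ ((Finset.Ico (0 : ℤ) K.N).filter J).image (xx θ) ↔
      ∃ i, J i ∧ xx θ i = v := by
    intro v
    simp only [Finset.mem_image, Finset.mem_filter, Finset.mem_Ico]
    constructor
    · rintro ⟨i, ⟨-, hi⟩, rfl⟩; exact ⟨i, hi, rfl⟩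
    · rintro ⟨i, hi, rfl⟩
      obtain ⟨b, b1, b2, b3, m, rfl⟩ := xx_rep hc 0 i
      exact ⟨_, ⟨⟨b1, by omega⟩, (h.J_add_mul i m).mpr hi⟩, b3⟩
  have hE : ∀ e, e ∈ ((Finset.Ico (0 : ℤ) K.N).filter J).image
      (fun i => (xx θ i, xx θ (ns i))) ↔ ∃ i, J i ∧ e = (xx θ i, xx θ (ns i)) := by
    intro v
    simp only [Finset.mem_image, Finset.mem_filter, Finset.mem_Ico]
    constructor
    · rintro ⟨i, ⟨-, hi⟩, rfl⟩; exact ⟨i, hi, rfl⟩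
    · rintro ⟨i, hi, rfl⟩
      obtain ⟨b, b1, b2, b3, m, rfl⟩ := xx_rep hc 0 i
      refine ⟨_, ⟨⟨b1, by omega⟩, (h.J_add_mul i m).mpr hi⟩, ?_⟩
      rw [h.ns_add_mul hi, xx_add_mul hc, xx_add_mul hc]
  refine ⟨⟨_, _, ?_, ?_, ?_, ?_, ?_, ?_⟩, hV, hE⟩
  · obtain ⟨i, hi⟩ := hne
    exact ⟨_, (hV _).mpr ⟨i, hi, rfl⟩⟩
  · intro v hv
    obtain ⟨i, -, rfl⟩ := (hV _).mp hv
    exact Complex.norm_exp_ofReal_mul_I _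
  · intro e he
    obtain ⟨i, hi, rfl⟩ := (hE _).mp he
    exact ⟨(hV _).mpr ⟨i, hi, rfl⟩, (hV _).mpr ⟨_, h.J_ns i hi, rfl⟩⟩
  · intro v hv
    obtain ⟨i, hi, rfl⟩ := (hV _).mp hv
    refine ⟨xx θ (ns i), (hE _).mpr ⟨i, hi, rfl⟩, ?_⟩
    intro w hw
    obtain ⟨i', hi', e⟩ := (hE _).mp hw
    simp only [Prod.mk.injEq] at e
    obtain ⟨m, rfl⟩ := (xx_eq_iff hc).mp e.1
    rw [e.2, h.ns_add_mul hi, xx_add_mul hc]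
  · intro v hv
    obtain ⟨i, hi, rfl⟩ := (hV _).mp hv
    refine ⟨xx θ (ps i), (hE _).mpr ⟨_, h.J_ps i hi, by rw [h.ns_ps i hi]⟩, ?_⟩
    intro w hw
    obtain ⟨i', hi', e⟩ := (hE _).mp hw
    simp only [Prod.mk.injEq] at e
    obtain ⟨m, e2⟩ := (xx_eq_iff hc).mp e.2
    have e3 := h.ns_add_mul hi' (-m)
    rw [e2] at e3
    have e4 : ns (i' + -m * K.N) = i := by rw [e3]; ring
    have hj := (h.J_add_mul i' (-m)).mpr hi'
    have e5 := h.ps_ns _ hj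
    rw [e4] at e5
    rw [e5, e.1, xx_add_mul hc]
  · intro u v w hu hw
    obtain ⟨i, hi, e⟩ := (hE _).mp hu
    obtain ⟨i', hi', e'⟩ := (hE _).mp hw
    simp only [Prod.mk.injEq] at e e'
    obtain ⟨rfl, rfl⟩ := e
    obtain ⟨e1, rfl⟩ := e'
    obtain ⟨m, rfl⟩ := (xx_eq_iff hc).mp e1
    have hn := h.J_ns i hi
    rw [h.ns_add_mul hn, xx_add_mul hc]
    have l1 := h.lt_ns i hi
    have l2 := h.lt_ns _ hn
    have l3 := h.acw _ hn
    rw [h.ps_ns i hi] at l3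
    refine ⟨xx_ne hc l1 (by omega), xx_ne hc l2 (by omega), xx_ne hc (l1.trans l2) l3, ?_⟩
    rw [posArc_xx hc l1 (by omega), posArc_xx hc (l1.trans l2) l3]
    have := hc.mono l2
    linarith

lemma PO.mem (hc : Cov K.N θ) (h : LStar K D J ns ps) {S : CyclicPolygon} (hS : PO θ J ns S)
    (i : ℤ) : xx θ i ∈ S.V ↔ J i := by
  rw [hS.1]
  constructor
  · rintro ⟨i', hi', e⟩
    obtain ⟨m, rfl⟩ := (xx_eq_iff hc).mp e
    exact (h.J_add_mul i' m).mpr hi'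
  · intro hi; exact ⟨i, hi, rfl⟩

lemma PO.isStar (hc : Cov K.N θ) (h : LStar K D J ns ps) {S : CyclicPolygon}
    (hS : PO θ J ns S) (hne : ∃ i, J i) : IsStar S := by
  obtain ⟨k, hk, hk'⟩ := h.star
  have hJ : (fun i => xx θ i ∈ S.V) = J := by
    funext i; exact propext (hS.mem hc h i)
  have hV : ∀ v ∈ S.V, ∃ i, xx θ i = v := fun v hv => by
    obtain ⟨i, -, hi⟩ := (hS.1 v).mp hv; exact ⟨i, hi⟩
  obtain ⟨i, hi⟩ := hne
  refine ⟨k, hk, ?_, ?_⟩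
  · rw [← count_all hc hV i, hJ, (hk' i hi).2]
  · intro e he
    obtain ⟨i, hi, rfl⟩ := (hS.2 _).mp he
    rw [← (hk' i hi).1, ← hJ, count_arc hc hV (h.lt_ns i hi) (h.ns_lt hi) ((hS.mem hc h i).mpr hi)]

lemma polygon_ext {S T : CyclicPolygon} (h1 : S.V = T.V) (h2 : S.E = T.E) : S = T := by
  cases S; cases T
  simp only at h1 h2
  subst h1 h2
  rfl

end

/-- The stars coming from strands. -/
def IsPiece (K : Comb) (θ : ℤ → ℝ) (D : ℤ → ℤ → Prop) (S : CyclicPolygon) : Prop :=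
  ∃ (j ns ps : ℤ → ℤ), Strand K D j ∧ LStar K D (fun i => ∃ t, j t = i) ns ps ∧
    (∀ a b, ((∃ t, j t = a) ∧ b = ns a) ↔ (K.C D a b ∧ j (a + b) = a)) ∧
    PO θ (fun i => ∃ t, j t = i) ns S

section
variable {P : CyclicPolygon} {K : Comb} {θ : ℤ → ℝ} {D : Set (Sym2 ℂ)}

lemma pieces_finite (hs : Setup P K θ) (D : ℤ → ℤ → Prop) : {S | IsPiece K θ D S}.Finite := by
  apply Set.Finite.of_finite_image (f := fun S : CyclicPolygon => (S.V, S.E))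
  · apply Set.Finite.subset (((P.V.powerset) ×ˢ ((P.V ×ˢ P.V).powerset) :
      Finset (Finset ℂ × Finset (ℂ × ℂ))).finite_toSet)
    rintro _ ⟨S, ⟨j, ns, ps, -, -, -, hS⟩, rfl⟩
    simp only [Finset.coe_product, Set.mem_prod, Finset.mem_coe, Finset.mem_powerset]
    constructor
    · intro v hv
      obtain ⟨i, -, rfl⟩ := (hS.1 v).mp hv
      exact hs.mem i
    · intro e he
      obtain ⟨i, -, rfl⟩ := (hS.2 e).mp he
      exact Finset.mem_product.mpr ⟨hs.mem _, hs.mem _⟩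
  · intro S _ T _ e
    simp only [Prod.mk.injEq] at e
    exact polygon_ext e.1 e.2

lemma decomp_of_per (hs : Setup P K θ) (hD : IsDiagonalSet P D) (hP : Per K (DL K θ D)) :
    HasStarDecomp P D := by
  have hd := hs.isDiag hD
  have hc := hs.cov
  refine ⟨(pieces_finite hs (DL K θ D)).toFinset, hD, ?_, ?_, ?_, ?_, ?_⟩
  · intro S hS
    simp only [Set.Finite.mem_toFinset, Set.mem_ofPred_eq] at hS
    obtain ⟨j, ns, ps, hj, hl, -, po⟩ := hS
    refine ⟨po.isStar hc hl ⟨j 0, 0, rfl⟩, ?_⟩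
    intro v hv
    obtain ⟨i, -, rfl⟩ := (po.1 v).mp hv
    exact hs.mem i
  · intro S hS
    simp only [Set.Finite.mem_toFinset, Set.mem_ofPred_eq] at hS
    obtain ⟨j, ns, ps, hj, hl, -, po⟩ := hS
    intro e he
    obtain ⟨i, hi, rfl⟩ := (po.2 e).mp he
    rw [hs.edge_iff (hl.lt_ns i hi) (hl.ns_lt hi)]
    rcases hl.edge i hi with h | h | h
    · exact Or.inl h
    · exact Or.inr h
    · exfalso
      have e1 := hl.acw i hi
      have e2 := hl.edge _ (hl.J_ps i hi)
      rw [hl.ns_ps i hi] at e2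
      have e3 := C_cases hd e2
      have e4 := (C_flip hd).mp e2
      have e5 := C_cases hd e4
      have e6 := K.acw i
      rcases e5 with e5 | e5 | e5 <;> omega
  · rintro ⟨u, v⟩ he
    have hm : u ∈ P.V ∧ v ∈ P.V ∧ u ≠ v := by
      rcases he with h | h
      · have := P.endmem _ h
        exact ⟨this.1, this.2, edge_ne h⟩
      · exact linkable_mem (hD _ _ h)
    obtain ⟨a, rfl⟩ := (hs.hV u).mp hm.1
    obtain ⟨b, b1, b2, rfl⟩ := hs.lift_pair hm.1 hm.2.1 hm.2.2 a rfl
    rw [hs.edge_iff b1 b2] at he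
    have hC : K.C (DL K θ D) a b := by
      rcases he with h | h
      · exact Or.inl h
      · exact Or.inr (Or.inl h)
    have ho : K.Out (a + b) a := by
      unfold Comb.Out
      rcases he with h | h
      · have := hd.link _ _ h
        unfold Comb.L at this
        omega
      · have := K.acw a
        omega
    obtain ⟨j, hj, hja⟩ := strand_exists hd (Or.inl ho : K.Act (a + b) a)
    obtain ⟨ns, ps, hl, hE⟩ := strand_star hd hj (hP j hj)
    obtain ⟨S, po⟩ := hl.po hc ⟨j 0, 0, rfl⟩
    refine ⟨S, ?_, ?_⟩
    · simp only [Set.Finite.mem_toFinset, Set.mem_ofPred_eq]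
      exact ⟨j, ns, ps, hj, hl, hE, po⟩
    · obtain ⟨h1, h2⟩ := (hE a b).mpr ⟨hC, hja⟩
      exact (po.2 _).mpr ⟨a, h1, by rw [h2]⟩
  · intro S hS T hT hne e heS heT
    simp only [Set.Finite.mem_toFinset, Set.mem_ofPred_eq] at hS hT
    obtain ⟨j, ns, ps, hj, hl, hE, po⟩ := hS
    obtain ⟨j', ns', ps', hj', hl', hE', po'⟩ := hT
    apply hne
    obtain ⟨i, hi, rfl⟩ := (po.2 e).mp heS
    obtain ⟨i', hi', e⟩ := (po'.2 _).mp heT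
    simp only [Prod.mk.injEq] at e
    obtain ⟨m, rfl⟩ := (xx_eq_iff hc).mp e.1
    have hi2 := (hl'.J_add_mul i m).mp hi'
    have e2 := e.2
    rw [hl'.ns_add_mul hi2, xx_add_mul hc] at e2
    have e3 := xx_inj hc (a := i) (hl.lt_ns i hi).le (hl.ns_lt hi) (hl'.lt_ns i hi2).le
      (hl'.ns_lt hi2) e2
    have f1 := ((hE i (ns i)).mp ⟨hi, rfl⟩).2
    have f2 := ((hE' i (ns' i)).mp ⟨hi2, rfl⟩).2
    rw [← e3] at f2
    have hjj : j = j' := funext fun t => strand_ext hj hj' (f1.trans f2.symm) t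
    subst hjj
    have hns : ∀ a, (∃ t, j t = a) → ns a = ns' a := by
      intro a ha
      have g := (hE a (ns a)).mp ⟨ha, rfl⟩
      exact ((hE' a (ns a)).mpr g).2
    apply polygon_ext
    · ext v
      rw [po.1, po'.1]
    · ext v
      rw [po.2, po'.2]
      constructor
      · rintro ⟨a, ha, rfl⟩; exact ⟨a, ha, by rw [hns a ha]⟩
      · rintro ⟨a, ha, rfl⟩; exact ⟨a, ha, by rw [hns a ha]⟩
  · intro S hS u v w hu hw
    simp only [Set.Finite.mem_toFinset, Set.mem_ofPred_eq] at hS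
    obtain ⟨j, ns, ps, hj, hl, -, po⟩ := hS
    rintro ⟨y, hy, hsp⟩
    obtain ⟨i, hi, e⟩ := (po.2 _).mp hw
    simp only [Prod.mk.injEq] at e
    obtain ⟨rfl, rfl⟩ := e
    have hu2 : (xx θ (ps i), xx θ i) ∈ S.E :=
      (po.2 _).mpr ⟨_, hl.J_ps i hi, by rw [hl.ns_ps i hi]⟩
    have := in_unique hu hu2
    subst this
    have hm := linkable_mem (hD _ _ hy)
    obtain ⟨c, c1, c2, rfl⟩ := hs.lift_pair hm.1 hm.2.1 hm.2.2 i rfl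
    have l1 := hl.lt_ns i hi
    have l2 := hl.lt_ns _ (hl.J_ps i hi)
    rw [hl.ns_ps i hi] at l2
    rw [← xx_add hc (ps i), splits_xx hc l1 (hl.acw i hi) (by omega) c1 c2] at hsp
    exact hl.nosplit i hi c hsp.1 hsp.2 ⟨c1, c2, hy⟩

lemma has_iff (hs : Setup P K θ) : HasStarDecomp P D ↔ IsDiagonalSet P D ∧ Per K (DL K θ D) :=
  ⟨fun ⟨_, h⟩ => ⟨h.1, per_of_decomp hs h⟩, fun h => decomp_of_per hs h.1 h.2⟩

end

end StarFlip


namespace StarFlip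
open Comb

lemma chain_of_rtg {α : Type*} {R : α → α → Prop} {M : α → Prop} {x y : α}
    (h : Relation.ReflTransGen (fun x y => M y ∧ R x y) x y) (hx : M x) :
    ∃ (t : ℕ) (F : ℕ → α), F 0 = x ∧ F t = y ∧ (∀ i ≤ t, M (F i)) ∧
      ∀ i < t, R (F i) (F (i + 1)) := by
  induction h using Relation.ReflTransGen.head_induction_on with
  | refl => exact ⟨0, fun _ => y, rfl, rfl, fun _ _ => hx, fun i hi => absurd hi (by omega)⟩
  | head h1 h2 ih =>
    rename_i a c
    obtain ⟨t, F, f0, ft, f1, f2⟩ := ih h1.1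
    refine ⟨t + 1, fun n => Nat.casesOn n a F, rfl, ft, ?_, ?_⟩
    · intro i hi
      cases i with
      | zero => exact hx
      | succ i => exact f1 i (by omega)
    · intro i hi
      cases i with
      | zero => simpa [f0] using h1.2
      | succ i => exact f2 i (by omega)

lemma small_mul {N : ℕ} {k x y : ℤ} (hx : 0 < x) (hx' : x < N) (hy : 0 < y) (hy' : y < N)
    (e : y = x + k * N) : k = 0 := by
  by_contra hk
  rcases lt_or_gt_of_ne hk with h | h <;> nlinarith

lemma linkable_symm {P : CyclicPolygon} {u v : ℂ} (h : Linkable P u v) : Linkable P v u :=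
  ⟨h.1.symm, h.2.2, h.2.1⟩

/-- The diagonal with a given lift. -/
def lab (θ : ℤ → ℝ) (p : ℤ × ℤ) : Sym2 ℂ := s(xx θ p.1, xx θ p.2)

/-- The letters of a set of diagonals. -/
def hat (K : Comb) (θ : ℤ → ℝ) (D : Set (Sym2 ℂ)) : Set (ℤ × ℤ) :=
  {p | p ∈ Q K K.N ∧ lab θ p ∈ D}

section
variable {P : CyclicPolygon} {K : Comb} {θ : ℤ → ℝ} {D : Set (Sym2 ℂ)}

lemma lab_inj (hs : Setup P K θ) {p q : ℤ × ℤ} (hp : p ∈ Q K K.N) (hq : q ∈ Q K K.N)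
    (e : lab θ p = lab θ q) : p = q := by
  obtain ⟨a, b⟩ := p
  obtain ⟨a', b'⟩ := q
  rw [mem_Q le_rfl] at hp hq
  obtain ⟨h1, h2, h3⟩ := hp
  obtain ⟨h4, h5, h6⟩ := hq
  simp only at h1 h2 h3 h4 h5 h6
  obtain ⟨l1, l2, -⟩ := L_ne h3
  obtain ⟨l3, l4, -⟩ := L_ne h6
  have hc := hs.cov
  have hN := hc.hN
  simp only [lab, Sym2.eq_iff] at e
  rcases e with ⟨e1, e2⟩ | ⟨e1, e2⟩
  · obtain ⟨m, rfl⟩ := (xx_eq_iff hc).mp e1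
    obtain ⟨n, rfl⟩ := (xx_eq_iff hc).mp e2
    have hk : n - m = 0 := small_mul (N := K.N) (x := b - a) (y := b + n * K.N - (a + m * K.N))
      (by omega) (by omega) (by omega) (by omega) (by ring)
    have : n = m := by omega
    subst this
    have hn : n = 0 := by
      by_contra hk
      rcases lt_or_gt_of_ne hk with h | h <;> nlinarith
    subst hn
    simp
  · exfalso
    obtain ⟨m, rfl⟩ := (xx_eq_iff hc).mp e1
    obtain ⟨n, rfl⟩ := (xx_eq_iff hc).mp e2
    have hk : m - n - 1 = 0 := small_mul (N := K.N) (x := a + K.N - b)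
      (y := a + m * K.N - (b + n * K.N))
      (by omega) (by omega) (by omega) (by omega) (by ring)
    have : m = n + 1 := by omega
    subst this
    rcases le_or_gt 0 n with h | h <;> nlinarith

lemma lab_linkable (hs : Setup P K θ) {p : ℤ × ℤ} (hp : p ∈ Q K K.N) {u v : ℂ}
    (e : lab θ p = s(u, v)) : Linkable P u v := by
  rw [mem_Q le_rfl] at hp
  obtain ⟨h1, h2, h3⟩ := hp
  obtain ⟨l1, l2, -⟩ := L_ne h3
  have hl := (hs.linkable l1 l2).mpr h3
  simp only [lab, Sym2.eq_iff] at e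
  rcases e with ⟨rfl, rfl⟩ | ⟨rfl, rfl⟩
  · exact hl
  · exact linkable_symm hl

lemma lab_surj (hs : Setup P K θ) {u v : ℂ} (h : Linkable P u v) :
    ∃ p ∈ Q K K.N, lab θ p = s(u, v) := by
  have hm := linkable_mem h
  have hc := hs.cov
  have hN : (0 : ℤ) < K.N := by exact_mod_cast hc.hN
  obtain ⟨a, rfl⟩ := (hs.hV u).mp hm.1
  obtain ⟨b, b1, b2, rfl⟩ := hs.lift_pair hm.1 hm.2.1 hm.2.2 a rfl
  have d1 := Int.emod_nonneg (a + b - 1) hN.ne'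
  have d2 := Int.emod_lt_of_pos (a + b - 1) hN
  have d3 := Int.mul_ediv_add_emod (a + b - 1) K.N
  set m := (a + b - 1) / K.N with hmdef
  set r := (a + b - 1) % K.N
  rcases Int.even_or_odd' m with ⟨k, hk | hk⟩
  · rw [hk] at d3
    have x1 := xx_add_mul hc a (-k)
    have x2 := xx_add_mul hc b (-k)
    refine ⟨(a + -k * K.N, b + -k * K.N), ?_, ?_⟩
    · rw [mem_Q le_rfl]
      refine ⟨by linarith, by linarith, ?_⟩
      rw [← hs.linkable (by simpa using b1) (by simp only; linarith), x1, x2]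
      exact h
    · simp only [lab, x1, x2]
  · rw [hk] at d3
    have x1 := xx_add_mul hc a (-k)
    have x2 := xx_add_mul hc b (-k - 1)
    refine ⟨(b + (-k - 1) * K.N, a + -k * K.N), ?_, ?_⟩
    · rw [mem_Q le_rfl]
      refine ⟨by simp only; linarith, by simp only; linarith, ?_⟩
      rw [← hs.linkable (by simp only; linarith) (by simp only; linarith), x1, x2]
      exact linkable_symm h
    · simp only [lab, x1, x2]
      exact Sym2.eq_swap

lemma hat_sub (e : ℤ × ℤ) (h : e ∈ hat K θ D) : e ∈ Q K K.N := h.1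

lemma hat_img (hs : Setup P K θ) {X : Set (ℤ × ℤ)} (hX : ∀ e ∈ X, e ∈ Q K K.N) :
    hat K θ (lab θ '' X) = X := by
  ext p
  constructor
  · rintro ⟨h1, q, hq, e⟩
    rwa [← lab_inj hs (hX q hq) h1 e]
  · intro hp
    exact ⟨hX p hp, p, hp, rfl⟩

lemma img_hat (hs : Setup P K θ) (hD : IsDiagonalSet P D) : lab θ '' (hat K θ D) = D := by
  ext e
  constructor
  · rintro ⟨p, hp, rfl⟩; exact hp.2
  · intro he
    induction e using Sym2.ind with
    | _ u v =>
      obtain ⟨p, hp, e⟩ := lab_surj hs (hD _ _ he)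
      exact ⟨p, ⟨hp, by rwa [e]⟩, e⟩

lemma img_diag (hs : Setup P K θ) {X : Set (ℤ × ℤ)} (hX : ∀ e ∈ X, e ∈ Q K K.N) :
    IsDiagonalSet P (lab θ '' X) := by
  rintro u v ⟨p, hp, e⟩
  exact lab_linkable hs (hX p hp) e

lemma W_hat : W (lo K) (hi K) (Q K K.N) {p | DL K θ D p.1 p.2} =
    W (lo K) (hi K) (Q K K.N) (hat K θ D) := by
  apply W_congr
  intro p hp
  have hp' := hp
  rw [mem_Q le_rfl] at hp'
  obtain ⟨l1, l2, -⟩ := L_ne hp'.2.2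
  simp only [Set.mem_ofPred_eq, hat, DL, lab, l1, l2, hp, true_and]

lemma has_iff_W (hs : Setup P K θ) {D₁ : Set (Sym2 ℂ)} (h₁ : HasStarDecomp P D₁)
    (hD : IsDiagonalSet P D) : HasStarDecomp P D ↔
      W (lo K) (hi K) (Q K K.N) (hat K θ D) = W (lo K) (hi K) (Q K K.N) (hat K θ D₁) := by
  rw [has_iff hs] at h₁ ⊢
  rw [per_iff_W (hs.isDiag h₁.1) h₁.2 (hs.isDiag hD), W_hat, W_hat]
  simp [hD]

lemma max_iff_W (hs : Setup P K θ) {D₁ : Set (Sym2 ℂ)} (h₁ : HasStarDecomp P D₁)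
    (hD : IsDiagonalSet P D) : (∃ 𝒯, IsMaximalStarDecomp P D 𝒯) ↔
      WMax (lo K) (hi K) (Q K K.N) (W (lo K) (hi K) (Q K K.N) (hat K θ D₁)) (hat K θ D) := by
  constructor
  · rintro ⟨𝒯, h2, h3⟩
    refine ⟨hat_sub, (has_iff_W hs h₁ hD).mp ⟨𝒯, h2⟩, ?_⟩
    intro X hX hXQ e
    apply h3 (lab θ '' X)
    · rw [← img_hat hs hD]
      refine ⟨Set.image_mono hX.1, ?_⟩
      intro hc
      apply hX.2
      intro p hp
      obtain ⟨q, hq, e⟩ := hc ⟨p, hp, rfl⟩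
      rwa [← lab_inj hs hq.1 (hXQ p hp) e]
    · rw [has_iff_W hs h₁ (img_diag hs hXQ), hat_img hs hXQ, e]
  · rintro ⟨-, h2, h3⟩
    obtain ⟨𝒯, hT⟩ := (has_iff_W hs h₁ hD).mpr h2
    refine ⟨𝒯, hT, ?_⟩
    intro D' hD' hh
    have hd' : IsDiagonalSet P D' := hh.choose_spec.1
    refine h3 (hat K θ D') ⟨?_, ?_⟩ hat_sub ((has_iff_W hs h₁ hd').mp hh)
    · intro p hp; exact ⟨hp.1, hD'.1 hp.2⟩
    · intro hc
      apply hD'.2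
      rw [← img_hat hs hD, ← img_hat hs hd']
      exact Set.image_mono hc

lemma img_flip (hs : Setup P K θ) {X Y : Set (ℤ × ℤ)} (hX : ∀ e ∈ X, e ∈ Q K K.N)
    (hY : ∀ e ∈ Y, e ∈ Q K K.N) {e f : ℤ × ℤ} (he : e ∈ X) (hf : f ∉ X)
    (hXY : Y = (X \ {e}) ∪ {f}) : FlipStep (lab θ '' X) (lab θ '' Y) := by
  have hfQ : f ∈ Q K K.N := hY f (by rw [hXY]; exact Or.inr rfl)
  refine ⟨lab θ e, lab θ f, ⟨e, he, rfl⟩, ?_, ?_⟩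
  · rintro ⟨q, hq, e⟩
    exact hf (by rwa [← lab_inj hs (hX q hq) hfQ e])
  · rw [hXY]
    ext d
    constructor
    · rintro ⟨q, hq | hq, rfl⟩
      · refine Or.inl ⟨⟨q, hq.1, rfl⟩, ?_⟩
        intro h
        exact hq.2 (lab_inj hs (hX q hq.1) (hX e he) h)
      · rw [hq]; exact Or.inr rfl
    · rintro (⟨⟨q, hq, rfl⟩, h2⟩ | h)
      · refine ⟨q, Or.inl ⟨hq, ?_⟩, rfl⟩
        rintro rfl
        exact h2 rfl
      · exact ⟨f, Or.inr rfl, h.symm⟩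

end

theorem connectivity (P : CyclicPolygon) (D₁ D₂ : Set (Sym2 ℂ))
    (𝒮₁ 𝒮₂ : Finset CyclicPolygon)
    (h₁ : IsMaximalStarDecomp P D₁ 𝒮₁) (h₂ : IsMaximalStarDecomp P D₂ 𝒮₂) :
    ∃ (t : ℕ) (F : ℕ → Set (Sym2 ℂ)),
      F 0 = D₁ ∧ F t = D₂ ∧
      (∀ i ≤ t, ∃ 𝒯 : Finset CyclicPolygon, IsMaximalStarDecomp P (F i) 𝒯) ∧
      (∀ i < t, FlipStep (F i) (F (i + 1))) := by
  obtain ⟨K, θ, hs⟩ := setup_exists P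
  have hH : HasStarDecomp P D₁ := ⟨_, h₁.1⟩
  have hd₁ := h₁.1.1
  have hd₂ := h₂.1.1
  have w₁ := (max_iff_W hs hH hd₁).mp ⟨_, h₁⟩
  have w₂ := (max_iff_W hs hH hd₂).mp ⟨_, h₂⟩
  have key := word_connected (kap_inj 0) (nodup_Q (K := K) le_rfl) (fun e he => adj_Q he) _ w₁ w₂
  apply chain_of_rtg (M := fun D => ∃ 𝒯, IsMaximalStarDecomp P D 𝒯) (R := FlipStep) _ ⟨_, h₁⟩
  rw [← img_hat hs hd₁, ← img_hat hs hd₂]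
  have := Relation.ReflTransGen.lift (p := fun D D' =>
    (∃ 𝒯, IsMaximalStarDecomp P D' 𝒯) ∧ FlipStep D D') (fun X => lab θ '' X) ?_ _ _ key
  · exact this
  · rintro X Y ⟨hX, hY, e, f, he, hf, hXY⟩
    refine ⟨?_, img_flip hs hX hY.1 he hf hXY⟩
    rw [max_iff_W hs hH (img_diag hs hY.1), hat_img hs hY.1]
    exact hY

end StarFlip

/-- Any two maximal star decompositions of a common cyclic polygon are
connected by a finite sequence of diagonal flips through maximal star decompositions. -/
theorem flip_connectivity (P : CyclicPolygon) (D₁ D₂ : Set (Sym2 ℂ))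
    (𝒮₁ 𝒮₂ : Finset CyclicPolygon)
    (h₁ : IsMaximalStarDecomp P D₁ 𝒮₁) (h₂ : IsMaximalStarDecomp P D₂ 𝒮₂) :
    ∃ (t : ℕ) (F : ℕ → Set (Sym2 ℂ)),
      F 0 = D₁ ∧ F t = D₂ ∧
      (∀ i ≤ t, ∃ 𝒯 : Finset CyclicPolygon, IsMaximalStarDecomp P (F i) 𝒯) ∧
      (∀ i < t, FlipStep (F i) (F (i + 1))) := by
  exact StarFlip.connectivity P D₁ D₂ 𝒮₁ 𝒮₂ h₁ h₂

end
end

section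
/- Let P be a cyclic polygon with n vertices and rotation number r, and let S be a star decomposition of P. Then S contains exactly n − 2r stars. -/
open Complex
open scoped Classical

noncomputable section

/-! ### Helper lemmas -/

theorem ns_posArc_eq {u v : ℂ} (hu : u ≠ 0) (hv : v ≠ 0) :
    posArc u v = arg v - arg u + (if arg u < arg v then 0 else 2 * Real.pi) := by
  have h1 : ((arg (v / u) : ℝ) : Real.Angle) = ((arg v - arg u : ℝ) : Real.Angle) := by
    rw [Complex.arg_div_coe_angle hv hu]; simp
  rw [Real.Angle.angle_eq_iff_two_pi_dvd_sub] at h1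
  obtain ⟨k, hk⟩ := h1
  have a1 := Complex.neg_pi_lt_arg (v / u)
  have a2 := Complex.arg_le_pi (v / u)
  have b1 := Complex.neg_pi_lt_arg u
  have b2 := Complex.arg_le_pi u
  have c1 := Complex.neg_pi_lt_arg v
  have c2 := Complex.arg_le_pi v
  have hp := Real.pi_pos
  have hklo : -2 < k := by
    have : (-2 : ℝ) < k := by nlinarith
    exact_mod_cast this
  have hkhi : k < 2 := by
    have : (k : ℝ) < 2 := by nlinarith
    exact_mod_cast this
  unfold posArc
  have : k = -1 ∨ k = 0 ∨ k = 1 := by omega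
  rcases this with rfl | rfl | rfl <;> push_cast at hk <;> split_ifs <;> linarith

theorem ns_posArc_pos {u v : ℂ} : 0 < posArc u v := by
  unfold posArc
  have a1 := Complex.neg_pi_lt_arg (v / u)
  split_ifs <;> linarith [Real.pi_pos]

theorem ns_posArc_le {u v : ℂ} : posArc u v ≤ 2 * Real.pi := by
  unfold posArc
  have a1 := Complex.arg_le_pi (v / u)
  split_ifs <;> linarith [Real.pi_pos]

theorem ns_arg_ne {u v : ℂ} (hu : ‖u‖ = 1) (hv : ‖v‖ = 1) (huv : u ≠ v) : arg u ≠ arg v := by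
  intro h
  exact huv (Complex.ext_norm_arg (by rw [hu, hv]) h)

theorem ns_ne_zero {u : ℂ} (hu : ‖u‖ = 1) : u ≠ 0 := by
  intro h; simp [h] at hu

theorem ns_posArc_swap {u v : ℂ} (hu : ‖u‖ = 1) (hv : ‖v‖ = 1) (huv : u ≠ v) :
    posArc v u = 2 * Real.pi - posArc u v := by
  have h := ns_arg_ne hu hv huv
  rw [ns_posArc_eq (ns_ne_zero hu) (ns_ne_zero hv), ns_posArc_eq (ns_ne_zero hv) (ns_ne_zero hu)]
  rcases lt_or_gt_of_ne h with h | h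
  · rw [if_pos h, if_neg (not_lt.2 h.le)]; ring
  · rw [if_pos h, if_neg (not_lt.2 h.le)]; ring

theorem ns_exp_posArc {u v : ℂ} (hu : ‖u‖ = 1) (hv : ‖v‖ = 1) :
    v = u * exp (posArc u v * I) := by
  have h0 : exp (posArc u v * I) = exp (arg (v / u) * I) := by
    unfold posArc
    split_ifs
    · rfl
    · push_cast
      rw [add_mul, Complex.exp_add, Complex.exp_two_pi_mul_I, mul_one]
  have h1 := Complex.norm_mul_exp_arg_mul_I (v / u)
  rw [norm_div, hu, hv] at h1
  rw [h0]
  have hu0 := ns_ne_zero hu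
  have : exp (arg (v / u) * I) = v / u := by simpa using h1
  rw [this]; field_simp

theorem ns_sub_eq (v : ℂ) (α : ℝ) :
    v * exp (α * I) - v = v * exp ((α / 2 : ℝ) * I) * (2 * I) * (Real.sin (α / 2) : ℝ) := by
  have e : exp (α * I) = exp ((α / 2 : ℝ) * I) * exp ((α / 2 : ℝ) * I) := by
    rw [← Complex.exp_add]; congr 1; push_cast; ring
  rw [e, Complex.exp_mul_I]
  push_cast
  have hs := Complex.sin_sq_add_cos_sq ((α : ℂ) / 2)
  set s := Complex.sin ((α : ℂ) / 2)
  set c := Complex.cos ((α : ℂ) / 2)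
  have hI : I * I = -1 := Complex.I_mul_I
  linear_combination v * hs - v * s ^ 2 * hI

theorem ns_vangle {u v w : ℂ} (hu : ‖u‖ = 1) (hv : ‖v‖ = 1) (hw : ‖w‖ = 1) (h : ACW u v w) :
    vangle u v w = (posArc v u - posArc v w) / 2 := by
  obtain ⟨huv, hvw, huw, hlt⟩ := h
  have hαβ : posArc v w < posArc v u := by
    have h1 := ns_arg_ne hu hv huv
    have h2 := ns_arg_ne hv hw hvw
    have h3 := ns_arg_ne hu hw huw
    have b1 := Complex.neg_pi_lt_arg u
    have b2 := Complex.arg_le_pi u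
    have c1 := Complex.neg_pi_lt_arg v
    have c2 := Complex.arg_le_pi v
    have d1 := Complex.neg_pi_lt_arg w
    have d2 := Complex.arg_le_pi w
    rw [ns_posArc_eq (ns_ne_zero hu) (ns_ne_zero hv),
      ns_posArc_eq (ns_ne_zero hu) (ns_ne_zero hw)] at hlt
    rw [ns_posArc_eq (ns_ne_zero hv) (ns_ne_zero hu), ns_posArc_eq (ns_ne_zero hv) (ns_ne_zero hw)]
    rcases lt_or_gt_of_ne h1 with h1 | h1 <;> rcases lt_or_gt_of_ne h2 with h2 | h2 <;>
    rcases lt_or_gt_of_ne h3 with h3 | h3 <;>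
    simp only [h1, h2, h3, not_lt.2 h1.le, not_lt.2 h2.le, not_lt.2 h3.le, if_true, if_false]
      at hlt ⊢ <;> linarith
  have hα2 : posArc v u < 2 * Real.pi := by
    rw [ns_posArc_swap hu hv huv]; linarith [@ns_posArc_pos u v]
  have hβ0 : 0 < posArc v w := ns_posArc_pos
  have eu := ns_exp_posArc hv hu
  have ew := ns_exp_posArc hv hw
  set α := posArc v u
  set β := posArc v w
  have hsα : 0 < Real.sin (α / 2) := Real.sin_pos_of_pos_of_lt_pi (by linarith) (by linarith)
  have hsβ : 0 < Real.sin (β / 2) := Real.sin_pos_of_pos_of_lt_pi (by linarith) (by linarith)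
  have hv0 := ns_ne_zero hv
  have hq : (u - v) / (w - v) =
      ((Real.sin (α / 2) / Real.sin (β / 2) : ℝ) : ℂ) * exp (((α - β) / 2 : ℝ) * I) := by
    rw [eu, ew, ns_sub_eq, ns_sub_eq]
    have hb : ((Real.sin (β / 2) : ℝ) : ℂ) ≠ 0 := by exact_mod_cast hsβ.ne'
    have he : exp (((α / 2 : ℝ) : ℂ) * I) =
        exp (((β / 2 : ℝ) : ℂ) * I) * exp (((α - β) / 2 : ℝ) * I) := by
      rw [← Complex.exp_add]; congr 1; push_cast; ring
    rw [he, Complex.ofReal_div (Real.sin (α / 2)) (Real.sin (β / 2))]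
    have := Complex.exp_ne_zero (((β / 2 : ℝ) : ℂ) * I)
    have := Complex.I_ne_zero
    field_simp
  unfold vangle
  rw [hq, Complex.arg_real_mul _ (div_pos hsα hsβ), Complex.arg_exp_mul_I,
    (toIocMod_eq_self Real.two_pi_pos).2 ⟨by linarith [Real.pi_pos], by linarith⟩, abs_of_pos]
  linarith

theorem ns_next_mem (P : CyclicPolygon) {v : ℂ} (hv : v ∈ P.V) : (v, P.next v) ∈ P.E := by
  have h : ∃ w, (v, w) ∈ P.E := (P.outdeg v hv).exists
  unfold CyclicPolygon.next
  rw [dif_pos h]; exact h.choose_spec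

theorem ns_prev_mem (P : CyclicPolygon) {v : ℂ} (hv : v ∈ P.V) : (P.prev v, v) ∈ P.E := by
  have h : ∃ w, (w, v) ∈ P.E := (P.indeg v hv).exists
  unfold CyclicPolygon.prev
  rw [dif_pos h]; exact h.choose_spec

theorem ns_sum_next (P : CyclicPolygon) (f : ℂ → ℂ → ℝ) :
    ∑ v ∈ P.V, f v (P.next v) = ∑ e ∈ P.E, f e.1 e.2 := by
  refine Finset.sum_bij (fun v _ => (v, P.next v)) (fun v hv => ns_next_mem P hv) ?_ ?_ ?_
  · intro a _ b _ h; exact (Prod.mk.inj h).1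
  · rintro ⟨a, b⟩ he
    have ha := (P.endmem _ he).1
    exact ⟨a, ha, by rw [(P.outdeg a ha).unique (ns_next_mem P ha) he]⟩
  · intros; rfl

theorem ns_sum_prev (P : CyclicPolygon) (f : ℂ → ℂ → ℝ) :
    ∑ v ∈ P.V, f (P.prev v) v = ∑ e ∈ P.E, f e.1 e.2 := by
  refine Finset.sum_bij (fun v _ => (P.prev v, v)) (fun v hv => ns_prev_mem P hv) ?_ ?_ ?_
  · intro a _ b _ h; exact (Prod.mk.inj h).2
  · rintro ⟨a, b⟩ he
    have hb := (P.endmem _ he).2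
    exact ⟨b, hb, by rw [(P.indeg b hb).unique (ns_prev_mem P hb) he]⟩
  · intros; rfl

theorem ns_edge_ne (P : CyclicPolygon) {u v : ℂ} (h : (u, v) ∈ P.E) : u ≠ v :=
  (P.acw u v _ h (ns_next_mem P (P.endmem _ h).2)).1

theorem ns_card_E (P : CyclicPolygon) : (P.E.card : ℝ) = P.V.card := by
  have := ns_sum_next P (fun _ _ => 1)
  simpa using this.symm

/-- The interior angle sum as a sum over edges. -/
theorem ns_interior_sum (P : CyclicPolygon) :
    ∑ v ∈ P.V, interiorAngle P v = ∑ e ∈ P.E, (Real.pi - posArc e.1 e.2) := by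
  have h1 : ∀ v ∈ P.V, interiorAngle P v =
      (posArc v (P.prev v)) / 2 - (posArc v (P.next v)) / 2 := by
    intro v hv
    have hp := ns_prev_mem P hv
    have hn := ns_next_mem P hv
    unfold interiorAngle
    rw [ns_vangle (P.onCircle _ (P.endmem _ hp).1) (P.onCircle _ hv)
      (P.onCircle _ (P.endmem _ hn).2) (P.acw _ _ _ hp hn)]
    ring
  rw [Finset.sum_congr rfl h1, Finset.sum_sub_distrib,
    ns_sum_next P (fun a b => posArc a b / 2), ns_sum_prev P (fun a b => posArc b a / 2),
    ← Finset.sum_sub_distrib]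
  refine Finset.sum_congr rfl ?_
  rintro ⟨a, b⟩ he
  have hab := ns_edge_ne P he
  simp only
  rw [ns_posArc_swap (P.onCircle _ (P.endmem _ he).1) (P.onCircle _ (P.endmem _ he).2) hab]
  ring

/-- Rank of a vertex. -/
def nsRank (P : CyclicPolygon) (v : ℂ) : ℕ := (P.V.filter fun x => arg x < arg v).card

theorem ns_edgeLength (P : CyclicPolygon) {u v : ℂ} (hu : u ∈ P.V) (hv : v ∈ P.V) (huv : u ≠ v) :
    (edgeLength P u v : ℝ) =
      nsRank P v - nsRank P u + (if arg u < arg v then 0 else (P.V.card : ℝ)) := by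
  have hmem : ∀ x ∈ P.V, x ∈ arcOO u v ↔
      (if arg u < arg v then arg u < arg x ∧ arg x < arg v
        else arg u < arg x ∨ arg x < arg v) := by
    intro x hx
    have hU := P.onCircle u hu
    have hVv := P.onCircle v hv
    have hX := P.onCircle x hx
    have h1 := ns_arg_ne hU hVv huv
    have b1 := Complex.neg_pi_lt_arg u
    have b2 := Complex.arg_le_pi u
    have c1 := Complex.neg_pi_lt_arg v
    have c2 := Complex.arg_le_pi v
    have d1 := Complex.neg_pi_lt_arg x
    have d2 := Complex.arg_le_pi x
    unfold arcOO
    simp only [Set.mem_ofPred_eq]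
    by_cases hxu : x = u
    · subst hxu; simp only [ne_eq, not_true_eq_false, false_and, lt_irrefl, false_or, false_iff]
      split_ifs with h <;> simp [h]
    by_cases hxv : x = v
    · subst hxv; simp only [ne_eq, not_true_eq_false, false_and, and_false, lt_irrefl, or_false,
        false_iff]
      split_ifs with h <;> simp [h]
    have h2 := ns_arg_ne hX hU hxu
    have h3 := ns_arg_ne hX hVv hxv
    rw [ns_posArc_eq (ns_ne_zero hU) (ns_ne_zero hX),
      ns_posArc_eq (ns_ne_zero hU) (ns_ne_zero hVv)]
    simp only [ne_eq, hxu, hxv, not_false_eq_true, true_and]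
    rcases lt_or_gt_of_ne h1 with h1 | h1 <;> rcases lt_or_gt_of_ne h2 with h2 | h2 <;>
    rcases lt_or_gt_of_ne h3 with h3 | h3 <;>
    simp only [h1, h2, h3, not_lt.2 h1.le, not_lt.2 h2.le, not_lt.2 h3.le, if_true, if_false,
      true_and, and_true, false_and, and_false, or_true, true_or, or_false, false_or, iff_true,
      iff_false, not_lt] <;> linarith
  have hset : ((P.V : Set ℂ) ∩ arcOO u v) = ((P.V.filter fun x => x ∈ arcOO u v : Finset ℂ) : Set ℂ) := by
    ext x; simp
  unfold edgeLength
  rw [hset, Set.ncard_coe_finset, Finset.filter_congr hmem]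
  have hne := ns_arg_ne (P.onCircle u hu) (P.onCircle v hv) huv
  -- vertices with arg ≤ arg u
  have hle : (P.V.filter fun x => arg x ≤ arg u).card = nsRank P u + 1 := by
    have : (P.V.filter fun x => arg x ≤ arg u) = insert u (P.V.filter fun x => arg x < arg u) := by
      ext x
      simp only [Finset.mem_filter, Finset.mem_insert]
      constructor
      · rintro ⟨hx, h⟩
        by_cases hxu : x = u
        · exact Or.inl hxu
        · exact Or.inr ⟨hx, lt_of_le_of_ne h (ns_arg_ne (P.onCircle x hx) (P.onCircle u hu) hxu)⟩
      · rintro (rfl | ⟨hx, h⟩)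
        · exact ⟨hu, le_rfl⟩
        · exact ⟨hx, h.le⟩
    rw [this, Finset.card_insert_of_notMem (by simp)]; rfl
  split_ifs with h
  · have : (P.V.filter fun x => arg x < arg v) =
        (P.V.filter fun x => arg x ≤ arg u) ∪
          (P.V.filter fun x => arg u < arg x ∧ arg x < arg v) := by
      ext x
      simp only [Finset.mem_filter, Finset.mem_union]
      constructor
      · rintro ⟨hx, h'⟩
        rcases le_or_gt (arg x) (arg u) with h2 | h2
        · exact Or.inl ⟨hx, h2⟩
        · exact Or.inr ⟨hx, h2, h'⟩
      · rintro (⟨hx, h2⟩ | ⟨hx, _, h2⟩)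
        · exact ⟨hx, by linarith⟩
        · exact ⟨hx, h2⟩
    have hc : nsRank P v = _ := congrArg Finset.card this
    rw [Finset.card_union_of_disjoint, hle] at hc
    · rw [hc]; push_cast; ring
    · rw [Finset.disjoint_filter]; intro x _ h1 h2; linarith [h2.1]
  · have h : arg v < arg u := lt_of_le_of_ne (not_lt.1 h) hne.symm
    have e1 : (P.V.filter fun x => arg u < arg x ∨ arg x < arg v).card =
        (P.V.filter fun x => arg u < arg x).card + nsRank P v := by
      rw [Finset.filter_or, Finset.card_union_of_disjoint]
      · rfl
      · rw [Finset.disjoint_filter]; intro x _ h1 h2; linarith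
    have e2 := Finset.card_filter_add_card_filter_not (s := P.V) (fun x => arg x ≤ arg u)
    simp only [not_le] at e2
    rw [hle] at e2
    rw [e1, ← e2]; push_cast; ring

theorem ns_star_sum (S : CyclicPolygon) (hS : IsStar S) :
    ∑ e ∈ S.E, (Real.pi - posArc e.1 e.2) = Real.pi := by
  obtain ⟨k, hk, hcard, hlen⟩ := hS
  have tele : ∀ g : ℂ → ℝ, ∑ e ∈ S.E, (g e.2 - g e.1) = 0 := by
    intro g
    rw [Finset.sum_sub_distrib, ← ns_sum_next S (fun a _ => g a), ← ns_sum_prev S (fun _ b => g b)]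
    simp
  have hE := ns_card_E S
  set W : ℝ := ∑ e ∈ S.E, (if arg e.1 < arg e.2 then (0 : ℝ) else 1) with hW
  have s1 : ∑ e ∈ S.E, posArc e.1 e.2 = 2 * Real.pi * W := by
    have : ∀ e ∈ S.E, posArc e.1 e.2 = (arg e.2 - arg e.1) +
        2 * Real.pi * (if arg e.1 < arg e.2 then (0 : ℝ) else 1) := by
      intro e he
      have hm := S.endmem e he
      rw [ns_posArc_eq (ns_ne_zero (S.onCircle _ hm.1)) (ns_ne_zero (S.onCircle _ hm.2))]
      split_ifs <;> ring
    rw [Finset.sum_congr rfl this, Finset.sum_add_distrib, tele, ← Finset.mul_sum, zero_add]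
  have s2 : (S.E.card : ℝ) * k = S.V.card * W := by
    have : ∀ e ∈ S.E, (k : ℝ) = ((nsRank S e.2 : ℝ) - nsRank S e.1) +
        S.V.card * (if arg e.1 < arg e.2 then (0 : ℝ) else 1) := by
      intro e he
      have hm := S.endmem e he
      rw [← hlen e he, ns_edgeLength S hm.1 hm.2 (ns_edge_ne S he)]
      split_ifs <;> ring
    have h2 := Finset.sum_congr (rfl : S.E = S.E) this
    rw [Finset.sum_add_distrib, tele (fun x => (nsRank S x : ℝ)), ← Finset.mul_sum, zero_add] at h2
    simpa using h2
  have hVpos : (S.V.card : ℝ) ≠ 0 := by rw [hcard]; positivity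
  rw [hE] at s2
  have hWk : W = k := (mul_left_cancel₀ hVpos s2).symm
  rw [Finset.sum_sub_distrib, s1, hWk, Finset.sum_const, nsmul_eq_mul, hE, hcard]
  push_cast; ring

/-- A star decomposition of a cyclic polygon with `n` vertices and rotation
number `r` contains exactly `n - 2r` stars. -/
theorem num_stars (P : CyclicPolygon) (r : ℕ) (hr : 0 < r)
    (hrot : ∑ v ∈ P.V, (Real.pi - interiorAngle P v) = 2 * Real.pi * r)
    (D : Set (Sym2 ℂ)) (𝒮 : Finset CyclicPolygon) (h : IsStarDecomp P D 𝒮) :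
    (𝒮.card : ℤ) = (P.V.card : ℤ) - 2 * r := by
  obtain ⟨hD, hstar, hsub, hcov, hdisj, -⟩ := h
  have hDV : ∀ u v : ℂ, s(u, v) ∈ D → u ∈ P.V ∧ v ∈ P.V ∧ u ≠ v ∧ (u, v) ∉ P.E := by
    intro u v huv
    obtain ⟨hne, h1, h2⟩ := hD u v huv
    refine ⟨h1.1, h2.1, hne, fun he => ?_⟩
    have hv : P.next u = v := (P.outdeg u h1.1).unique (ns_next_mem P h1.1) he
    have h3 := h1.2.2.1
    rw [hv] at h3
    have hz : v - u ≠ 0 := sub_ne_zero.2 hne.symm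
    unfold vangle at h3
    rw [div_self hz] at h3
    simp at h3
  set T : Finset (ℂ × ℂ) := (P.V ×ˢ P.V).filter fun e => s(e.1, e.2) ∈ D with hT
  have hTmem : ∀ e : ℂ × ℂ, e ∈ T ↔ s(e.1, e.2) ∈ D := by
    intro e
    simp only [hT, Finset.mem_filter, Finset.mem_product, and_iff_right_iff_imp]
    intro he
    exact ⟨(hDV _ _ he).1, (hDV _ _ he).2.1⟩
  have hTsum : ∑ e ∈ T, (Real.pi - posArc e.1 e.2) = 0 := by
    refine Finset.sum_involution (fun e _ => e.swap) ?_ ?_ ?_ ?_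
    · rintro ⟨a, b⟩ he
      have h1 := hDV _ _ ((hTmem _).1 he)
      simp only [Prod.fst_swap, Prod.snd_swap]
      rw [ns_posArc_swap (P.onCircle _ h1.1) (P.onCircle _ h1.2.1) h1.2.2.1]
      ring
    · rintro ⟨a, b⟩ he _ h2
      have h1 := hDV _ _ ((hTmem _).1 he)
      exact h1.2.2.1 (Prod.mk.inj h2).2
    · rintro ⟨a, b⟩ he
      rw [hTmem] at he ⊢
      simpa [Sym2.eq_swap] using he
    · intros; simp
  have hU : 𝒮.biUnion (fun S => S.E) = P.E ∪ T := by
    ext e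
    simp only [Finset.mem_biUnion, Finset.mem_union, hTmem]
    constructor
    · rintro ⟨S, hS, he⟩
      exact hsub S hS he
    · intro he
      exact hcov e he
  have hPT : Disjoint P.E T := by
    rw [Finset.disjoint_left]
    rintro ⟨a, b⟩ he hT'
    exact (hDV _ _ ((hTmem _).1 hT')).2.2.2 he
  have key : ∑ S ∈ 𝒮, ∑ e ∈ S.E, (Real.pi - posArc e.1 e.2) =
      ∑ e ∈ P.E, (Real.pi - posArc e.1 e.2) := by
    rw [← Finset.sum_biUnion, hU, Finset.sum_union hPT, hTsum, add_zero]
    intro S₁ h1 S₂ h2 hne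
    exact Finset.disjoint_left.2 fun e he => hdisj S₁ h1 S₂ h2 hne e he
  rw [Finset.sum_congr rfl (fun S hS => ns_star_sum S (hstar S hS).1), ← ns_interior_sum,
    Finset.sum_const, nsmul_eq_mul] at key
  rw [Finset.sum_sub_distrib, Finset.sum_const, nsmul_eq_mul, ← key] at hrot
  have hfin : (𝒮.card : ℝ) = P.V.card - 2 * r := by
    have : Real.pi * (𝒮.card : ℝ) = Real.pi * (P.V.card - 2 * r) := by linarith
    exact mul_left_cancel₀ Real.pi_ne_zero this
  exact_mod_cast hfin

end
end
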